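/- arXiv:1011.3494 — 2 statements merged into one kernel-verified Lean document; each statement's English description precedes it below -/
import Mathlib

section
/- (Kac–Ward formula) Let G=(V,E) be a finite simple planar graph with |V| = n, embedded in the plane by an injective map v : V → ℂ with edges drawn as straight line segments, such that the closed segments [v_i, v_j] of distinct edges intersect only at shared endpoints and no vertex lies in the relative interior of any edge segment. Let θ : E → ℝ be edge parameters and let Z = ∑_{x∈{−1,+1}^V} exp(∑_{{i,j}∈E} θ_{ij} x_i x_j) be the partition function of the zero-field Ising model on G. For directed edges, let φ_{ijl} ∈ (−π,π] be the turning angle from (i,j) to (j,l), i.e. the argument of (v_l − v_j)/(v_j − v_i). Define the matrix W ∈ ℂ^{2|E|×2|E|}, indexed by directed edges, by W = A D, where D is diagonal with D_{(i,j),(i,j)} = tanh θ_{ij}, and A_{(i,j),(k,l)} = exp((√−1/2)·φ_{ijl}) if j=k and i≠l, and A_{(i,j),(k,l)} = 0 otherwise. Then det(I − W) is a nonnegative real number and Z = 2^n (∏_{{i,j}∈E} cosh θ_{ij}) · det(I − W)^{1/2}; equivalently, Z² = 4^n (∏_{{i,j}∈E} cosh θ_{ij})² · det(I − W). -/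
noncomputable section

/-- The spin value ±1 associated to a Boolean. -/
def spin (b : Bool) : ℝ := if b then 1 else -1

variable {V : Type*} [Fintype V] [DecidableEq V]

/-- The product σᵢσⱼ over an unordered pair. -/
def pairProd (σ : V → ℝ) : Sym2 V → ℝ :=
  Sym2.lift ⟨fun i j => σ i * σ j, fun i j => mul_comm (σ i) (σ j)⟩

/-- Energy (exponent) of an Ising model with vertex parameters θv and edge parameters θe. -/
def energy (G : SimpleGraph V) [DecidableRel G.Adj]
    (θv : V → ℝ) (θe : Sym2 V → ℝ) (x : V → Bool) : ℝ :=
  ∑ i, θv i * spin (x i) + ∑ e ∈ G.edgeFinset, θe e * pairProd (fun i => spin (x i)) e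

/-- Partition function of the Ising model. -/
def partitionFn (G : SimpleGraph V) [DecidableRel G.Adj]
    (θv : V → ℝ) (θe : Sym2 V → ℝ) : ℝ :=
  ∑ x : V → Bool, Real.exp (energy G θv θe x)

/-- Probability mass function of the Ising model. -/
def isingProb (G : SimpleGraph V) [DecidableRel G.Adj]
    (θv : V → ℝ) (θe : Sym2 V → ℝ) (x : V → Bool) : ℝ :=
  Real.exp (energy G θv θe x) / partitionFn G θv θe

/-- Pair moment E_θ[x_i x_j]. -/
def momentPair (G : SimpleGraph V) [DecidableRel G.Adj]
    (θv : V → ℝ) (θe : Sym2 V → ℝ) (i j : V) : ℝ :=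
  ∑ x : V → Bool, isingProb G θv θe x * spin (x i) * spin (x j)

/-- Single-site moment (mean) E_θ[x_i]. -/
def momentSingle (G : SimpleGraph V) [DecidableRel G.Adj]
    (θv : V → ℝ) (θe : Sym2 V → ℝ) (i : V) : ℝ :=
  ∑ x : V → Bool, isingProb G θv θe x * spin (x i)


namespace KW
open Matrix Finset

section pf
variable {E : Type*} [Fintype E] [DecidableEq E] {R : Type*} [CommRing R]

/-- Unnormalised Pfaffian. -/
def pfn (M : Matrix (E × Bool) (E × Bool) R) : R :=
  ∑ σ : Equiv.Perm (E × Bool), ((Equiv.Perm.sign σ : ℤ) : R) *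
    ∏ e, M (σ (e, false)) (σ (e, true))

/-- standard symplectic matrix -/
def J (E : Type*) [DecidableEq E] (R : Type*) [CommRing R] : Matrix (E × Bool) (E × Bool) R :=
  Matrix.of fun a c => if a.1 = c.1 then
    (if a.2 = c.2 then 0 else if a.2 = false then 1 else -1) else 0

/-- pairs of maps as maps from the product -/
def pairEquiv (E H : Type*) : (E × Bool → H) ≃ (E → H × H) where
  toFun p := fun e => (p (e, false), p (e, true))
  invFun q := fun h => if h.2 then (q h.1).2 else (q h.1).1
  left_inv p := by ext ⟨e, b⟩; cases b <;> simp
  right_inv q := by ext e <;> simp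

theorem pfn_congr (B M : Matrix (E × Bool) (E × Bool) R) :
    pfn (B * M * Bᵀ) = B.det * pfn M := by
  have key : ∀ p : E × Bool → E × Bool,
      ∑ σ : Equiv.Perm (E × Bool), ((Equiv.Perm.sign σ : ℤ) : R) * ∏ h, B (σ h) (p h)
        = (B.submatrix id p).det := by
    intro p
    rw [Matrix.det_apply']
    rfl
  have h1 : ∀ x y, (B * M * Bᵀ) x y
      = ∑ q : (E × Bool) × (E × Bool), M q.1 q.2 * (B x q.1 * B y q.2) := by
    intro x y
    rw [Fintype.sum_prod_type]
    simp only [Matrix.mul_apply, Matrix.transpose_apply, Finset.sum_mul]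
    rw [Finset.sum_comm]
    refine Finset.sum_congr rfl fun a _ => Finset.sum_congr rfl fun c _ => by ring
  calc pfn (B * M * Bᵀ)
      = ∑ q : E → (E × Bool) × (E × Bool), ∑ σ : Equiv.Perm (E × Bool),
          ((Equiv.Perm.sign σ : ℤ) : R) * ∏ e, (M (q e).1 (q e).2 *
            (B (σ (e, false)) (q e).1 * B (σ (e, true)) (q e).2)) := by
        simp only [pfn, h1, Finset.prod_univ_sum, Finset.mul_sum, Fintype.piFinset_univ]
        rw [Finset.sum_comm]
    _ = ∑ p : E × Bool → E × Bool, (∏ e, M (p (e, false)) (p (e, true))) *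
          (B.submatrix id p).det := by
        symm
        refine Fintype.sum_equiv (pairEquiv E (E × Bool)) _ _ fun p => ?_
        rw [← key, Finset.mul_sum]
        refine Finset.sum_congr rfl fun σ _ => ?_
        rw [Finset.prod_mul_distrib, Fintype.prod_prod_type]
        simp only [Fintype.prod_bool, pairEquiv, Equiv.coe_fn_mk]
        simp only [mul_comm]
        ring
    _ = ∑ p : E × Bool → E × Bool with Function.Bijective p,
          (∏ e, M (p (e, false)) (p (e, true))) * (B.submatrix id p).det := by
        refine (sum_subset (filter_subset _ _) fun f _ hbij ↦ ?_).symm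
        have hb : ¬ Function.Injective f := by
          rw [Finite.injective_iff_bijective]
          simpa only [mem_filter_univ] using hbij
        simp only [Function.Injective, not_forall] at hb
        obtain ⟨i, j, hij, hne⟩ := hb
        rw [Matrix.det_zero_of_column_eq hne, mul_zero]
        intro k
        simp [hij]
    _ = ∑ τ : Equiv.Perm (E × Bool),
          (∏ e, M (τ (e, false)) (τ (e, true))) * (B.submatrix id τ).det :=
      sum_bij (fun p h ↦ Equiv.ofBijective p (mem_filter.1 h).2) (fun _ _ ↦ mem_univ _)
        (fun _ _ _ _ h ↦ by injection h)
        (fun b _ ↦ ⟨b, mem_filter.2 ⟨mem_univ _, b.bijective⟩, DFunLike.coe_injective rfl⟩)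
        fun _ _ ↦ rfl
    _ = B.det * pfn M := by
        rw [pfn, Finset.mul_sum]
        refine Finset.sum_congr rfl fun τ _ => ?_
        rw [Matrix.det_permute']
        ring

theorem pfn_map {S : Type*} [CommRing S] (f : R →+* S) (M : Matrix (E × Bool) (E × Bool) R) :
    pfn (M.map f) = f (pfn M) := by
  simp [pfn, map_sum, map_mul, map_prod]

theorem J_map {S : Type*} [CommRing S] (f : R →+* S) : (J E R).map f = J E S := by
  ext a c
  simp only [J, Matrix.map_apply, Matrix.of_apply]
  split_ifs <;> simp

theorem J_transpose : (J E R)ᵀ = -J E R := by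
  ext ⟨a, s⟩ ⟨c, t⟩
  simp only [J, Matrix.transpose_apply, Matrix.of_apply, Matrix.neg_apply]
  by_cases h : a = c
  · subst h; cases s <;> cases t <;> simp
  · simp [h, Ne.symm h]

theorem J_mul_J : J E R * J E R = -1 := by
  ext ⟨a, s⟩ ⟨c, t⟩
  simp only [J, Matrix.mul_apply, Matrix.of_apply, Matrix.neg_apply, Fintype.sum_prod_type,
    Fintype.sum_bool, Matrix.one_apply]
  by_cases h : a = c
  · subst h; cases s <;> cases t <;> simp
  · simp only [Prod.mk.injEq, h, false_and, if_false, neg_zero]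
    refine Finset.sum_eq_zero fun x _ => ?_
    by_cases h1 : a = x
    · subst h1; simp [h]
    · simp [h1]

theorem pfn_J_pos : 0 < pfn (J E ℝ) := by
  have hterm : ∀ σ : Equiv.Perm (E × Bool), 0 ≤ ((Equiv.Perm.sign σ : ℤ) : ℝ) *
    ∏ e, J E ℝ (σ (e, false)) (σ (e, true)) := by
    intro σ
    by_cases h0 : ∃ e, J E ℝ (σ (e, false)) (σ (e, true)) = 0
    · obtain ⟨e, he⟩ := h0
      rw [Finset.prod_eq_zero (mem_univ e) he, mul_zero]
    · push Not at h0
      have hsame : ∀ e, (σ (e, false)).1 = (σ (e, true)).1 := by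
        intro e; by_contra hne; exact h0 e (by simp [J, hne])
      have hdiff : ∀ e, (σ (e, true)).2 = !(σ (e, false)).2 := by
        intro e
        have : (σ (e, false)).2 ≠ (σ (e, true)).2 := by
          intro hne; exact h0 e (by simp [J, hne])
        revert this
        cases (σ (e, false)).2 <;> cases (σ (e, true)).2 <;> simp
      let g : E → E := fun e => (σ (e, false)).1
      have hσ : ∀ e s, σ (e, s) = (g e, if (σ (e, false)).2 then !s else s) := by
        intro e s
        cases s
        · ext <;> simp [g]
        · ext
          · simp [g, hsame]
          · simp [hdiff]
      have hgs : Function.Surjective g := by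
        intro x
        obtain ⟨⟨e, s⟩, hx⟩ := σ.surjective (x, true)
        exact ⟨e, by rw [hσ] at hx; exact (Prod.ext_iff.1 hx).1⟩
      let π : Equiv.Perm E := Equiv.ofBijective g (Finite.surjective_iff_bijective.1 hgs)
      let fl : E → Equiv.Perm Bool := fun e => if (σ (e, false)).2 then Equiv.swap false true else 1
      have hdec : σ = (Equiv.prodCongrLeft (fun _ : Bool => π)) * (Equiv.prodCongrRight fl) := by
        ext1 ⟨e, s⟩
        rw [hσ]
        simp only [Equiv.Perm.mul_apply, Equiv.prodCongrRight_apply, Equiv.prodCongrLeft_apply, fl, π,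
          Equiv.ofBijective_apply]
        congr 1
        cases (σ (e, false)).2 <;> cases s <;> simp
      have hsign : Equiv.Perm.sign σ = ∏ e, (if (σ (e, false)).2 then (-1 : ℤˣ) else 1) := by
        conv_lhs => rw [hdec]
        rw [Equiv.Perm.sign_mul, Equiv.Perm.sign_prodCongrRight, Equiv.Perm.sign_prodCongrLeft]
        simp only [Fintype.prod_bool, Int.units_mul_self, one_mul, fl]
        refine Finset.prod_congr rfl fun e _ => ?_
        split_ifs <;> simp
      rw [hsign]
      push_cast
      rw [← Finset.prod_mul_distrib]
      refine Finset.prod_nonneg fun e _ => ?_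
      simp only [J, Matrix.of_apply, hsame, hdiff, if_true]
      cases (σ (e, false)).2 <;> simp
  unfold pfn
  refine Finset.sum_pos' (fun σ _ => hterm σ) ⟨1, mem_univ _, ?_⟩
  simp [J]

end pf
end KW

namespace KW
open Matrix Finset

section pfsq
variable {E : Type*} [Fintype E] [DecidableEq E]

theorem exists_sqrt_coeff : ∃ b : ℕ → ℝ, ∀ n, ∑ p ∈ antidiagonal n, b p.1 * b p.2
    = if n = 0 then 1 else if n = 1 then 1 else 0 := by
  refine ⟨fun n => PowerSeries.coeff n (PowerSeries.binomialSeries ℝ (1/2 : ℚ)), fun n => ?_⟩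
  rw [← PowerSeries.coeff_mul, ← PowerSeries.binomialSeries_add]
  have : (1/2 + 1/2 : ℚ) = ((1 : ℕ) : ℚ) := by norm_num
  rw [this, PowerSeries.binomialSeries_nat]
  simp only [pow_one, map_add, PowerSeries.coeff_one, PowerSeries.coeff_X]
  rcases n with _ | n
  · simp
  · simp

theorem pfn_sq_powerSeries (Q : Matrix (E × Bool) (E × Bool) ℝ) (hQ : Qᵀ = -Q) :
    pfn (J E (PowerSeries ℝ) + (PowerSeries.X : PowerSeries ℝ) • Q.map (PowerSeries.C (R := ℝ))) ^ 2
    = (1 - (PowerSeries.X : PowerSeries ℝ) •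
        (Q.map (PowerSeries.C (R := ℝ)) * J E (PowerSeries ℝ))).det *
      (pfn (J E (PowerSeries ℝ))) ^ 2 := by
  obtain ⟨b, hb⟩ := exists_sqrt_coeff
  set Y : Matrix (E × Bool) (E × Bool) ℝ := - (Q * J E ℝ) with hY
  let B : Matrix (E × Bool) (E × Bool) (PowerSeries ℝ) :=
    Matrix.of fun i j => PowerSeries.mk fun k => b k * (Y ^ k) i j
  have hYJ : Y * J E ℝ = J E ℝ * Yᵀ := by
    simp only [hY, transpose_neg, transpose_mul, J_transpose, hQ, neg_mul, mul_neg, neg_neg,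
      Matrix.mul_assoc, J_mul_J, mul_one]
    rw [← Matrix.mul_assoc, J_mul_J]
    simp
  have hYkJ : ∀ k, Y ^ k * J E ℝ = J E ℝ * (Y ^ k)ᵀ := by
    intro k
    induction k with
    | zero => simp
    | succ k ih =>
      rw [pow_succ, Matrix.mul_assoc, hYJ, ← Matrix.mul_assoc, ih, Matrix.mul_assoc,
        ← Matrix.transpose_mul, ← pow_succ', pow_succ]
  have hJC : J E (PowerSeries ℝ) = (J E ℝ).map (PowerSeries.C (R := ℝ)) := (J_map _).symm
  have hBJ : B * J E (PowerSeries ℝ) = J E (PowerSeries ℝ) * Bᵀ := by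
    ext i j k
    have := congrFun (congrFun (hYkJ k) i) j
    simp only [Matrix.mul_apply, Matrix.transpose_apply] at this
    simp only [hJC, Matrix.mul_apply, Matrix.transpose_apply, Matrix.map_apply, map_sum, B,
      Matrix.of_apply, PowerSeries.coeff_mul_C, PowerSeries.coeff_C_mul, PowerSeries.coeff_mk]
    calc _ = b k * ∑ x, (Y ^ k) i x * J E ℝ x j := by
          rw [Finset.mul_sum]; exact Finset.sum_congr rfl fun _ _ => by ring
      _ = _ := by
          rw [this, Finset.mul_sum]; exact Finset.sum_congr rfl fun _ _ => by ring
  have hBB : B * B = 1 - (PowerSeries.X : PowerSeries ℝ) •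
        (Q.map (PowerSeries.C (R := ℝ)) * J E (PowerSeries ℝ)) := by
    ext i j k
    have hL : PowerSeries.coeff k ((B * B) i j)
        = (∑ p ∈ antidiagonal k, b p.1 * b p.2) * (Y ^ k) i j := by
      simp only [Matrix.mul_apply, map_sum, PowerSeries.coeff_mul, B, Matrix.of_apply,
        PowerSeries.coeff_mk]
      rw [Finset.sum_comm, Finset.sum_mul]
      refine Finset.sum_congr rfl fun p hp => ?_
      rw [← HasAntidiagonal.mem_antidiagonal.1 hp, pow_add, Matrix.mul_apply, Finset.mul_sum]
      exact Finset.sum_congr rfl fun _ _ => by ring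
    have hR : (Q.map (PowerSeries.C (R := ℝ)) * J E (PowerSeries ℝ)) i j
        = PowerSeries.C ((Q * J E ℝ) i j) := by
      rw [hJC, ← Matrix.map_mul]; rfl
    rw [hL, hb]
    simp only [Matrix.sub_apply, Matrix.smul_apply, hR, smul_eq_mul, map_sub]
    rcases k with _ | _ | k
    · simp [Matrix.one_apply]
    · simp [Matrix.one_apply, hY]
      split_ifs <;> simp [PowerSeries.coeff_one]
    · simp [Matrix.one_apply]
      split_ifs <;> simp [PowerSeries.coeff_one, PowerSeries.coeff_X]
  have hM : J E (PowerSeries ℝ) + (PowerSeries.X : PowerSeries ℝ) • Q.map (PowerSeries.C (R := ℝ))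
      = B * J E (PowerSeries ℝ) * Bᵀ := by
    rw [Matrix.mul_assoc, ← hBJ, ← Matrix.mul_assoc, hBB, Matrix.sub_mul, Matrix.smul_mul,
      Matrix.mul_assoc, J_mul_J]
    simp
  rw [hM, pfn_congr, ← hBB, Matrix.det_mul]
  ring

theorem pfn_sq (Q : Matrix (E × Bool) (E × Bool) ℝ) (hQ : Qᵀ = -Q) :
    pfn (J E ℝ + Q) ^ 2 = (1 - Q * J E ℝ).det * (pfn (J E ℝ)) ^ 2 := by
  have hpoly : pfn (J E (Polynomial ℝ) + (Polynomial.X : Polynomial ℝ) •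
        Q.map (Polynomial.C (R := ℝ))) ^ 2
    = (1 - (Polynomial.X : Polynomial ℝ) •
        (Q.map (Polynomial.C (R := ℝ)) * J E (Polynomial ℝ))).det *
      (pfn (J E (Polynomial ℝ))) ^ 2 := by
    have hinj : Function.Injective (Polynomial.coeToPowerSeries.ringHom (R := ℝ)) :=
      Polynomial.coe_injective ℝ
    apply hinj
    rw [map_pow, map_mul, map_pow, ← pfn_map, ← pfn_map, RingHom.map_det, J_map]
    have := pfn_sq_powerSeries Q hQ
    convert this using 4
    · ext1 i j
      simp [← J_map (E := E) (Polynomial.coeToPowerSeries.ringHom (R := ℝ))]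
      exact mul_comm _ _
    · congr 1
      rw [RingHom.mapMatrix_apply, Matrix.map_sub _ (by simp), Matrix.map_one _ (by simp) (by simp)]
      congr 1
      rw [← J_map (E := E) (Polynomial.coeToPowerSeries.ringHom (R := ℝ))]
      ext1 i j
      simp only [Matrix.mul_apply, Matrix.map_apply, Matrix.smul_apply, smul_eq_mul, map_mul,
        map_sum]
      simp
  have := congrArg (Polynomial.evalRingHom (1 : ℝ)) hpoly
  rw [map_pow, map_mul, map_pow, ← pfn_map, ← pfn_map, RingHom.map_det, J_map] at this
  convert this using 4
  · rw [← J_map (E := E) (Polynomial.evalRingHom (1 : ℝ))]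
    ext1 i j
    simp
  · rw [RingHom.mapMatrix_apply, Matrix.map_sub _ (by simp), Matrix.map_one _ (by simp) (by simp)]
    congr 1
    rw [← J_map (E := E) (Polynomial.evalRingHom (1 : ℝ))]
    ext1 i j
    simp [Matrix.mul_apply, Polynomial.eval_finsetSum]

end pfsq
end KW

namespace KW
open Matrix Finset

section pfexp
variable {E : Type*} [Fintype E] [DecidableEq E] {R : Type*} [CommRing R]

theorem pfn_split (e : E) (M1 M0 M2 : Matrix (E × Bool) (E × Bool) R)
    (hboth : ∀ a c, a.1 = e → c.1 = e → M1 a c = M0 a c + M2 a c)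
    (hleft : ∀ a c, a.1 = e → c.1 ≠ e → M1 a c = M0 a c ∧ M2 a c = 0)
    (hright : ∀ a c, a.1 ≠ e → c.1 = e → M1 a c = M0 a c ∧ M2 a c = 0)
    (hnone : ∀ a c, a.1 ≠ e → c.1 ≠ e → M1 a c = M0 a c ∧ M2 a c = M0 a c) :
    pfn M1 = pfn M0 + pfn M2 := by
  unfold pfn
  rw [← Finset.sum_add_distrib]
  refine Finset.sum_congr rfl fun σ _ => ?_
  rw [← mul_add]
  congr 1
  by_cases h : ∃ f, (σ (f, false)).1 = e ∧ (σ (f, true)).1 = e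
  · obtain ⟨f, hf0, hf1⟩ := h
    have hne : σ (f, false) ≠ σ (f, true) := fun h => by simpa using σ.injective h
    have hother : ∀ g s, g ≠ f → (σ (g, s)).1 ≠ e := by
      intro g s hg hs
      have : σ (g, s) = σ (f, false) ∨ σ (g, s) = σ (f, true) := by
        rcases hx : σ (g, s) with ⟨x1, x2⟩
        rcases hy : σ (f, false) with ⟨y1, y2⟩
        rcases hz : σ (f, true) with ⟨z1, z2⟩
        rw [hx] at hs; rw [hy] at hf0 hne; rw [hz] at hf1 hne
        simp only at hs hf0 hf1
        subst hs hf0 hf1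
        revert hne
        cases x2 <;> cases y2 <;> cases z2 <;> simp
      rcases this with h | h <;> have := σ.injective h <;> simp_all
    rw [← Finset.mul_prod_erase _ _ (mem_univ f), ← Finset.mul_prod_erase _ (fun x => M0 _ _) (mem_univ f),
      ← Finset.mul_prod_erase _ (fun x => M2 _ _) (mem_univ f), hboth _ _ hf0 hf1, add_mul]
    congr 2
    · refine Finset.prod_congr rfl fun g hg => ?_
      exact (hnone _ _ (hother g _ (ne_of_mem_erase hg)) (hother g _ (ne_of_mem_erase hg))).1
    · refine Finset.prod_congr rfl fun g hg => ?_
      have := (hnone _ _ (hother g false (ne_of_mem_erase hg)) (hother g true (ne_of_mem_erase hg)))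
      rw [this.1, this.2]
  · push Not at h
    have hz : ∏ x, M2 (σ (x, false)) (σ (x, true)) = 0 := by
      obtain ⟨⟨f, s⟩, hf⟩ := σ.surjective (e, false)
      refine Finset.prod_eq_zero (mem_univ f) ?_
      cases s
      · have h0 : (σ (f, false)).1 = e := by rw [hf]
        exact (hleft _ _ h0 (h f h0)).2
      · have h0 : (σ (f, true)).1 = e := by rw [hf]
        exact (hright _ _ (fun h1 => h f h1 h0) h0).2
    rw [hz, add_zero]
    refine Finset.prod_congr rfl fun g _ => ?_
    by_cases h0 : (σ (g, false)).1 = e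
    · exact (hleft _ _ h0 (h g h0)).1
    · by_cases h1 : (σ (g, true)).1 = e
      · exact (hright _ _ h0 h1).1
      · exact (hnone _ _ h0 h1).1

theorem J_apply_ne {a c : E × Bool} (h : a.1 ≠ c.1) : J E R a c = 0 := by
  simp [J, h]

/-- partially expanded matrix -/
def MT (Q : Matrix (E × Bool) (E × Bool) R) (T P : Finset E) : Matrix (E × Bool) (E × Bool) R :=
  Matrix.of fun a c => (if (a.1 ∈ P ∨ a.1 ∉ T) ∧ (c.1 ∈ P ∨ c.1 ∉ T) then Q a c else 0) +
    (if a.1 ∈ P then 0 else J E R a c)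

/-- `Q` on the edges in `P`, `J` elsewhere -/
def MP (Q : Matrix (E × Bool) (E × Bool) R) (P : Finset E) : Matrix (E × Bool) (E × Bool) R :=
  Matrix.of fun a c => (if a.1 ∈ P ∧ c.1 ∈ P then Q a c else 0) +
    (if a.1 ∈ P then 0 else J E R a c)

theorem pfn_expand_aux (Q : Matrix (E × Bool) (E × Bool) R) (T : Finset E) :
    pfn (J E R + Q) = ∑ P ∈ T.powerset, pfn (MT Q T P) := by
  induction T using Finset.induction_on with
  | empty =>
    simp only [powerset_empty, sum_singleton]
    congr 1
    ext a c
    simp [MT, add_comm]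
  | insert e T he ih =>
    rw [Finset.sum_powerset_insert he, ih, ← Finset.sum_add_distrib]
    refine Finset.sum_congr rfl fun P hP => ?_
    have heP : e ∉ P := fun h => he (mem_powerset.1 hP h)
    rw [add_comm]
    refine pfn_split e _ _ _ ?_ ?_ ?_ ?_
    · intro a c ha hc
      simp [MT, ha, hc, he, heP]
    · intro a c ha hc
      have := J_apply_ne (R := R) (a := a) (c := c) (by rw [ha]; exact hc.symm)
      simp [MT, ha, hc, he, heP, this]
    · intro a c ha hc
      have := J_apply_ne (R := R) (a := a) (c := c) (by rw [hc]; exact ha)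
      simp [MT, ha, hc, he, heP, this]
    · intro a c ha hc
      simp [MT, ha, hc]

theorem pfn_expand (Q : Matrix (E × Bool) (E × Bool) R) :
    pfn (J E R + Q) = ∑ P : Finset E, pfn (MP Q P) := by
  rw [pfn_expand_aux Q univ]
  simp [MT, MP]

theorem pfn_MP_scale (T : Matrix (E × Bool) (E × Bool) R) (x : E → R) (P : Finset E) :
    pfn (MP (Matrix.diagonal (fun h : E × Bool => if h.2 then 1 else x h.1) * T *
      Matrix.diagonal (fun h : E × Bool => if h.2 then 1 else x h.1)) P) =
      (∏ e ∈ P, x e) * pfn (MP T P) := by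
  have : MP (Matrix.diagonal (fun h : E × Bool => if h.2 then 1 else x h.1) * T *
      Matrix.diagonal (fun h : E × Bool => if h.2 then 1 else x h.1)) P =
      Matrix.diagonal (fun h : E × Bool => if h.1 ∈ P then (if h.2 then 1 else x h.1) else 1) *
      MP T P *
      (Matrix.diagonal (fun h : E × Bool => if h.1 ∈ P then (if h.2 then 1 else x h.1) else 1))ᵀ := by
    ext a c
    simp only [Matrix.diagonal_transpose, Matrix.mul_diagonal, Matrix.diagonal_mul, MP,
      Matrix.of_apply]
    by_cases ha : a.1 ∈ P
    · by_cases hc : c.1 ∈ P <;> simp [ha, hc]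
    · by_cases hc : c.1 ∈ P
      · simp [ha, hc, J_apply_ne (R := R) (a := a) (c := c) (fun h => ha (h ▸ hc))]
      · simp [ha, hc]
  rw [this, pfn_congr, Matrix.det_diagonal, Fintype.prod_prod_type]
  congr 1
  simp only [Fintype.prod_bool]
  rw [← Finset.prod_subset (Finset.subset_univ P)]
  · exact Finset.prod_congr rfl fun e he => by simp [he]
  · intro e _ he; simp [he]

end pfexp
end KW

namespace KW
open Matrix Finset

section tour

/-- masked tournament matrix in the standard lexicographic order -/
def T0 {n : ℕ} {β : Type*} [DecidableEq β] (b : Fin n → β) :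
    Matrix (Fin n × Bool) (Fin n × Bool) ℝ :=
  Matrix.of fun a c => if b a.1 = b c.1 then
    (if a.1 < c.1 then 1 else if c.1 < a.1 then -1 else J (Fin n) ℝ a c) else 0

theorem pfn_T0 {n : ℕ} {β : Type*} [DecidableEq β] (b : Fin n → β) :
    pfn (T0 b) = pfn (J (Fin n) ℝ) := by
  let B : Matrix (Fin n × Bool) (Fin n × Bool) ℝ := Matrix.of fun a c =>
    (if a = c then 1 else 0) + (if c.1 < a.1 ∧ b c.1 = b a.1 then (if c.2 then 1 else -1) else 0)
  have hdet : B.det = 1 := by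
    have hB : B.BlockTriangular (fun a => OrderDual.toDual a.1) := by
      intro i j hij
      have hij' : i.1 < j.1 := hij
      have h1 : i ≠ j := fun h => by rw [h] at hij'; exact lt_irrefl _ hij'
      simp [B, h1, not_lt_of_gt hij']
    rw [hB.det_fintype]
    refine Finset.prod_eq_one fun k _ => ?_
    have : B.toSquareBlock (fun a => OrderDual.toDual a.1) k = 1 := by
      ext ⟨i, hi⟩ ⟨j, hj⟩
      have : i.1 = j.1 := by
        have := hi.trans hj.symm
        exact this
      simp [Matrix.toSquareBlock_def, B, this, Matrix.one_apply]
    rw [this, Matrix.det_one]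
  have hT : T0 b = B * J (Fin n) ℝ * Bᵀ := by
    have hBJ : ∀ a f, (B * J (Fin n) ℝ) a (f, false) = - B a (f, true) ∧
        (B * J (Fin n) ℝ) a (f, true) = B a (f, false) := by
      intro a f
      simp only [Matrix.mul_apply, Fintype.sum_prod_type, Fintype.sum_bool, J, Matrix.of_apply]
      constructor
      · rw [Finset.sum_eq_single f]
        · simp
        · intro g _ hg; simp [hg]
        · simp
      · rw [Finset.sum_eq_single f]
        · simp
        · intro g _ hg; simp [hg]
        · simp
    let m : Fin n × Bool → Fin n → ℝ := fun a f => if f < a.1 ∧ b f = b a.1 then 1 else 0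
    have hB0 : ∀ a f, B a (f, false) = (if a = (f, false) then 1 else 0) - m a f := by
      intro a f
      simp only [B, m, Matrix.of_apply]
      split_ifs <;> simp_all
    have hB1 : ∀ a f, B a (f, true) = (if a = (f, true) then 1 else 0) + m a f := by
      intro a f
      simp only [B, m, Matrix.of_apply]
      split_ifs <;> simp
    ext a c
    rw [Matrix.mul_apply, Fintype.sum_prod_type]
    simp only [Fintype.sum_bool, (hBJ _ _).1, (hBJ _ _).2, Matrix.transpose_apply, hB0, hB1]
    have hterm : ∀ f, ((if a = (f, false) then (1:ℝ) else 0) - m a f) *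
          ((if c = (f, true) then 1 else 0) + m c f) +
        -((if a = (f, true) then 1 else 0) + m a f) * ((if c = (f, false) then 1 else 0) - m c f)
        = (if f = a.1 then J (Fin n) ℝ a c + m c a.1 else 0) - (if f = c.1 then m a c.1 else 0) := by
      intro f
      obtain ⟨a, s⟩ := a
      obtain ⟨c, t⟩ := c
      by_cases ha : f = a
      · subst ha
        by_cases hc : f = c
        · subst hc
          cases s <;> cases t <;> simp [J] <;> ring
        · cases s <;> cases t <;> simp [J, hc, Ne.symm hc] <;> ring
      · by_cases hc : f = c
        · subst hc
          cases s <;> cases t <;> simp [ha, Ne.symm ha] <;> ring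
        · simp [ha, hc, Ne.symm ha, Ne.symm hc, mul_comm]
    rw [Finset.sum_congr rfl fun f _ => hterm f, Finset.sum_sub_distrib]
    simp only [Finset.sum_ite_eq', Finset.mem_univ, if_true, T0, Matrix.of_apply, m]
    by_cases hb : b a.1 = b c.1
    · rcases lt_trichotomy a.1 c.1 with h | h | h
      · simp [hb, h, not_lt_of_gt h, J_apply_ne (R := ℝ) (ne_of_lt h)]
      · simp [h]
      · simp [hb, h, not_lt_of_gt h, J_apply_ne (R := ℝ) (ne_of_gt h)]
    · have : a.1 ≠ c.1 := fun h => hb (by rw [h])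
      simp [hb, Ne.symm hb, J_apply_ne (R := ℝ) this]
  rw [hT, pfn_congr, hdet, one_mul]

theorem pfn_submatrix {E R : Type*} [Fintype E] [DecidableEq E] [CommRing R]
    (M : Matrix (E × Bool) (E × Bool) R) (ρ : Equiv.Perm (E × Bool)) :
    pfn (M.submatrix ρ ρ) = ((Equiv.Perm.sign ρ : ℤ) : R) * pfn M := by
  unfold pfn
  rw [Finset.mul_sum]
  refine Fintype.sum_equiv (Equiv.mulLeft ρ) _ _ fun σ => ?_
  rw [Equiv.coe_mulLeft, Equiv.Perm.sign_mul, ← mul_assoc]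
  congr 1
  push_cast
  rw [← mul_assoc, ← Int.cast_mul, ← Units.val_mul, Int.units_mul_self]
  simp

variable {n : ℕ} {β K : Type*} [DecidableEq β] [LinearOrder K]

/-- masked tournament for a key -/
def Tk (k : Fin n × Bool → K) (b : Fin n × Bool → β) :
    Matrix (Fin n × Bool) (Fin n × Bool) ℝ :=
  Matrix.of fun a c => if b a = b c then (if k a < k c then 1 else if k c < k a then -1 else 0) else 0

theorem pfn_Tk_odd (k : Fin n × Bool → K) (b : Fin n × Bool → β) (x : β)
    (hx : ¬ Even (Finset.univ.filter (fun a => b a = x)).card) : pfn (Tk k b) = 0 := by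
  have h1 : Tk k b = Matrix.diagonal (fun a => if b a = x then (-1:ℝ) else 1) * Tk k b *
      (Matrix.diagonal (fun a => if b a = x then (-1:ℝ) else 1))ᵀ := by
    ext a c
    simp only [Matrix.diagonal_transpose, Matrix.mul_diagonal, Matrix.diagonal_mul, Tk,
      Matrix.of_apply]
    by_cases h : b a = b c
    · by_cases hc : b c = x <;> simp only [h, hc, if_true, if_false] <;> ring
    · simp [h]
  have h2 := congrArg pfn h1
  rw [pfn_congr, Matrix.det_diagonal, Finset.prod_ite] at h2
  simp only [Finset.prod_const, one_pow, mul_one] at h2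
  rw [Nat.not_even_iff_odd] at hx
  rw [hx.neg_one_pow] at h2
  linarith

/-- lexicographic position -/
def iota (n : ℕ) : Fin n × Bool ≃ Fin (n * 2) :=
  (Equiv.prodCongr (Equiv.refl _) finTwoEquiv.symm).trans finProdFinEquiv

theorem iota_val (e : Fin n) (s : Bool) : (iota n (e, s)).val = 2 * e.val + (if s then 1 else 0) := by
  cases s <;> simp [iota, finProdFinEquiv, finTwoEquiv] <;> ring

theorem exists_rank (k : Fin n × Bool → K) (hk : Function.Injective k) :
    ∃ κ : Fin n × Bool ≃ Fin (n * 2), ∀ a c, κ a < κ c ↔ k a < k c := by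
  classical
  let s : Finset K := univ.image k
  have hs : s.card = n * 2 := by
    rw [Finset.card_image_of_injective _ hk]; simp
  let g : Fin n × Bool ≃ s := Equiv.ofBijective (fun a => ⟨k a, by simp [s]⟩) (by
    constructor
    · intro a c h; exact hk (by simpa using h)
    · rintro ⟨y, hy⟩
      obtain ⟨a, _, rfl⟩ := Finset.mem_image.1 hy
      exact ⟨a, rfl⟩)
  refine ⟨g.trans (s.orderIsoOfFin hs).symm.toEquiv, fun a c => ?_⟩
  simp only [Equiv.trans_apply]
  change (s.orderIsoOfFin hs).symm (g a) < (s.orderIsoOfFin hs).symm (g c) ↔ _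
  rw [OrderIso.lt_iff_lt]
  rfl

theorem pfn_Tk_even (k : Fin n × Bool → K) (hk : Function.Injective k) (b : Fin n × Bool → β)
    (hconv : ∀ a c d, k a ≤ k c → k c ≤ k d → b a = b d → b c = b a)
    (heven : ∀ x, Even (Finset.univ.filter (fun a => b a = x)).card)
    (h01 : ∀ e, k (e, false) < k (e, true)) :
    pfn (Tk k b) = (((∏ e : Fin n, ∏ f : Fin n, if e < f then
      (∏ s, ∏ t, if k (e, s) < k (f, t) then (1 : ℤˣ) else -1) else 1 : ℤˣ) : ℤ) : ℝ)
        * pfn (J (Fin n) ℝ) := by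
  obtain ⟨κ, hκ⟩ := exists_rank k hk
  have hκle : ∀ a c, κ a ≤ κ c ↔ k a ≤ k c := by
    intro a c; rw [← not_lt, ← not_lt, hκ]
  let ρ : Equiv.Perm (Fin n × Bool) := (iota n).trans κ.symm
  have hkρ : ∀ a, κ (ρ a) = iota n a := by intro a; simp [ρ]
  have hbl : ∀ e, b (ρ (e, false)) = b (ρ (e, true)) := by
    intro e
    by_contra hne
    let S : Finset (Fin n × Bool) := univ.filter fun c => κ c ≤ κ (ρ (e, false))
    have hScard : S.card = 2 * e.val + 1 := by
      have : S.card = (Finset.Iic (iota n (e, false))).card := by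
        refine Finset.card_bij (fun c _ => κ c) ?_ ?_ ?_
        · intro c hc
          simpa [S, hkρ] using hc
        · intro c _ d _ h; exact κ.injective h
        · intro y hy
          refine ⟨κ.symm y, ?_, by simp⟩
          simpa [S, hkρ] using hy
      rw [this, Fin.card_Iic, iota_val]
      simp
    have hSeven : Even S.card := by
      rw [Finset.card_eq_sum_card_image b S]
      refine Finset.even_sum _ fun x hx => ?_
      obtain ⟨c, hc, rfl⟩ := Finset.mem_image.1 hx
      have hSeq : S.filter (fun a => b a = b c) = univ.filter (fun a => b a = b c) := by
        ext d
        simp only [mem_filter, mem_univ, true_and, and_iff_right_iff_imp, S]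
        intro hd
        by_contra hlt
        have hc' : κ c ≤ κ (ρ (e, false)) := by simpa [S] using hc
        have h1 : κ (ρ (e, true)) ≤ κ d := by
          rw [not_le, hkρ, Fin.lt_def, iota_val] at hlt
          rw [hkρ, Fin.le_def, iota_val]
          simp at hlt ⊢
          omega
        have h2 : κ (ρ (e, false)) ≤ κ (ρ (e, true)) := by
          rw [hkρ, hkρ, Fin.le_def, iota_val, iota_val]; simp
        have e1 := hconv c (ρ (e, false)) d ((hκle _ _).1 hc') ((hκle _ _).1 (h2.trans h1)) hd.symm
        have e2 := hconv c (ρ (e, true)) d ((hκle _ _).1 (hc'.trans h2)) ((hκle _ _).1 h1) hd.symm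
        exact hne (e1.trans e2.symm)
      rw [hSeq]
      exact heven _
    rw [hScard] at hSeven
    exact (Nat.not_even_iff_odd.2 ⟨e.val, rfl⟩) hSeven
  have hsub : (Tk k b).submatrix ρ ρ = T0 (fun e => b (ρ (e, false))) := by
    have hb' : ∀ a, b (ρ a) = b (ρ (a.1, false)) := by
      rintro ⟨e, s⟩; cases s
      · rfl
      · exact (hbl e).symm
    have hlt : ∀ a c, k (ρ a) < k (ρ c) ↔ iota n a < iota n c := by
      intro a c; rw [← hκ, hkρ, hkρ]
    ext a c
    simp only [Matrix.submatrix_apply, Tk, T0, Matrix.of_apply, hb' a, hb' c, hlt]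
    obtain ⟨e, s⟩ := a
    obtain ⟨f, t⟩ := c
    simp only [Fin.lt_def, iota_val]
    congr 1
    rcases lt_trichotomy e f with h | h | h
    · have h' : e.val < f.val := h
      have : 2 * e.val + (if s then 1 else 0) < 2 * f.val + (if t then 1 else 0) := by
        split_ifs <;> omega
      simp only [this, h', if_true]
    · subst h
      cases s <;> cases t <;> simp [J]
    · have h' : f.val < e.val := h
      have : 2 * f.val + (if t then 1 else 0) < 2 * e.val + (if s then 1 else 0) := by
        split_ifs <;> omega
      simp only [this, h', if_true, not_lt_of_gt this, not_lt_of_gt h', if_false]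
  have hsign : Equiv.Perm.sign ρ = (∏ e : Fin n, ∏ f : Fin n, if e < f then
      (∏ s, ∏ t, if k (e, s) < k (f, t) then (1 : ℤˣ) else -1) else 1 : ℤˣ) := by
    have h1 : Equiv.Perm.sign ρ = Equiv.Perm.sign ((iota n).symm.trans κ) := by
      rw [← Equiv.Perm.sign_symm ((iota n).symm.trans κ)]
      refine Equiv.Perm.sign_eq_sign_of_equiv _ _ (iota n) ?_
      intro x
      simp [ρ]
    rw [h1, Equiv.Perm.sign_eq_prod_prod_Ioi]
    have h2 : ∀ i : Fin (n * 2), (∏ j ∈ Finset.Ioi i, (if ((iota n).symm.trans κ) i <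
        ((iota n).symm.trans κ) j then (1 : ℤˣ) else -1)) =
        ∏ c : Fin n × Bool, if i < iota n c then
          (if k ((iota n).symm i) < k c then (1 : ℤˣ) else -1) else 1 := by
      intro i
      rw [← Finset.prod_filter]
      symm
      refine Finset.prod_bij (fun c _ => iota n c) ?_ ?_ ?_ ?_
      · intro c hc; simpa using hc
      · intro c _ d _ h; exact (iota n).injective h
      · intro y hy; exact ⟨(iota n).symm y, by simpa using hy, by simp⟩
      · intro c _; simp [hκ]
    rw [Finset.prod_congr rfl fun i _ => h2 i]
    rw [← Fintype.prod_equiv (iota n) (fun a => ∏ c : Fin n × Bool, if iota n a < iota n c then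
          (if k a < k c then (1 : ℤˣ) else -1) else 1) _ (fun a => by simp)]
    simp only [Fintype.prod_prod_type]
    refine Finset.prod_congr rfl fun e _ => ?_
    rw [Finset.prod_comm]
    refine Finset.prod_congr rfl fun f _ => ?_
    simp only [Fin.lt_def, iota_val]
    rcases lt_trichotomy e f with h | h | h
    · have h' : e.val < f.val := h
      have : ∀ s t : Bool, 2 * e.val + (if s then 1 else 0) < 2 * f.val + (if t then 1 else 0) := by
        intro s t
        split_ifs <;> omega
      simp only [this, h', if_true]
    · subst h
      simp [h01]
    · have h' : f.val < e.val := h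
      have : ∀ s t : Bool, ¬ (2 * e.val + (if s then 1 else 0) < 2 * f.val + (if t then 1 else 0)) := by
        intro s t
        split_ifs <;> omega
      simp only [this, not_lt_of_gt h', if_false, Finset.prod_const_one]
  have h3 := pfn_submatrix (Tk k b) ρ
  rw [hsub, pfn_T0, hsign] at h3
  rw [h3, ← mul_assoc, ← Int.cast_mul, ← Units.val_mul, Int.units_mul_self]
  simp

end tour
end KW

namespace KW
open Matrix Finset

section geom

/-- coordinates data of a plane straight-line graph; edges oriented from left to right -/
structure PlaneData (V : Type*) (n : ℕ) where
  x : V → ℝ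
  y : V → ℝ
  a : Fin n → V
  b : Fin n → V
  hx : Function.Injective x
  hab : ∀ e, x (a e) < x (b e)
  hed : ∀ e f, a e = a f → b e = b f → e = f
  hvert : ∀ e w, x (a e) < x w → x w < x (b e) →
    y w ≠ y (a e) + (y (b e) - y (a e)) / (x (b e) - x (a e)) * (x w - x (a e))
  hcross : ∀ e f X, e ≠ f → x (a e) < X → X < x (b e) → x (a f) < X → X < x (b f) →
    y (a e) + (y (b e) - y (a e)) / (x (b e) - x (a e)) * (X - x (a e)) ≠
    y (a f) + (y (b f) - y (a f)) / (x (b f) - x (a f)) * (X - x (a f))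

variable {V : Type*} {n : ℕ} (D : PlaneData V n)

namespace PlaneData

/-- slope -/
noncomputable def m (e : Fin n) : ℝ := (D.y (D.b e) - D.y (D.a e)) / (D.x (D.b e) - D.x (D.a e))

/-- height of an edge above abscissa -/
noncomputable def ht (e : Fin n) (X : ℝ) : ℝ := D.y (D.a e) + D.m e * (X - D.x (D.a e))

/-- vertex of a half edge -/
def vt (h : Fin n × Bool) : V := if h.2 then D.b h.1 else D.a h.1

@[simp] theorem vt_false (e : Fin n) : D.vt (e, false) = D.a e := rfl
@[simp] theorem vt_true (e : Fin n) : D.vt (e, true) = D.b e := rfl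

theorem ht_a (e : Fin n) : D.ht e (D.x (D.a e)) = D.y (D.a e) := by simp [ht]

theorem ht_b (e : Fin n) : D.ht e (D.x (D.b e)) = D.y (D.b e) := by
  have := D.hab e
  have h : D.x (D.b e) - D.x (D.a e) ≠ 0 := by linarith
  simp only [ht, m]
  field_simp
  ring

theorem ht_sub (e : Fin n) (X : ℝ) : D.ht e X = D.y (D.b e) + D.m e * (X - D.x (D.b e)) := by
  rw [← ht_b]
  simp only [ht]; ring

theorem vert (e : Fin n) (w : V) (h1 : D.x (D.a e) < D.x w) (h2 : D.x w < D.x (D.b e)) :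
    D.y w ≠ D.ht e (D.x w) := D.hvert e w h1 h2

theorem same_sign (e f : Fin n) (hef : e ≠ f) (p q : ℝ) (hpq : p < q)
    (h1 : D.x (D.a e) ≤ p) (h2 : D.x (D.a f) ≤ p) (h3 : q ≤ D.x (D.b e)) (h4 : q ≤ D.x (D.b f))
    (hp : D.ht e p ≠ D.ht f p) (hq : D.ht e q ≠ D.ht f q) :
    D.ht f p < D.ht e p ↔ D.ht f q < D.ht e q := by
  have hcont : ContinuousOn (fun X => D.ht e X - D.ht f X) (Set.Icc p q) := by
    unfold ht; fun_prop
  have hno : ∀ X ∈ Set.Ioo p q, D.ht e X - D.ht f X ≠ 0 := by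
    intro X hX h
    exact D.hcross e f X hef (by linarith [hX.1]) (by linarith [hX.2]) (by linarith [hX.1])
      (by linarith [hX.2]) (by simpa [ht, m, sub_eq_zero] using h)
  constructor
  · intro h
    by_contra h'
    have h'' : D.ht e q < D.ht f q := lt_of_le_of_ne (not_lt.1 h') hq
    obtain ⟨X, hX, hX0⟩ := intermediate_value_Ioo' hpq.le hcont
      (show (0:ℝ) ∈ Set.Ioo _ _ from ⟨by simpa using h'', by simpa using h⟩)
    exact hno X hX hX0
  · intro h
    by_contra h'
    have h'' : D.ht e p < D.ht f p := lt_of_le_of_ne (not_lt.1 h') hp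
    obtain ⟨X, hX, hX0⟩ := intermediate_value_Ioo hpq.le hcont
      (show (0:ℝ) ∈ Set.Ioo _ _ from ⟨by simpa using h'', by simpa using h⟩)
    exact hno X hX hX0

open Classical in
/-- sign recording that an edge passes above a vertex -/
noncomputable def be (e : Fin n) (w : V) : ℤˣ :=
  if D.x (D.a e) < D.x w ∧ D.x w < D.x (D.b e) ∧ D.y w < D.ht e (D.x w) then -1 else 1

/-- key of half edges -/
noncomputable def kU (h : Fin n × Bool) : ℝ ×ₗ Bool ×ₗ ℝ :=
  toLex (D.x (D.vt h), toLex (!h.2, D.m h.1))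

theorem kU_lt (e f : Fin n) (s t : Bool) : D.kU (e, s) < D.kU (f, t) ↔
    D.x (D.vt (e, s)) < D.x (D.vt (f, t)) ∨ (D.x (D.vt (e, s)) = D.x (D.vt (f, t)) ∧
      ((s = true ∧ t = false) ∨ (s = t ∧ D.m e < D.m f))) := by
  simp only [kU, Prod.Lex.toLex_lt_toLex]
  cases s <;> cases t <;> simp

theorem m_ne_left (e f : Fin n) (hef : e ≠ f) (h : D.a e = D.a f) : D.m e ≠ D.m f := by
  intro hm
  have hb : D.b e ≠ D.b f := fun hb => hef (D.hed e f h hb)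
  rcases lt_or_gt_of_ne (fun h => hb (D.hx h)) with hlt | hlt
  · refine D.vert f (D.b e) ?_ hlt ?_
    · rw [← h]; exact D.hab e
    · rw [← ht_b]; simp [ht, h, hm]
  · refine D.vert e (D.b f) ?_ hlt ?_
    · rw [h]; exact D.hab f
    · rw [← ht_b]; simp [ht, h, hm]

theorem m_ne_right (e f : Fin n) (hef : e ≠ f) (h : D.b e = D.b f) : D.m e ≠ D.m f := by
  intro hm
  have hb : D.a e ≠ D.a f := fun hb => hef (D.hed e f hb h)
  rcases lt_or_gt_of_ne (fun h => hb (D.hx h)) with hlt | hlt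
  · refine D.vert e (D.a f) hlt ?_ ?_
    · rw [h]; exact D.hab f
    · rw [← ht_a]; simp [ht_sub, h, hm]
  · refine D.vert f (D.a e) hlt ?_ ?_
    · rw [← h]; exact D.hab e
    · rw [← ht_a]; simp [ht_sub, h, hm]

theorem kU_inj : Function.Injective D.kU := by
  rintro ⟨e, s⟩ ⟨f, t⟩ h
  simp only [kU, toLex_inj, Prod.mk.injEq, Bool.not_inj_iff] at h
  obtain ⟨h1, h2, h3⟩ := h
  subst h2
  have hv := D.hx h1
  by_contra hne
  have hef : e ≠ f := fun h => hne (by rw [h])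
  cases s
  · exact D.m_ne_left e f hef hv h3
  · exact D.m_ne_right e f hef hv h3

/-- crossing sign of two edges -/
noncomputable def cr {K : Type*} [LinearOrder K] (k : Fin n × Bool → K) (e f : Fin n) : ℤˣ :=
  ∏ s, ∏ t, if k (e, s) < k (f, t) then (1 : ℤˣ) else -1

theorem cr_symm {K : Type*} [LinearOrder K] (k : Fin n × Bool → K) (hk : Function.Injective k)
    (e f : Fin n) (hef : e ≠ f) : cr k e f = cr k f e := by
  have : ∀ s t, (if k (e, s) < k (f, t) then (1 : ℤˣ) else -1)
      = - (if k (f, t) < k (e, s) then (1 : ℤˣ) else -1) := by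
    intro s t
    rcases lt_trichotomy (k (e, s)) (k (f, t)) with h | h | h
    · simp [h, not_lt_of_gt h]
    · have := hk h; simp at this; exact absurd this.1 hef
    · simp [h, not_lt_of_gt h]
  simp only [cr, this, Fintype.prod_bool]
  simp only [neg_mul, mul_neg, neg_neg]
  ac_rfl

theorem cr_eq_aux (e f : Fin n) (hef : e ≠ f)
    (hw : D.x (D.a e) < D.x (D.a f) ∨ (D.a e = D.a f ∧ D.x (D.b e) < D.x (D.b f))) :
    cr D.kU e f = (D.be e (D.a f) * D.be e (D.b f)) * (D.be f (D.a e) * D.be f (D.b e)) := by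
  have he := D.hab e
  have hf := D.hab f
  simp only [cr, Fintype.prod_bool, kU_lt, vt_false, vt_true]
  rcases hw with h1 | ⟨h1, h2⟩
  · have b3 : D.be f (D.a e) = 1 := by simp [be, not_lt_of_gt h1]
    rcases lt_trichotomy (D.x (D.b e)) (D.x (D.a f)) with h2 | h2 | h2
    · have b1 : D.be e (D.a f) = 1 := by simp [be, not_lt_of_gt h2]
      have b2 : D.be e (D.b f) = 1 := by simp [be, not_lt_of_gt (h2.trans hf)]
      have b4 : D.be f (D.b e) = 1 := by simp [be, not_lt_of_gt h2]
      simp [b1, b2, b3, b4, h1, h2, h1.trans hf, h2.trans hf]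
    · have b1 : D.be e (D.a f) = 1 := by simp [be, h2]
      have b2 : D.be e (D.b f) = 1 := by
        have : ¬ D.x (D.b f) < D.x (D.b e) := by linarith
        simp [be, this]
      have b4 : D.be f (D.b e) = 1 := by simp [be, h2]
      simp [b1, b2, b3, b4, h1, h2, h1.trans hf, hf]
    · rcases lt_trichotomy (D.x (D.b e)) (D.x (D.b f)) with h3 | h3 | h3
      · -- interleaved
        have b2 : D.be e (D.b f) = 1 := by simp [be, not_lt_of_gt h3]
        have hs := D.same_sign e f hef (D.x (D.a f)) (D.x (D.b e)) h2 h1.le le_rfl le_rfl h3.le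
          (by rw [ht_a]; exact (D.vert e _ h1 h2).symm)
          (by rw [ht_b]; exact (D.vert f _ h2 h3))
        have hne := D.vert f _ h2 h3
        rw [ht_a, ht_b] at hs
        simp only [be, h1, h2, h3, h1.trans hf, not_lt_of_gt h1, not_lt_of_gt h2,
          not_lt_of_gt h3, ne_of_gt h2, ne_of_lt h1, hs, true_and, false_and, if_true, if_false]
        rcases lt_or_gt_of_ne hne with h | h
        · simp [h, not_lt_of_gt h]
        · simp [h, not_lt_of_gt h]
      · have b2 : D.be e (D.b f) = 1 := by simp [be, h3]
        have b4 : D.be f (D.b e) = 1 := by simp [be, h3]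
        have hbb := D.hx h3
        have hm : D.y (D.a f) < D.ht e (D.x (D.a f)) ↔ D.m e < D.m f := by
          rw [← ht_a, ht_sub, ht_sub, hbb]
          constructor
          · intro h
            by_contra h'
            nlinarith [mul_nonneg (sub_nonneg.2 (not_lt.1 h')) (sub_nonneg.2 hf.le)]
          · intro h
            nlinarith [mul_pos (sub_pos.2 h) (sub_pos.2 hf)]
        rw [b2, b3, b4]
        simp only [be, h1, h2, h3, h1.trans hf, hm, true_and, if_true, not_lt_of_gt hf, ne_of_gt hf,
          lt_irrefl, false_and, or_false, false_or, if_false]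
        by_cases h : D.m e < D.m f <;> simp [h, hf]
      · have b4 : D.be f (D.b e) = 1 := by simp [be, not_lt_of_gt h3]
        have hs := D.same_sign e f hef (D.x (D.a f)) (D.x (D.b f)) hf h1.le le_rfl h3.le le_rfl
          (by rw [ht_a]; exact (D.vert e _ h1 h2).symm)
          (by rw [ht_b]; exact (D.vert e _ (h1.trans hf) h3).symm)
        rw [ht_a, ht_b] at hs
        simp only [be, h1, h2, h3, h1.trans hf, not_lt_of_gt h1, not_lt_of_gt h2,
          not_lt_of_gt h3, ne_of_gt h2, ne_of_lt h1, ne_of_gt h3, hs, true_and, false_and, if_true,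
          if_false]
        by_cases h : D.y (D.b f) < D.ht e (D.x (D.b f)) <;> simp [h]
  · have hm : D.y (D.b e) < D.ht f (D.x (D.b e)) ↔ D.m e < D.m f := by
      rw [← ht_b, ht, ht, h1]
      rw [h1] at he
      constructor
      · intro h
        by_contra h'
        nlinarith [mul_nonneg (sub_nonneg.2 (not_lt.1 h')) (sub_nonneg.2 he.le)]
      · intro h
        nlinarith [mul_pos (sub_pos.2 h) (sub_pos.2 he)]
    have b1 : D.be e (D.a f) = 1 := by simp [be, h1]
    have b2 : D.be e (D.b f) = 1 := by simp [be, not_lt_of_gt h2]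
    have b3 : D.be f (D.a e) = 1 := by simp [be, h1]
    have h4 : D.x (D.a f) < D.x (D.b e) := h1 ▸ he
    rw [b1, b2, b3]
    simp only [be, h1, h2, hm, h4, hf, true_and, if_true, not_lt_of_gt h4, ne_of_gt h4,
          lt_irrefl, false_and, or_false, false_or, if_false]
    by_cases h : D.m e < D.m f <;> simp [h]

theorem cr_eq (e f : Fin n) (hef : e ≠ f) :
    cr D.kU e f = (D.be e (D.a f) * D.be e (D.b f)) * (D.be f (D.a e) * D.be f (D.b e)) := by
  rcases lt_trichotomy (D.x (D.a e)) (D.x (D.a f)) with h | h | h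
  · exact D.cr_eq_aux e f hef (Or.inl h)
  · have ha := D.hx h
    rcases lt_trichotomy (D.x (D.b e)) (D.x (D.b f)) with h' | h' | h'
    · exact D.cr_eq_aux e f hef (Or.inr ⟨ha, h'⟩)
    · exact absurd (D.hed e f ha (D.hx h')) hef
    · rw [cr_symm _ D.kU_inj _ _ hef, D.cr_eq_aux f e hef.symm (Or.inr ⟨ha.symm, h'⟩), mul_comm]
  · rw [cr_symm _ D.kU_inj _ _ hef, D.cr_eq_aux f e hef.symm (Or.inl h), mul_comm]

end PlaneData
end geom
end KW

namespace KW
open Matrix Finset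

section geom2
variable {U : Type*} [DecidableEq U] {n : ℕ} (D : PlaneData U n)

namespace PlaneData

/-- key of half edges adapted to a set of edges -/
noncomputable def kP (P : Finset (Fin n)) (h : Fin n × Bool) : Bool ×ₗ (ℝ ×ₗ Bool ×ₗ ℝ) :=
  if h.1 ∈ P then toLex (true, D.kU h)
  else toLex (false, toLex (((h.1 : ℕ) : ℝ), toLex (h.2, (0 : ℝ))))

/-- block label of half edges adapted to a set of edges -/
def lab (P : Finset (Fin n)) (h : Fin n × Bool) : U ⊕ Fin n :=
  if h.1 ∈ P then Sum.inl (D.vt h) else Sum.inr h.1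

theorem kP_inj (P : Finset (Fin n)) : Function.Injective (D.kP P) := by
  rintro ⟨e, s⟩ ⟨f, t⟩ h
  unfold kP at h
  by_cases he : e ∈ P <;> by_cases hf : f ∈ P
  · simp only [he, hf, if_true, toLex_inj, Prod.mk.injEq, true_and] at h
    exact D.kU_inj h
  · simp [he, hf] at h
  · simp [he, hf] at h
  · simp only [he, hf, if_false, toLex_inj, Prod.mk.injEq, true_and, and_true, Nat.cast_inj] at h
    exact Prod.ext (Fin.ext h.1) h.2

theorem kP_le (P : Finset (Fin n)) (a c : Fin n × Bool) (h : D.kP P a ≤ D.kP P c) :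
    (c.1 ∉ P → a.1 ∉ P ∧ a.1 ≤ c.1) ∧ (a.1 ∈ P → c.1 ∈ P ∧ D.x (D.vt a) ≤ D.x (D.vt c)) := by
  unfold kP at h
  by_cases ha : a.1 ∈ P <;> by_cases hc : c.1 ∈ P
  · simp only [ha, hc, if_true, Prod.Lex.toLex_le_toLex, lt_irrefl, false_or, true_and, kU] at h
    refine ⟨fun h' => absurd hc h', fun _ => ⟨hc, ?_⟩⟩
    rcases h with h | h
    · exact h.le
    · exact h.1.le
  · simp [ha, hc, Prod.Lex.toLex_le_toLex] at h
    exact absurd h (by decide)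
  · exact ⟨fun h' => absurd hc h', fun h' => absurd h' ha⟩
  · simp only [ha, hc, if_false, Prod.Lex.toLex_le_toLex, lt_irrefl, false_or, true_and,
      Nat.cast_lt, Nat.cast_inj] at h
    refine ⟨fun _ => ⟨ha, ?_⟩, fun h' => absurd h' ha⟩
    rcases h with h | h
    · exact le_of_lt h
    · exact le_of_eq (Fin.ext h.1)

theorem lab_conv (P : Finset (Fin n)) (a c d : Fin n × Bool) (h1 : D.kP P a ≤ D.kP P c)
    (h2 : D.kP P c ≤ D.kP P d) (h : D.lab P a = D.lab P d) : D.lab P c = D.lab P a := by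
  obtain ⟨h11, h12⟩ := D.kP_le P a c h1
  obtain ⟨h21, h22⟩ := D.kP_le P c d h2
  unfold lab at h ⊢
  by_cases ha : a.1 ∈ P <;> by_cases hd : d.1 ∈ P
  · have hc := (h12 ha)
    simp only [ha, hd, hc.1, if_true, Sum.inl.injEq] at h ⊢
    apply D.hx
    have := (h22 hc.1).2
    rw [← h] at this
    exact le_antisymm this hc.2
  · simp [ha, hd] at h
  · simp [ha, hd] at h
  · have hc := h21 hd
    have hc' := h11 hc.1
    simp only [ha, hd, hc.1, if_false, Sum.inr.injEq] at h ⊢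
    exact le_antisymm (h ▸ hc.2) hc'.2

theorem kP_01 (P : Finset (Fin n)) (e : Fin n) : D.kP P (e, false) < D.kP P (e, true) := by
  unfold kP
  by_cases he : e ∈ P
  · simp only [he, if_true, Prod.Lex.toLex_lt_toLex, kU_lt, vt_false, vt_true]
    exact Or.inr ⟨trivial, Or.inl (D.hab e)⟩
  · simp [he, Prod.Lex.toLex_lt_toLex]

theorem MP_Tk (P : Finset (Fin n)) : MP (Tk D.kU D.vt) P = Tk (D.kP P) (D.lab P) := by
  ext ⟨e, s⟩ ⟨f, t⟩
  simp only [MP, Tk, Matrix.of_apply, J, kP, lab]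
  by_cases he : e ∈ P <;> by_cases hf : f ∈ P
  · simp [he, hf, Prod.Lex.toLex_lt_toLex]
  · simp [he, hf]
  · have : e ≠ f := fun h => he (h ▸ hf)
    simp [he, hf, this]
  · simp only [he, hf, and_self, if_false, zero_add, Sum.inr.injEq, Prod.Lex.toLex_lt_toLex]
    by_cases hef : e = f
    · subst hef
      cases s <;> cases t <;> simp
    · simp [hef]

theorem cr_kP_mem (P : Finset (Fin n)) (e f : Fin n) (he : e ∈ P) (hf : f ∈ P) :
    cr (D.kP P) e f = cr D.kU e f := by
  simp [cr, kP, he, hf, Prod.Lex.toLex_lt_toLex]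

theorem cr_kP_not (P : Finset (Fin n)) (e f : Fin n) (hef : e ≠ f) (h : ¬ (e ∈ P ∧ f ∈ P)) :
    cr (D.kP P) e f = 1 := by
  by_cases he : e ∈ P <;> by_cases hf : f ∈ P
  · exact absurd ⟨he, hf⟩ h
  · simp [cr, kP, he, hf, Prod.Lex.toLex_lt_toLex]
  · simp [cr, kP, he, hf, Prod.Lex.toLex_lt_toLex]
  · have : ¬ ((e : ℕ) = (f : ℕ)) := fun h => hef (Fin.ext h)
    simp only [cr, kP, he, hf, if_false, Prod.Lex.toLex_lt_toLex, lt_irrefl, false_or, true_and,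
      Nat.cast_inj, this, false_and, or_false, Nat.cast_lt]
    split_ifs <;> simp

theorem be_self_a (e : Fin n) : D.be e (D.a e) = 1 := by simp [be]
theorem be_self_b (e : Fin n) : D.be e (D.b e) = 1 := by simp [be]

theorem prod_lt_symm {M : Type*} [CommMonoid M] (g : Fin n → Fin n → M) (h : ∀ e, g e e = 1) :
    (∏ e, ∏ f, if e < f then g e f * g f e else 1) = ∏ e, ∏ f, g e f := by
  have h1 : ∀ e f : Fin n, g e f = (if e < f then g e f else 1) * (if f < e then g e f else 1) := by
    intro e f
    rcases lt_trichotomy e f with hl | hl | hl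
    · simp [hl, not_lt_of_gt hl]
    · subst hl; simp [h]
    · simp [hl, not_lt_of_gt hl]
  have h2 : (∏ e, ∏ f, g e f) = (∏ e, ∏ f, if e < f then g e f else 1) *
      ∏ e, ∏ f, if f < e then g e f else 1 := by
    rw [← Finset.prod_mul_distrib]
    refine Finset.prod_congr rfl fun e _ => ?_
    rw [← Finset.prod_mul_distrib]
    exact Finset.prod_congr rfl fun f _ => h1 e f
  rw [h2, Finset.prod_comm (f := fun e f => if f < e then g e f else 1),
    ← Finset.prod_mul_distrib]
  refine Finset.prod_congr rfl fun e _ => ?_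
  rw [← Finset.prod_mul_distrib]
  refine Finset.prod_congr rfl fun f _ => ?_
  split_ifs <;> simp

/-- an edge set all of whose degrees are even -/
def EvenSet (P : Finset (Fin n)) : Prop :=
  ∀ w : U, Even (univ.filter (fun h : Fin n × Bool => h.1 ∈ P ∧ D.vt h = w)).card

theorem prod_be (P : Finset (Fin n)) (hP : D.EvenSet P) (e : Fin n) :
    (∏ f, if f ∈ P then D.be e (D.a f) * D.be e (D.b f) else 1) = 1 := by
  have h1 : (∏ f, if f ∈ P then D.be e (D.a f) * D.be e (D.b f) else 1) =
      ∏ h ∈ univ.filter (fun h : Fin n × Bool => h.1 ∈ P), D.be e (D.vt h) := by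
    rw [Finset.prod_filter, Fintype.prod_prod_type]
    refine Finset.prod_congr rfl fun f _ => ?_
    by_cases hf : f ∈ P <;> simp [hf, mul_comm]
  rw [h1]
  have h2 := Finset.prod_comp (s := univ.filter (fun h : Fin n × Bool => h.1 ∈ P))
    (fun w => D.be e w) D.vt
  rw [h2]
  refine Finset.prod_eq_one fun w _ => ?_
  have := hP w
  rw [Finset.filter_filter]
  obtain ⟨k, hk⟩ := this
  rw [hk, ← two_mul, pow_mul, sq, Int.units_mul_self, one_pow]

theorem prod_cr (P : Finset (Fin n)) (hP : D.EvenSet P) :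
    (∏ e : Fin n, ∏ f : Fin n, if e < f then cr (D.kP P) e f else 1) = 1 := by
  let g : Fin n → Fin n → ℤˣ := fun e f =>
    if e ∈ P ∧ f ∈ P then D.be e (D.a f) * D.be e (D.b f) else 1
  have hg : ∀ e, g e e = 1 := by
    intro e; simp [g, be_self_a, be_self_b]
  have h1 : ∀ e f : Fin n, (if e < f then cr (D.kP P) e f else 1) =
      if e < f then g e f * g f e else 1 := by
    intro e f
    by_cases hlt : e < f
    · simp only [hlt, if_true]
      by_cases h : e ∈ P ∧ f ∈ P
      · rw [cr_kP_mem _ _ _ _ h.1 h.2, D.cr_eq e f (ne_of_lt hlt)]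
        simp [g, h.1, h.2]
      · rw [cr_kP_not _ _ _ _ (ne_of_lt hlt) h]
        have h' : ¬ (f ∈ P ∧ e ∈ P) := fun h' => h ⟨h'.2, h'.1⟩
        simp only [g, if_neg h, if_neg h', mul_one]
    · simp [hlt]
  simp only [h1]
  rw [prod_lt_symm g hg]
  refine Finset.prod_eq_one fun e _ => ?_
  by_cases he : e ∈ P
  · simpa [g, he] using D.prod_be P hP e
  · simp [g, he]

theorem pfn_MP_even (P : Finset (Fin n)) (hP : D.EvenSet P) :
    pfn (MP (Tk D.kU D.vt) P) = pfn (J (Fin n) ℝ) := by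
  rw [MP_Tk, pfn_Tk_even (D.kP P) (D.kP_inj P) (D.lab P) (D.lab_conv P) ?_ (D.kP_01 P)]
  · have := D.prod_cr P hP
    unfold cr at this
    rw [this]; simp
  · rintro (w | e)
    · convert hP w using 3
      rename_i h _
      by_cases hh : h.1 ∈ P <;> simp [lab, hh]
    · by_cases he : e ∈ P
      · have : univ.filter (fun h => D.lab P h = Sum.inr e) = ∅ := by
          ext ⟨f, t⟩
          rw [Finset.mem_filter]
          by_cases hh : f ∈ P
          · simp [lab, hh]
          · simp only [lab, hh, if_false, Sum.inr.injEq, mem_univ, true_and,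
              notMem_empty, iff_false]
            rintro rfl; exact hh he
        rw [this]; simp
      · have : univ.filter (fun h => D.lab P h = Sum.inr e) = {(e, false), (e, true)} := by
          ext ⟨f, t⟩
          rw [Finset.mem_filter]
          by_cases hh : f ∈ P
          · have : f ≠ e := by rintro rfl; exact he hh
            simp [lab, hh, this]
          · cases t <;> simp [lab, hh]
        rw [this, Finset.card_pair (by simp)]
        exact even_two

theorem pfn_MP_odd (P : Finset (Fin n)) (hP : ¬ D.EvenSet P) :
    pfn (MP (Tk D.kU D.vt) P) = 0 := by
  unfold EvenSet at hP
  push Not at hP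
  obtain ⟨w, hw⟩ := hP
  rw [MP_Tk]
  refine pfn_Tk_odd _ _ (Sum.inl w) ?_
  rw [Nat.not_even_iff_odd] at *
  convert hw using 3
  rename_i h _
  by_cases hh : h.1 ∈ P <;> simp [lab, hh]

open Classical in
/-- generating function of even edge sets -/
noncomputable def evenGen (D : PlaneData U n) (x : Fin n → ℝ) : ℝ :=
  ∑ P : Finset (Fin n), if D.EvenSet P then ∏ e ∈ P, x e else 0

theorem det_eq (x : Fin n → ℝ) :
    (1 - (Matrix.diagonal (fun h : Fin n × Bool => if h.2 then 1 else x h.1) * Tk D.kU D.vt *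
      Matrix.diagonal (fun h : Fin n × Bool => if h.2 then 1 else x h.1)) * J (Fin n) ℝ).det
      = D.evenGen x ^ 2 := by
  set Q := Matrix.diagonal (fun h : Fin n × Bool => if h.2 then 1 else x h.1) * Tk D.kU D.vt *
      Matrix.diagonal (fun h : Fin n × Bool => if h.2 then 1 else x h.1) with hQ
  have hT : (Tk D.kU D.vt)ᵀ = - Tk D.kU D.vt := by
    ext a c
    simp only [Tk, Matrix.transpose_apply, Matrix.of_apply, Matrix.neg_apply]
    by_cases h : D.vt a = D.vt c
    · rcases lt_trichotomy (D.kU a) (D.kU c) with h' | h' | h'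
      · simp [h, h', not_lt_of_gt h']
      · simp [h, h']
      · simp [h, h', not_lt_of_gt h']
    · simp [h, Ne.symm h]
  have hQt : Qᵀ = -Q := by
    rw [hQ, Matrix.transpose_mul, Matrix.transpose_mul, hT]
    simp [Matrix.mul_assoc]
  have h1 := pfn_sq Q hQt
  have h2 : pfn (J (Fin n) ℝ + Q) = D.evenGen x * pfn (J (Fin n) ℝ) := by
    rw [pfn_expand, evenGen, Finset.sum_mul]
    refine Finset.sum_congr rfl fun P _ => ?_
    rw [hQ, pfn_MP_scale]
    by_cases hP : D.EvenSet P
    · rw [pfn_MP_even _ _ hP, if_pos hP]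
    · rw [pfn_MP_odd _ _ hP, if_neg hP]; simp
  have h3 := pfn_J_pos (E := Fin n)
  rw [h2, mul_pow] at h1
  exact (mul_right_cancel₀ (pow_ne_zero 2 h3.ne') h1).symm

end PlaneData
end geom2
end KW

namespace KW
open Matrix Finset

section gauge

theorem half_arg (r : ℝ) (hr : 0 < r) (α : ℝ) (hα : α ∈ Set.Ioc (-Real.pi) Real.pi) (z : ℂ)
    (hz : z = r * Complex.exp (α * Complex.I)) :
    Complex.exp (Complex.I / 2 * (Complex.arg z : ℂ)) = Complex.exp (α / 2 * Complex.I) := by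
  have : Complex.arg z = α := by
    rw [hz, Complex.exp_mul_I, Complex.arg_mul_cos_add_sin_mul_I hr hα]
  rw [this]
  congr 1
  ring

variable {U : Type*} [DecidableEq U] {n : ℕ} (D : PlaneData U n)

namespace PlaneData

/-- complex position -/
noncomputable def z (w : U) : ℂ := ⟨D.x w, D.y w⟩

/-- opposite half edge -/
def fl (h : Fin n × Bool) : Fin n × Bool := (h.1, !h.2)

/-- angle of the outgoing direction at a half edge -/
noncomputable def psi (h : Fin n × Bool) : ℝ :=
  if h.2 then Real.arctan (D.m h.1) - Real.pi else Real.arctan (D.m h.1)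

/-- half-angle gauge -/
noncomputable def sg (h : Fin n × Bool) : ℂ := Complex.exp (D.psi h / 2 * Complex.I)

theorem exp_pi_half : Complex.exp (Real.pi / 2 * Complex.I) = Complex.I := by
  rw [Complex.exp_mul_I, Complex.cos_pi_div_two, Complex.sin_pi_div_two]; simp

theorem exp_neg_pi_half : Complex.exp (-(Real.pi / 2 * Complex.I)) = -Complex.I := by
  rw [Complex.exp_neg, exp_pi_half, Complex.inv_I]

theorem sg_fl (g : Fin n × Bool) : -Complex.I * D.sg (fl g) = (J (Fin n) ℝ (fl g) g : ℂ) * D.sg g := by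
  obtain ⟨e, s⟩ := g
  cases s
  · simp only [sg, fl, psi, Bool.not_false, if_true, J, Matrix.of_apply]
    rw [show ((((Real.arctan (D.m e) - Real.pi : ℝ) : ℂ)) / 2 * Complex.I) =
      (Real.arctan (D.m e) : ℂ) / 2 * Complex.I + -(Real.pi / 2 * Complex.I) by push_cast; ring,
      Complex.exp_add, exp_neg_pi_half]
    simp [-Complex.ofReal_arctan]
    linear_combination (Complex.exp (Complex.ofReal (Real.arctan (D.m e)) / 2 * Complex.I)) * Complex.I_mul_I
  · simp only [sg, fl, psi, Bool.not_true, if_true, J, Matrix.of_apply]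
    rw [show ((((Real.arctan (D.m e) - Real.pi : ℝ) : ℂ)) / 2 * Complex.I) =
      (Real.arctan (D.m e) : ℂ) / 2 * Complex.I + -(Real.pi / 2 * Complex.I) by push_cast; ring,
      Complex.exp_add, exp_neg_pi_half]
    simp
    ring

theorem dir_edge (e : Fin n) : ∃ r : ℝ, 0 < r ∧ D.z (D.b e) - D.z (D.a e) =
    r * Complex.exp (Real.arctan (D.m e) * Complex.I) := by
  have he := sub_pos.2 (D.hab e)
  have hs : 0 < Real.sqrt (1 + D.m e ^ 2) := Real.sqrt_pos.2 (by positivity)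
  refine ⟨(D.x (D.b e) - D.x (D.a e)) * Real.sqrt (1 + D.m e ^ 2), by positivity, ?_⟩
  rw [Complex.exp_mul_I, ← Complex.ofReal_cos, ← Complex.ofReal_sin, Real.cos_arctan,
    Real.sin_arctan]
  have hm : D.m e * (D.x (D.b e) - D.x (D.a e)) = D.y (D.b e) - D.y (D.a e) := by
    unfold m; field_simp
  apply Complex.ext
  · simp [z]; field_simp
  · simp [z]; field_simp; linarith

theorem dir_half (h : Fin n × Bool) : ∃ r : ℝ, 0 < r ∧ D.z (D.vt (fl h)) - D.z (D.vt h) =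
    r * Complex.exp (D.psi h * Complex.I) := by
  obtain ⟨e, s⟩ := h
  obtain ⟨r, hr, h⟩ := D.dir_edge e
  refine ⟨r, hr, ?_⟩
  cases s
  · simpa [fl, psi] using h
  · simp only [fl, psi, Bool.not_true, vt_true, vt_false, if_true]
    rw [← neg_sub, h]
    rw [Complex.ofReal_sub, sub_mul, Complex.exp_sub, Complex.exp_pi_mul_I]
    ring

theorem psi_bd (h : Fin n × Bool) : -(3 * Real.pi / 2) < D.psi h ∧ D.psi h < Real.pi / 2 := by
  have h1 := Real.arctan_lt_pi_div_two (D.m h.1)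
  have h2 := Real.neg_pi_div_two_lt_arctan (D.m h.1)
  have := Real.pi_pos
  unfold psi
  split_ifs <;> constructor <;> linarith

theorem psi_lt (h f : Fin n × Bool) (hv : D.vt h = D.vt f) (hlt : D.kU h < D.kU f) :
    D.psi h < D.psi f := by
  obtain ⟨e, s⟩ := h
  obtain ⟨f, t⟩ := f
  rw [kU_lt, hv] at hlt
  have h1 := Real.arctan_lt_pi_div_two (D.m e)
  have h2 := Real.neg_pi_div_two_lt_arctan (D.m f)
  simp only [lt_irrefl, true_and, false_or] at hlt
  rcases hlt with ⟨rfl, rfl⟩ | ⟨rfl, hm⟩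
  · simp [psi]; linarith
  · have := Real.arctan_strictMono hm
    cases s <;> simp [psi, hm]

theorem angle (h f : Fin n × Bool) (hv : D.vt h = D.vt f) (hne : h ≠ f) :
    Complex.exp (Complex.I / 2 * (Complex.arg ((D.z (D.vt (fl f)) - D.z (D.vt h)) /
      (D.z (D.vt h) - D.z (D.vt (fl h)))) : ℂ)) =
    (D.sg h)⁻¹ * ((Tk D.kU D.vt h f : ℝ) : ℂ) * (-Complex.I * D.sg f) := by
  obtain ⟨r, hr, h1⟩ := D.dir_half h
  obtain ⟨q, hq, h2⟩ := D.dir_half f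
  have hrc : (r : ℂ) ≠ 0 := by exact_mod_cast hr.ne'
  rw [← neg_sub (D.z (D.vt (fl h))), h1, hv, h2]
  have b1 := D.psi_bd h
  have b2 := D.psi_bd f
  have hk : D.kU h ≠ D.kU f := fun hk => hne (D.kU_inj hk)
  rcases lt_or_gt_of_ne hk with hlt | hlt
  · have hp := D.psi_lt h f hv hlt
    rw [half_arg (q / r) (by positivity) (D.psi f - D.psi h - Real.pi)
      ⟨by linarith, by linarith⟩]
    · simp only [Tk, Matrix.of_apply, hv, hlt, if_true, sg]
      rw [← Complex.exp_neg, ← exp_neg_pi_half]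
      simp only [Complex.ofReal_one, mul_one]
      rw [← Complex.exp_add, ← Complex.exp_add]
      congr 1
      push_cast; ring
    · push_cast
      rw [sub_mul, sub_mul, Complex.exp_sub, Complex.exp_sub, Complex.exp_pi_mul_I]
      field_simp
  · have hp := D.psi_lt f h hv.symm hlt
    rw [half_arg (q / r) (by positivity) (D.psi f - D.psi h + Real.pi)
      ⟨by linarith, by linarith⟩]
    · simp only [Tk, Matrix.of_apply, hv, hlt, not_lt_of_gt hlt, if_true, if_false, sg]
      rw [← Complex.exp_neg]
      rw [show ∀ a b : ℂ, a * ((-1 : ℝ) : ℂ) * (-Complex.I * b) =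
          a * (Complex.exp (Real.pi / 2 * Complex.I) * b) by
        intro a b; rw [exp_pi_half]; push_cast; ring]
      rw [← Complex.exp_add, ← Complex.exp_add]
      congr 1
      push_cast; ring
    · push_cast
      rw [add_mul, sub_mul, Complex.exp_add, Complex.exp_sub, Complex.exp_pi_mul_I]
      field_simp

theorem half_eq (h f : Fin n × Bool) (h1 : D.vt h = D.vt f) (h2 : D.vt (fl h) = D.vt (fl f)) :
    h = f := by
  obtain ⟨e, s⟩ := h
  obtain ⟨f, t⟩ := f
  have he := D.hab e
  have hf := D.hab f
  cases s <;> cases t <;> simp only [fl, Bool.not_true, Bool.not_false, vt_true, vt_false] at h1 h2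
  · rw [D.hed e f h1 h2]
  · rw [h1, h2] at he; exact absurd he (not_lt_of_gt hf)
  · rw [h1, h2] at he; exact absurd he (not_lt_of_gt hf)
  · rw [D.hed e f h2 h1]

/-- Kac-Ward transition matrix on half edges -/
noncomputable def Ah : Matrix (Fin n × Bool) (Fin n × Bool) ℂ := Matrix.of fun h g =>
  if D.vt h = D.vt (fl g) ∧ D.vt (fl h) ≠ D.vt g then
    Complex.exp (Complex.I / 2 * (Complex.arg ((D.z (D.vt g) - D.z (D.vt h)) /
      (D.z (D.vt h) - D.z (D.vt (fl h)))) : ℂ)) else 0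

theorem fl_fl (h : Fin n × Bool) : fl (fl h) = h := by simp [fl]

theorem TJ_apply (h g : Fin n × Bool) :
    (Tk D.kU D.vt * J (Fin n) ℝ) h g = Tk D.kU D.vt h (fl g) * J (Fin n) ℝ (fl g) g := by
  rw [Matrix.mul_apply]
  refine Finset.sum_eq_single _ ?_ (by simp)
  intro k _ hk
  have : J (Fin n) ℝ k g = 0 := by
    obtain ⟨e, s⟩ := k
    obtain ⟨f, t⟩ := g
    simp only [J, Matrix.of_apply]
    by_cases hef : e = f
    · subst hef
      have : s = t := by
        by_contra hst
        apply hk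
        revert hst
        cases s <;> cases t <;> simp [fl]
      simp [this]
    · simp [hef]
  rw [this, mul_zero]

theorem Ah_eq (h g : Fin n × Bool) :
    D.Ah h g = (D.sg h)⁻¹ * (((Tk D.kU D.vt * J (Fin n) ℝ) h g : ℝ) : ℂ) * D.sg g := by
  rw [TJ_apply]
  push_cast
  rw [show (D.sg h)⁻¹ * (((Tk D.kU D.vt h (fl g) : ℝ) : ℂ) * ((J (Fin n) ℝ (fl g) g : ℝ) : ℂ)) *
    D.sg g = (D.sg h)⁻¹ * ((Tk D.kU D.vt h (fl g) : ℝ) : ℂ) *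
    (((J (Fin n) ℝ (fl g) g : ℝ) : ℂ) * D.sg g) by ring, ← sg_fl]
  simp only [Ah, Matrix.of_apply]
  by_cases hv : D.vt h = D.vt (fl g)
  · by_cases hv2 : D.vt (fl h) = D.vt g
    · have : h = fl g := D.half_eq h (fl g) hv (by rw [fl_fl]; exact hv2)
      rw [← this]
      simp [hv2, Tk]
    · rw [if_pos ⟨hv, hv2⟩]
      have := D.angle h (fl g) hv (by rintro rfl; exact hv2 (by rw [fl_fl]))
      rw [fl_fl] at this
      exact this
  · simp [hv, Tk]

theorem det_Ah (t : Fin n → ℝ) :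
    (1 - D.Ah * Matrix.diagonal (fun h : Fin n × Bool => (t h.1 : ℂ))).det =
      ((D.evenGen t ^ 2 : ℝ) : ℂ) := by
  let S : Matrix (Fin n × Bool) (Fin n × Bool) ℂ := Matrix.diagonal D.sg
  let S' : Matrix (Fin n × Bool) (Fin n × Bool) ℂ := Matrix.diagonal (fun h => (D.sg h)⁻¹)
  let T : Matrix (Fin n × Bool) (Fin n × Bool) ℝ := Tk D.kU D.vt
  let De : Matrix (Fin n × Bool) (Fin n × Bool) ℝ :=
    Matrix.diagonal (fun h : Fin n × Bool => if h.2 then 1 else t h.1)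
  let Dt : Matrix (Fin n × Bool) (Fin n × Bool) ℝ :=
    Matrix.diagonal (fun h : Fin n × Bool => t h.1)
  let c : ℝ →+* ℂ := Complex.ofRealHom
  have hSS : S * S' = 1 := by
    simp only [S, S', Matrix.diagonal_mul_diagonal]
    rw [← Matrix.diagonal_one]
    congr 1
    ext h
    exact mul_inv_cancel₀ (Complex.exp_ne_zero _)
  have h1 : D.Ah * Matrix.diagonal (fun h : Fin n × Bool => (t h.1 : ℂ)) =
      S' * (T * J (Fin n) ℝ * Dt).map c * S := by
    ext h g
    simp only [S, S', Dt, Matrix.mul_diagonal, Matrix.diagonal_mul, Matrix.map_apply]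
    rw [Ah_eq]
    simp only [c, Complex.ofRealHom_eq_coe, T]
    push_cast
    ring
  have h2 : (1 - S' * (T * J (Fin n) ℝ * Dt).map c * S).det =
      ((1 - T * J (Fin n) ℝ * Dt).map c).det := by
    rw [Matrix.mul_assoc, Matrix.det_one_sub_mul_comm, Matrix.mul_assoc, hSS, Matrix.mul_one]
    congr 1
    rw [Matrix.map_sub _ (by simp), Matrix.map_one _ (by simp) (by simp)]
  have h3 : J (Fin n) ℝ * Dt = De * J (Fin n) ℝ * De := by
    ext ⟨e, s⟩ ⟨f, u⟩
    simp only [De, Dt, Matrix.mul_diagonal, Matrix.diagonal_mul, J, Matrix.of_apply]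
    by_cases hef : e = f
    · subst hef
      cases s <;> cases u <;> simp
    · simp [hef]
  have h4 : (1 - T * J (Fin n) ℝ * Dt).det = D.evenGen t ^ 2 := by
    rw [← D.det_eq t]
    rw [Matrix.mul_assoc, h3, ← Matrix.mul_assoc, Matrix.det_one_sub_mul_comm]
    simp only [Matrix.mul_assoc, De, T]
  rw [h1, h2, ← h4]
  exact (RingHom.map_det c _).symm

end PlaneData
end gauge
end KW

namespace KW
open Matrix Finset

section ising
variable {U : Type*} [DecidableEq U] [Fintype U] {n : ℕ} (D : PlaneData U n)

namespace PlaneData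

theorem sum_spin (P : Finset (Fin n)) [Decidable (D.EvenSet P)] :
    (∑ x : U → Bool, ∏ i ∈ P, (spin (x (D.a i)) * spin (x (D.b i)))) =
      if D.EvenSet P then (2 : ℝ) ^ Fintype.card U else 0 := by
  let dg : U → ℕ := fun w => (univ.filter (fun h : Fin n × Bool => h.1 ∈ P ∧ D.vt h = w)).card
  have h1 : ∀ x : U → Bool, ∏ i ∈ P, (spin (x (D.a i)) * spin (x (D.b i))) =
      ∏ w, spin (x w) ^ dg w := by
    intro x
    have h2 : ∏ i ∈ P, (spin (x (D.a i)) * spin (x (D.b i))) =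
        ∏ h ∈ univ.filter (fun h : Fin n × Bool => h.1 ∈ P), spin (x (D.vt h)) := by
      rw [Finset.prod_filter, Fintype.prod_prod_type, ← Finset.prod_filter_mul_prod_filter_not univ (· ∈ P)]
      rw [show (∏ i ∈ univ.filter (fun i => ¬ i ∈ P), ∏ y : Bool,
        if i ∈ P then spin (x (D.vt (i, y))) else 1) = 1 from
        Finset.prod_eq_one fun i hi => by simp [(Finset.mem_filter.1 hi).2], mul_one]
      rw [show univ.filter (· ∈ P) = P by ext; simp]
      refine Finset.prod_congr rfl fun i hi => ?_
      simp [hi, mul_comm]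
    rw [h2, ← Finset.prod_fiberwise (univ.filter (fun h : Fin n × Bool => h.1 ∈ P)) D.vt]
    refine Finset.prod_congr rfl fun w _ => ?_
    rw [Finset.filter_filter]
    rw [Finset.prod_congr rfl (g := fun _ => spin (x w))
      (fun h hh => by rw [(Finset.mem_filter.1 hh).2.2]), Finset.prod_const]
  simp only [h1]
  have h3 := Finset.prod_univ_sum (fun _ : U => (univ : Finset Bool)) (fun w b => spin b ^ dg w)
  rw [Fintype.piFinset_univ] at h3
  rw [← h3]
  split_ifs with hP
  · rw [← Finset.card_univ, ← Finset.prod_const]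
    refine Finset.prod_congr rfl fun w _ => ?_
    have := (hP w).neg_one_pow (α := ℝ)
    simp only [Fintype.sum_bool, spin, dg]
    simp [this]; norm_num
  · unfold EvenSet at hP
    push Not at hP
    obtain ⟨w, hw⟩ := hP
    refine Finset.prod_eq_zero (mem_univ w) ?_
    rw [Nat.not_even_iff_odd] at hw
    have := hw.neg_one_pow (α := ℝ)
    simp only [Fintype.sum_bool, spin, dg]
    simp [this]

theorem ising_sum (t : Fin n → ℝ) :
    (∑ x : U → Bool, ∏ i, (1 + t i * (spin (x (D.a i)) * spin (x (D.b i))))) =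
      2 ^ Fintype.card U * D.evenGen t := by
  classical
  simp only [Finset.prod_one_add, Finset.powerset_univ, Finset.prod_mul_distrib (f := t)]
  rw [Finset.sum_comm, evenGen, Finset.mul_sum]
  refine Finset.sum_congr rfl fun P _ => ?_
  rw [← Finset.mul_sum, sum_spin]
  split_ifs <;> ring

end PlaneData

theorem exp_spin (θ : ℝ) (p q : Bool) : Real.exp (θ * (spin p * spin q)) =
    Real.cosh θ * (1 + Real.tanh θ * (spin p * spin q)) := by
  have hc := (Real.cosh_pos θ).ne'
  rw [Real.tanh_eq_sinh_div_cosh]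
  cases p <;> cases q <;> simp only [spin, if_true] <;> field_simp <;> simp [← Real.cosh_add_sinh,
    ← Real.cosh_sub_sinh] <;> ring

end ising
end KW

namespace KW
open Matrix Finset

section build
variable {U : Type*} [DecidableEq U] [Fintype U]

theorem exists_rotation (v : U → ℂ) (hinj : Function.Injective v) :
    ∃ c : ℂ, c ≠ 0 ∧ Function.Injective (fun w => (v w * c).re) := by
  classical
  obtain ⟨t, ht⟩ := Infinite.exists_notMem_finset
    ((univ : Finset (U × U)).image (fun p => -((v p.1).re - (v p.2).re) / ((v p.1).im - (v p.2).im)))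
  refine ⟨⟨1, -t⟩, fun h => by simpa using congrArg Complex.re h, ?_⟩
  intro i j hij
  by_contra hne
  simp only [Complex.mul_re] at hij
  by_cases him : (v i).im - (v j).im = 0
  · apply hne
    apply hinj
    have him' : (v i).im = (v j).im := by linarith
    apply Complex.ext _ him'
    rw [him'] at hij
    linarith
  · apply ht
    rw [Finset.mem_image]
    refine ⟨(i, j), mem_univ _, ?_⟩
    rw [div_eq_iff him]
    linarith

theorem seg_pt (p q : ℂ) (h : p.re < q.re) (X : ℝ) :
    (⟨X, p.im + (q.im - p.im) / (q.re - p.re) * (X - p.re)⟩ : ℂ) =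
      (1 - (X - p.re) / (q.re - p.re) : ℝ) • p + ((X - p.re) / (q.re - p.re) : ℝ) • q := by
  have : q.re - p.re ≠ 0 := by linarith
  apply Complex.ext
  · simp only [Complex.add_re, Complex.add_im, Complex.smul_re, Complex.smul_im, smul_eq_mul]
    field_simp; ring
  · simp only [Complex.add_re, Complex.add_im, Complex.smul_re, Complex.smul_im, smul_eq_mul]
    field_simp; ring

theorem seg_unit (p q X : ℝ) (h1 : p < X) (h2 : X < q) :
    0 < 1 - (X - p) / (q - p) ∧ 0 < (X - p) / (q - p) := by
  have h : 0 < q - p := by linarith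
  refine ⟨?_, div_pos (by linarith) h⟩
  rw [sub_pos, div_lt_one h]
  linarith

theorem exists_planeData (G : SimpleGraph U) (v : U → ℂ)
    (hcross : ∀ i j k l : U, G.Adj i j → G.Adj k l → s(i, j) ≠ s(k, l) →
      segment ℝ (v i) (v j) ∩ segment ℝ (v k) (v l) ⊆ ({v i, v j} : Set ℂ) ∩ {v k, v l})
    (hvert : ∀ i j : U, G.Adj i j → ∀ k : U, k ≠ i → k ≠ j →
      v k ∉ openSegment ℝ (v i) (v j)) (c : ℂ) (hc : c ≠ 0)
    (hci : Function.Injective (fun w => (v w * c).re)) :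
    ∃ (n : ℕ) (D : PlaneData U n), (∀ w, D.z w = v w * c) ∧ (∀ e, G.Adj (D.a e) (D.b e)) ∧
      (∀ i j, G.Adj i j → D.x i < D.x j → ∃ e, D.a e = i ∧ D.b e = j) := by
  classical
  let Eo := {p : U × U // G.Adj p.1 p.2 ∧ (v p.1 * c).re < (v p.2 * c).re}
  let ε : Fin (Fintype.card Eo) ≃ Eo := (Fintype.equivFin Eo).symm
  refine ⟨Fintype.card Eo,
    { x := fun w => (v w * c).re
      y := fun w => (v w * c).im
      a := fun e => (ε e).1.1
      b := fun e => (ε e).1.2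
      hx := hci
      hab := fun e => (ε e).2.2
      hed := ?_
      hvert := ?_
      hcross := ?_ }, ?_, ?_, ?_⟩
  · intro e f h1 h2
    apply ε.injective
    exact Subtype.ext (Prod.ext h1 h2)
  · intro e w h1 h2 h3
    refine hvert _ _ (ε e).2.1 w ?_ ?_ ?_
    · rintro rfl; exact lt_irrefl _ h1
    · rintro rfl; exact lt_irrefl _ h2
    · have hu := seg_unit _ _ _ h1 h2
      refine ⟨_, _, hu.1, hu.2, by ring, ?_⟩
      apply mul_right_cancel₀ hc
      rw [add_mul, smul_mul_assoc, smul_mul_assoc, ← seg_pt _ _ (ε e).2.2, ← h3]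
  · intro e f X hef h1 h2 h3 h4 h5
    have hs : s((ε e).1.1, (ε e).1.2) ≠ s((ε f).1.1, (ε f).1.2) := by
      intro h
      rw [Sym2.eq_iff] at h
      rcases h with h | h
      · exact hef (ε.injective (Subtype.ext (Prod.ext h.1 h.2)))
      · have h6 := (ε e).2.2
        rw [h.1, h.2] at h6
        exact absurd h6 (not_lt_of_gt (ε f).2.2)
    have hu := seg_unit _ _ _ h1 h2
    have hu' := seg_unit _ _ _ h3 h4
    have e1 := seg_pt _ _ (ε e).2.2 X
    have e2 := seg_pt _ _ (ε f).2.2 X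
    rw [h5, e2] at e1
    rw [← h5] at e2
    have hmem := hcross _ _ _ _ (ε e).2.1 (ε f).2.1 hs
      ⟨⟨_, _, hu.1.le, hu.2.le, by ring, rfl⟩, ⟨_, _, hu'.1.le, hu'.2.le, by ring, ?_⟩⟩
    · have key : ∀ w, (1 - (X - (v (ε e).1.1 * c).re) / ((v (ε e).1.2 * c).re - (v (ε e).1.1 * c).re)) • v (ε e).1.1 +
          ((X - (v (ε e).1.1 * c).re) / ((v (ε e).1.2 * c).re - (v (ε e).1.1 * c).re)) • v (ε e).1.2 = v w →
          X = (v w * c).re := by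
        intro w hw
        rw [← hw, add_mul, smul_mul_assoc, smul_mul_assoc, ← seg_pt _ _ (ε e).2.2]
      rcases hmem.1 with h | h
      · exact absurd (key _ h) (ne_of_gt h1)
      · exact absurd (key _ h) (ne_of_lt h2)
    · apply mul_right_cancel₀ hc
      rw [add_mul, smul_mul_assoc, smul_mul_assoc, add_mul, smul_mul_assoc, smul_mul_assoc]
      exact e1
  · intro w; rfl
  · intro e; exact (ε e).2.1
  · intro i j h1 h2
    refine ⟨ε.symm ⟨(i, j), h1, h2⟩, ?_, ?_⟩ <;> simp

end build
end KW

/-- **Kac–Ward formula.** For a zero-field Ising model on a finite simple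
planar graph `G` with a straight-line planar embedding `v : V → ℂ`, the Kac–Ward matrix
`W = A·D` (indexed by directed edges, `D` diagonal with entries `tanh θ_{ij}`, and
`A_{(i,j),(k,l)} = exp((i/2)·φ_{ijl})` when `j = k`, `i ≠ l`) satisfies: `det(I − W)` is a
nonnegative real number and
`Z = 2^n (∏_{{i,j}∈E} cosh θ_{ij}) det(I − W)^{1/2}`; equivalently
`Z² = 4^n (∏ cosh θ)² det(I − W)`. -/
theorem kac_ward_formula
    (G : SimpleGraph V) [DecidableRel G.Adj]
    (v : V → ℂ) (hinj : Function.Injective v)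
    (hcross : ∀ i j k l : V, G.Adj i j → G.Adj k l → s(i, j) ≠ s(k, l) →
      segment ℝ (v i) (v j) ∩ segment ℝ (v k) (v l) ⊆ ({v i, v j} : Set ℂ) ∩ {v k, v l})
    (hvert : ∀ i j : V, G.Adj i j → ∀ k : V, k ≠ i → k ≠ j →
      v k ∉ openSegment ℝ (v i) (v j))
    (θ : Sym2 V → ℝ)
    (A W : Matrix {p : V × V // G.Adj p.1 p.2} {p : V × V // G.Adj p.1 p.2} ℂ)
    (hA : ∀ d d' : {p : V × V // G.Adj p.1 p.2}, A d d' =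
      if d.1.2 = d'.1.1 ∧ d.1.1 ≠ d'.1.2 then
        Complex.exp (Complex.I / 2 *
          (Complex.arg ((v d'.1.2 - v d.1.2) / (v d.1.2 - v d.1.1)) : ℂ))
      else 0)
    (hW : W = A * Matrix.diagonal (fun d => (Real.tanh (θ s(d.1.1, d.1.2)) : ℂ))) :
    (1 - W).det.im = 0 ∧ 0 ≤ (1 - W).det.re ∧
    partitionFn G (fun _ => 0) θ =
      2 ^ (Fintype.card V) * (∏ e ∈ G.edgeFinset, Real.cosh (θ e)) *
        Real.sqrt ((1 - W).det.re) ∧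
    (partitionFn G (fun _ => 0) θ) ^ 2 =
      4 ^ (Fintype.card V) * (∏ e ∈ G.edgeFinset, Real.cosh (θ e)) ^ 2 * (1 - W).det.re := by

  classical
  obtain ⟨c, hc, hci⟩ := KW.exists_rotation v hinj
  obtain ⟨n, D, hz, hadj, hsurj⟩ := KW.exists_planeData G v hcross hvert c hc hci
  -- directed edges
  have hadj' : ∀ h : Fin n × Bool, G.Adj (D.vt (KW.PlaneData.fl h)) (D.vt h) := by
    rintro ⟨e, s⟩
    cases s
    · exact (hadj e).symm
    · exact hadj e
  let Φ0 : Fin n × Bool → {p : V × V // G.Adj p.1 p.2} := fun h =>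
    ⟨(D.vt (KW.PlaneData.fl h), D.vt h), hadj' h⟩
  have hΦ : Function.Bijective Φ0 := by
    constructor
    · intro h f hf
      have h1 := congrArg Subtype.val hf
      exact D.half_eq h f (congrArg Prod.snd h1) (congrArg Prod.fst h1)
    · rintro ⟨⟨i, j⟩, hij⟩
      rcases lt_or_gt_of_ne (fun h => hij.ne (D.hx h)) with h | h
      · obtain ⟨e, h1, h2⟩ := hsurj i j hij h
        refine ⟨(e, true), Subtype.ext ?_⟩
        simp [Φ0, KW.PlaneData.fl, h1, h2]
      · obtain ⟨e, h1, h2⟩ := hsurj j i hij.symm h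
        refine ⟨(e, false), Subtype.ext ?_⟩
        simp [Φ0, KW.PlaneData.fl, h1, h2]
  let Φ := Equiv.ofBijective Φ0 hΦ
  let t : Fin n → ℝ := fun e => Real.tanh (θ s(D.a e, D.b e))
  have hWs : (1 - W).submatrix Φ Φ =
      1 - D.Ah * Matrix.diagonal (fun h : Fin n × Bool => (t h.1 : ℂ)) := by
    have hWe : W.submatrix Φ Φ = D.Ah * Matrix.diagonal (fun h : Fin n × Bool => (t h.1 : ℂ)) := by
      ext h g
      rw [Matrix.submatrix_apply, hW, Matrix.mul_diagonal, Matrix.mul_diagonal, hA]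
      have e1 : ((Φ h).1.1 = D.vt (KW.PlaneData.fl h) ∧ (Φ h).1.2 = D.vt h) := ⟨rfl, rfl⟩
      have e2 : ((Φ g).1.1 = D.vt (KW.PlaneData.fl g) ∧ (Φ g).1.2 = D.vt g) := ⟨rfl, rfl⟩
      rw [e1.1, e1.2, e2.1, e2.2]
      have e3 : θ s(D.vt (KW.PlaneData.fl g), D.vt g) = θ s(D.a g.1, D.b g.1) := by
        obtain ⟨e, s⟩ := g
        cases s
        · exact congrArg θ Sym2.eq_swap
        · rfl
      rw [e3]
      congr 1
      simp only [KW.PlaneData.Ah, Matrix.of_apply, hz, ← sub_mul]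
      rw [mul_div_mul_right _ _ hc]
    rw [← hWe]
    ext h g
    simp [Matrix.one_apply]
  have hdet : (1 - W).det = ((D.evenGen t ^ 2 : ℝ) : ℂ) := by
    rw [← D.det_Ah t, ← hWs, Matrix.det_submatrix_equiv_self]
  -- edges
  have himg : G.edgeFinset = Finset.univ.image (fun e : Fin n => s(D.a e, D.b e)) := by
    ext q
    rw [SimpleGraph.mem_edgeFinset, Finset.mem_image]
    induction q using Sym2.ind with
    | _ i j =>
      rw [SimpleGraph.mem_edgeSet]
      constructor
      · intro hij
        rcases lt_or_gt_of_ne (fun h => hij.ne (D.hx h)) with h | h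
        · obtain ⟨e, h1, h2⟩ := hsurj i j hij h
          exact ⟨e, Finset.mem_univ _, by rw [h1, h2]⟩
        · obtain ⟨e, h1, h2⟩ := hsurj j i hij.symm h
          exact ⟨e, Finset.mem_univ _, by rw [h1, h2, Sym2.eq_swap]⟩
      · rintro ⟨e, -, he⟩
        rw [← SimpleGraph.mem_edgeSet, ← he]
        exact hadj e
  have hsinj : Function.Injective (fun e : Fin n => s(D.a e, D.b e)) := by
    intro e f h
    rw [Sym2.eq_iff] at h
    rcases h with h | h
    · exact D.hed e f h.1 h.2
    · have h6 := D.hab e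
      rw [h.1, h.2] at h6
      exact absurd h6 (not_lt_of_gt (D.hab f))
  have hcosh : ∏ e ∈ G.edgeFinset, Real.cosh (θ e) = ∏ e, Real.cosh (θ s(D.a e, D.b e)) := by
    rw [himg, Finset.prod_image (fun e _ f _ h => hsinj h)]
  have hZ : partitionFn G (fun _ => 0) θ =
      2 ^ (Fintype.card V) * (∏ e ∈ G.edgeFinset, Real.cosh (θ e)) * D.evenGen t := by
    have hx : ∀ x : V → Bool, Real.exp (energy G (fun _ => 0) θ x) =
        (∏ e ∈ G.edgeFinset, Real.cosh (θ e)) *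
          ∏ e, (1 + t e * (spin (x (D.a e)) * spin (x (D.b e)))) := by
      intro x
      rw [hcosh, ← Finset.prod_mul_distrib]
      simp only [energy, zero_mul, Finset.sum_const_zero, zero_add]
      rw [himg, Finset.sum_image (fun e _ f _ h => hsinj h), Real.exp_sum]
      refine Finset.prod_congr rfl fun e _ => ?_
      exact KW.exp_spin _ _ _
    unfold partitionFn
    simp only [hx]
    rw [← Finset.mul_sum, D.ising_sum t]
    ring
  have hZpos : 0 < partitionFn G (fun _ => 0) θ := by
    unfold partitionFn
    exact Finset.sum_pos (fun x _ => Real.exp_pos _) Finset.univ_nonempty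
  have hcpos : 0 < ∏ e ∈ G.edgeFinset, Real.cosh (θ e) :=
    Finset.prod_pos fun e _ => Real.cosh_pos _
  have hF : 0 < D.evenGen t := by
    rw [hZ] at hZpos
    exact pos_of_mul_pos_right hZpos (by positivity)
  have hre : (1 - W).det.re = D.evenGen t ^ 2 := by rw [hdet, Complex.ofReal_re]
  refine ⟨by rw [hdet, Complex.ofReal_im], by rw [hre]; positivity, ?_, ?_⟩
  · rw [hre, Real.sqrt_sq hF.le, hZ]
  · rw [hre, hZ, show (4 : ℝ) = 2 ^ 2 by norm_num, ← pow_mul, mul_comm 2, pow_mul]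
    ring
end
end

section
/- Let G=(V,E) be a finite simple planar graph with a straight-line planar embedding v : V → ℂ, let θ : E → ℝ be edge parameters with w_{ij} = tanh θ_{ij}, and let A, D, W = AD be the Kac–Ward matrices of this embedding. Assume I − W is invertible and set S = (I−W)^{−1} A. Then the edge moments of the zero-field Ising model on G satisfy, for every edge {i,j}∈E, μ_{ij} := E_θ[x_i x_j] = w_{ij} − (1/2)(1 − w_{ij}²)(S_{(i,j),(i,j)} + S_{(j,i),(j,i)}). -/
noncomputable section

variable {V : Type*} [Fintype V] [DecidableEq V]

/-! ### Abstract combinatorial core -/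

/-- Sign of the order relation between two darts. -/
def kwSg {D K : Type*} [LinearOrder K] (key : D → K) (a b : D) : ℝ :=
  if key a < key b then 1 else if key b < key a then -1 else 0

/-- Parity sign of the number of elements of `S` before `a`. -/
def kwN {D K : Type*} [LinearOrder K] (key : D → K) (a : D) (S : Finset D) : ℝ :=
  ∏ s ∈ S, if key s < key a then -1 else 1

/-- Local sign matrix. -/
def kwM {D K U : Type*} [LinearOrder K] [DecidableEq U] (key : D → K) (ν : D → U) (a b : D) : ℝ :=
  if ν a = ν b then kwSg key a b else 0

/-- Sets of darts closed under reversal. -/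
def kwClosed {D : Type*} (bar : D → D) (S : Finset D) : Prop := ∀ d ∈ S, bar d ∈ S

/-- Parity condition with two marked vertices. -/
def kwEven {D U : Type*} [DecidableEq U] (ν : D → U) (S : Finset D) (p q : U) : Prop :=
  ∀ u, Even ((S.filter (fun s => ν s = u)).card + (if p = u then 1 else 0) + (if q = u then 1 else 0))

theorem kwN_sq {D K : Type*} [LinearOrder K] (key : D → K) (a : D) (S : Finset D) :
    kwN key a S * kwN key a S = 1 := by
  unfold kwN
  rw [← Finset.prod_mul_distrib]
  apply Finset.prod_eq_one
  intro s _
  split_ifs <;> norm_num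

theorem kw_tele {D K : Type*} [DecidableEq D] [LinearOrder K] (key : D → K)
    (hk : Function.Injective key) (p : D → Prop) [DecidablePred p]
    (hp : ∀ a b, key a ≤ key b → p b → p a) (T : Finset D) :
    2 * ∑ c ∈ T, (if p c then kwN key c T else 0) = 1 - ∏ s ∈ T, (if p s then (-1 : ℝ) else 1) := by
  induction T using Finset.induction_on_max_value key with
  | empty => simp
  | insert a T ha hmax ih =>
    have hlt : ∀ c ∈ T, key c < key a := fun c hc =>
      lt_of_le_of_ne (hmax c hc) (fun h => ha (hk h ▸ hc))
    rw [Finset.sum_insert ha, Finset.prod_insert ha]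
    have h1 : ∀ c ∈ T, kwN key c (insert a T) = kwN key c T := by
      intro c hc
      unfold kwN
      rw [Finset.prod_insert ha, if_neg (not_lt.mpr (hmax c hc)), one_mul]
    have h2 : kwN key a (insert a T) = ∏ s ∈ T, (-1 : ℝ) := by
      unfold kwN
      rw [Finset.prod_insert ha, if_neg (lt_irrefl _), one_mul]
      exact Finset.prod_congr rfl (fun s hs => by rw [if_pos (hlt s hs)])
    rw [Finset.sum_congr rfl (fun c hc => by rw [h1 c hc]), h2, mul_add, ih]
    by_cases hpa : p a
    · have h3 : ∏ s ∈ T, (if p s then (-1 : ℝ) else 1) = ∏ s ∈ T, (-1 : ℝ) :=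
        Finset.prod_congr rfl (fun s hs => by rw [if_pos (hp _ _ (hmax s hs) hpa)])
      rw [h3, if_pos hpa, if_pos hpa]; ring
    · rw [if_neg hpa, if_neg hpa]; ring

/-- Alternating-sum identity, version with the other mark outside of the block. -/
theorem kw_alt_out {D K : Type*} [DecidableEq D] [LinearOrder K] (key : D → K)
    (hk : Function.Injective key) (T : Finset D) (hT : Odd T.card) (a : D) :
    ∑ c ∈ T, kwSg key a c * kwN key c T = if a ∈ T then 0 else kwN key a T := by
  have e1 := kw_tele key hk (fun _ => True) (fun _ _ _ _ => trivial) T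
  have e2 := kw_tele key hk (fun c => key c < key a) (fun x y h1 h2 => lt_of_le_of_lt h1 h2) T
  simp only [if_true, Finset.prod_const, hT.neg_one_pow] at e1
  have e3 : ∑ c ∈ T, (if c = a then kwN key c T else 0) = if a ∈ T then kwN key a T else 0 := by
    rw [Finset.sum_ite_eq']
  have e4 : ∑ c ∈ T, kwSg key a c * kwN key c T = ∑ c ∈ T, kwN key c T
      - 2 * ∑ c ∈ T, (if key c < key a then kwN key c T else 0)
      - ∑ c ∈ T, (if c = a then kwN key c T else 0) := by
    rw [Finset.mul_sum, ← Finset.sum_sub_distrib, ← Finset.sum_sub_distrib]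
    apply Finset.sum_congr rfl
    intro c _
    unfold kwSg
    rcases lt_trichotomy (key a) (key c) with h | h | h
    · have : c ≠ a := by rintro rfl; exact lt_irrefl _ h
      simp [h, not_lt.mpr h.le, this]
    · have : a = c := hk h
      simp [this]
    · have : c ≠ a := by rintro rfl; exact lt_irrefl _ h
      simp [h, not_lt.mpr h.le, this]; ring
  have e5 : ∏ s ∈ T, (if key s < key a then (-1 : ℝ) else 1) = kwN key a T := rfl
  rw [e5] at e2
  rw [e4, e3]
  split_ifs <;> linarith

/-- Alternating-sum identity, version with the other mark inside of the block. -/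
theorem kw_alt_in {D K : Type*} [DecidableEq D] [LinearOrder K] (key : D → K)
    (hk : Function.Injective key) (T : Finset D) (hT : Even T.card) (a b : D) (hb : b ∉ T) :
    kwN key b T * kwSg key a b + ∑ c ∈ T, kwSg key a c * kwSg key c b * kwN key c T
      = if a ∈ T then 0 else kwSg key a b * kwN key a T := by
  have e1 := kw_tele key hk (fun _ => True) (fun _ _ _ _ => trivial) T
  have e2 := kw_tele key hk (fun c => key c < key a) (fun x y h1 h2 => lt_of_le_of_lt h1 h2) T
  have e2' := kw_tele key hk (fun c => key c < key b) (fun x y h1 h2 => lt_of_le_of_lt h1 h2) T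
  simp only [if_true, Finset.prod_const, hT.neg_one_pow] at e1
  have e3 : ∑ c ∈ T, (if c = a then kwN key c T else 0) = if a ∈ T then kwN key a T else 0 := by
    rw [Finset.sum_ite_eq']
  have e5 : ∏ s ∈ T, (if key s < key a then (-1 : ℝ) else 1) = kwN key a T := rfl
  have e5' : ∏ s ∈ T, (if key s < key b then (-1 : ℝ) else 1) = kwN key b T := rfl
  rw [e5] at e2
  rw [e5'] at e2'
  have e4 : ∑ c ∈ T, kwSg key a c * kwSg key c b * kwN key c T =
      kwSg key a b * (2 * ∑ c ∈ T, (if key c < key b then kwN key c T else 0)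
      - 2 * ∑ c ∈ T, (if key c < key a then kwN key c T else 0)
      - ∑ c ∈ T, (if c = a then kwN key c T else 0))
      - ∑ c ∈ T, kwN key c T := by
    rw [Finset.mul_sum, Finset.mul_sum, ← Finset.sum_sub_distrib, ← Finset.sum_sub_distrib,
      Finset.mul_sum, ← Finset.sum_sub_distrib]
    apply Finset.sum_congr rfl
    intro c hc
    have hcb : key c ≠ key b := fun h => hb (hk h ▸ hc)
    have hca : (c = a) ↔ key c = key a := hk.eq_iff.symm
    rw [if_congr hca rfl rfl]
    unfold kwSg
    generalize kwN key c T = t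
    generalize key a = x at *
    generalize key b = y at *
    generalize key c = z at *
    rcases lt_trichotomy x y with h | h | h <;> rcases lt_trichotomy z y with h' | h' | h' <;>
    rcases lt_trichotomy x z with h'' | h'' | h'' <;>
    first
    | (exfalso; order)
    | (have := h.not_gt; have := h'.not_gt; have := h''.not_gt; have := h''.ne'; have := h''.ne; simp [*]; try ring)
    | (have := h.not_gt; have := h'.not_gt;  simp [*]; try ring)
  rw [e4, e3]
  by_cases hab : a = b
  · subst hab
    have : kwSg key a a = 0 := by simp [kwSg]
    simp [this]; linarith
  · split_ifs <;> linear_combination kwSg key a b * (e2' - e2) - (1/2) * e1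

theorem kw_local {D K U : Type*} [DecidableEq D] [LinearOrder K] [DecidableEq U] (key : D → K)
    (hk : Function.Injective key) (ν : D → U)
    (hblock : ∀ a b c, ν a = ν c → ν b ≠ ν a → (key a < key b ↔ key c < key b))
    (S : Finset D) (a b : D) (hb : b ∉ S) (he : kwEven ν S (ν a) (ν b)) :
    (if a ∈ S then 0 else kwSg key a b * kwN key a S)
      = kwN key b S * kwM key ν a b + ∑ c ∈ S, kwM key ν a c * kwSg key c b * kwN key c S := by
  have hblock' : ∀ a b c, ν a = ν c → ν b ≠ ν a → (key b < key a ↔ key b < key c) := by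
    intro a b c h1 h2
    have h3 := hblock a b c h1 h2
    have h4 : key a ≠ key b := fun h => h2 (by rw [hk h])
    have h5 : key c ≠ key b := fun h => h2 (by rw [h1, hk h])
    rcases lt_or_gt_of_ne h4 with h | h <;> rcases lt_or_gt_of_ne h5 with h' | h'
    · simp [h.not_gt, h'.not_gt]
    · exact absurd (h3.1 h) h'.not_gt
    · exact absurd (h3.2 h') h.not_gt
    · simp [h, h']
  set T := S.filter (fun s => ν s = ν a) with hT
  set κ : ℝ := ∏ s ∈ S.filter (fun s => ¬ ν s = ν a), (if key s < key a then -1 else 1) with hκ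
  have hsplit : ∀ x, ν x = ν a → kwN key x S = kwN key x T * κ := by
    intro x hx
    unfold kwN
    rw [← Finset.prod_filter_mul_prod_filter_not S (fun s => ν s = ν a), hκ]
    congr 1
    apply Finset.prod_congr rfl
    intro s hs
    rw [Finset.mem_filter] at hs
    rw [if_congr (hblock' x s a hx (by rw [hx]; exact hs.2)) rfl rfl]
  have hsum : ∑ c ∈ S, kwM key ν a c * kwSg key c b * kwN key c S
      = (∑ c ∈ T, kwSg key a c * kwSg key c b * kwN key c T) * κ := by
    rw [hT, Finset.sum_filter, Finset.sum_mul]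
    apply Finset.sum_congr rfl
    intro c _
    by_cases h : ν c = ν a
    · rw [if_pos h, kwM, if_pos h.symm, hsplit c h]; ring
    · rw [if_neg h, kwM, if_neg (Ne.symm h)]; ring
  have hmem : a ∈ S ↔ a ∈ T := by simp [hT]
  rw [hsum, hsplit a rfl, if_congr hmem rfl rfl]
  have hcard := he (ν a)
  rw [← hT] at hcard
  by_cases hab : ν a = ν b
  · have hev : Even T.card := by
      simp only [hab, if_true] at hcard
      rw [add_assoc] at hcard
      exact (Nat.even_add.mp hcard).2 (by norm_num)
    have hbT : b ∉ T := fun h => hb (Finset.mem_filter.mp h).1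
    have := kw_alt_in key hk T hev a b hbT
    rw [hsplit b hab.symm, kwM, if_pos hab]
    split_ifs with h
    · rw [if_pos h] at this
      linear_combination (-κ) * this
    · rw [if_neg h] at this
      linear_combination (-κ) * this
  · have hodd : Odd T.card := by
      simp only [if_true, if_neg (Ne.symm hab)] at hcard
      rw [Nat.even_add_one.symm.symm] at hcard
      simpa [Nat.even_add_one] using hcard
    have := kw_alt_out key hk T hodd a
    have hs2 : ∑ c ∈ T, kwSg key a c * kwSg key c b * kwN key c T
        = kwSg key a b * ∑ c ∈ T, kwSg key a c * kwN key c T := by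
      rw [Finset.mul_sum]
      apply Finset.sum_congr rfl
      intro c hc
      have hc' : ν c = ν a := (Finset.mem_filter.mp hc).2
      have : kwSg key c b = kwSg key a b := by
        unfold kwSg
        rw [if_congr (hblock c b a hc' (by rw [hc']; exact Ne.symm hab)) rfl rfl,
          if_congr (hblock' c b a hc' (by rw [hc']; exact Ne.symm hab)) rfl rfl]
      rw [this]; ring
    rw [hs2, this, kwM, if_neg hab]
    split_ifs <;> ring

open Classical in
theorem kw_toggle {D : Type*} [Fintype D] [DecidableEq D] (bar : D → D)
    (hbar : ∀ d, bar (bar d) = d) (hfix : ∀ d, bar d ≠ d) (c : D) (f : Finset D → ℝ) :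
    ∑ S ∈ Finset.univ.filter (fun S => kwClosed bar S ∧ c ∈ S), f S
      = ∑ S ∈ Finset.univ.filter (fun S => kwClosed bar S ∧ c ∉ S),
          f (insert c (insert (bar c) S)) := by
  have hc1 := hfix c
  refine Finset.sum_bij' (fun S _ => (S.erase (bar c)).erase c)
    (fun S _ => insert c (insert (bar c) S)) ?_ ?_ ?_ ?_ ?_
  · intro S hS
    simp only [Finset.mem_filter, Finset.mem_univ, true_and] at hS ⊢
    refine ⟨?_, by simp⟩
    intro d hd
    simp only [Finset.mem_erase] at hd ⊢
    refine ⟨?_, ?_, hS.1 d hd.2.2⟩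
    · rintro rfl; exact hd.2.1 (hbar d).symm
    · intro h; apply hd.1; rw [← hbar d, h, hbar]
  · intro S hS
    simp only [Finset.mem_filter, Finset.mem_univ, true_and] at hS ⊢
    refine ⟨?_, by simp⟩
    intro d hd
    simp only [Finset.mem_insert] at hd ⊢
    rcases hd with rfl | rfl | hd
    · simp
    · simp [hbar]
    · exact Or.inr (Or.inr (hS.1 d hd))
  · intro S hS
    simp only [Finset.mem_filter, Finset.mem_univ, true_and] at hS
    have h1 := hS.1 c hS.2
    ext d
    simp only [Finset.mem_insert, Finset.mem_erase]
    by_cases h2 : d = c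
    · subst h2; simp [hS.2]
    · by_cases h3 : d = bar c
      · subst h3; simp [h1]
      · simp [h2, h3]
  · intro S hS
    simp only [Finset.mem_filter, Finset.mem_univ, true_and] at hS
    have h1 : bar c ∉ S := fun h => hS.2 (by have := hS.1 _ h; rwa [hbar] at this)
    ext d
    simp only [Finset.mem_insert, Finset.mem_erase]
    by_cases h2 : d = c
    · subst h2; simp [hS.2]
    · by_cases h3 : d = bar c
      · subst h3; simp [h1]
      · simp [h2, h3]
  · intro S hS
    simp only [Finset.mem_filter, Finset.mem_univ, true_and] at hS
    have h1 := hS.1 c hS.2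
    congr 1
    ext d
    simp only [Finset.mem_insert, Finset.mem_erase]
    by_cases h2 : d = c
    · subst h2; simp [hS.2]
    · by_cases h3 : d = bar c
      · subst h3; simp [h1]
      · simp [h2, h3]

open Classical in
/-- The (unnormalised) fermionic Green function. -/
def kwG {D K U : Type*} [Fintype D] [DecidableEq D] [LinearOrder K] [DecidableEq U] (key : D → K)
    (bar : D → D) (ν : D → U) (Ω : Finset D → ℝ) (a b : D) : ℝ :=
  kwSg key a b * ∑ S ∈ Finset.univ.filter (fun S => kwClosed bar S ∧ a ∉ S),
    if b ∉ S ∧ kwEven ν S (ν a) (ν b) then Ω S * kwN key a S * kwN key b S else 0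

open Classical in
/-- The even-subgraph generating function with two marked vertices. -/
def kwP {D U : Type*} [Fintype D] [DecidableEq U]
    (bar : D → D) (ν : D → U) (Ω : Finset D → ℝ) (p q : U) : ℝ :=
  ∑ S ∈ Finset.univ.filter (fun S => kwClosed bar S), if kwEven ν S p q then Ω S else 0

theorem kwEven_insert {D U : Type*} [DecidableEq D] [DecidableEq U] (bar : D → D) (ν : D → U)
    (S : Finset D) (c : D) (h1 : c ∉ S) (h2 : bar c ∉ S) (h3 : bar c ≠ c) (q : U) :
    kwEven ν (insert c (insert (bar c) S)) (ν c) q ↔ kwEven ν S (ν (bar c)) q := by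
  unfold kwEven
  apply forall_congr'
  intro u
  have : (Finset.filter (fun s => ν s = u) (insert c (insert (bar c) S))).card
      = (Finset.filter (fun s => ν s = u) S).card + (if ν c = u then 1 else 0)
        + (if ν (bar c) = u then 1 else 0) := by
    have h4 : c ∉ insert (bar c) S := by simp [h1, h3.symm]
    rw [Finset.card_filter, Finset.card_filter, Finset.sum_insert h4, Finset.sum_insert h2]
    ring
  rw [this]
  split_ifs <;> simp [Nat.even_add_one, parity_simps]

theorem kwN_insert {D K : Type*} [LinearOrder K] [DecidableEq D] (key : D → K) (a c c' : D)
    (S : Finset D) (h1 : c ∉ S) (h2 : c' ∉ S) (h3 : c' ≠ c) :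
    kwN key a (insert c (insert c' S)) = (if key c < key a then -1 else 1) *
      ((if key c' < key a then -1 else 1) * kwN key a S) := by
  unfold kwN
  have h4 : c ∉ insert c' S := by simp [h1, h3.symm]
  rw [Finset.prod_insert h4, Finset.prod_insert h2]

open Classical in
theorem kw_perc {D K U : Type*} [Fintype D] [DecidableEq D] [LinearOrder K] [DecidableEq U]
    (key : D → K) (hk : Function.Injective key) (bar : D → D)
    (hbar : ∀ d, bar (bar d) = d) (hfix : ∀ d, bar d ≠ d) (ν : D → U)
    (w : D → ℝ) (Ω : Finset D → ℝ)
    (hΩ : ∀ S c, kwClosed bar S → c ∉ S → Ω (insert c (insert (bar c) S))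
      = Ω S * w c * kwN key c S * kwN key (bar c) S) (b c : D) :
    kwSg key c (bar c) * w c * kwG key bar ν Ω (bar c) b
      = ∑ S ∈ Finset.univ.filter (fun S => kwClosed bar S ∧ c ∈ S),
        if kwEven ν S (ν c) (ν b) then Ω S * (if b = c then -1 else if b ∈ S then 0 else
          kwSg key c b * kwN key c S * kwN key b S) else 0 := by
  rw [kw_toggle bar hbar hfix c, kwG]
  have hfil : Finset.univ.filter (fun S => kwClosed bar S ∧ bar c ∉ S)
      = Finset.univ.filter (fun S => kwClosed bar S ∧ c ∉ S) := by
    ext S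
    simp only [Finset.mem_filter, Finset.mem_univ, true_and]
    constructor
    · rintro ⟨h, h'⟩; exact ⟨h, fun h2 => h' (h c h2)⟩
    · rintro ⟨h, h'⟩; exact ⟨h, fun h2 => h' (by have := h _ h2; rwa [hbar] at this)⟩
  rw [hfil, ← mul_assoc, Finset.mul_sum]
  apply Finset.sum_congr rfl
  intro S hS
  simp only [Finset.mem_filter, Finset.mem_univ, true_and] at hS
  obtain ⟨hcl, hc⟩ := hS
  have hc' : bar c ∉ S := fun h => hc (by have := hcl _ h; rwa [hbar] at this)
  have hf := hfix c
  rw [if_congr (kwEven_insert bar ν S c hc hc' hf (ν b)) rfl rfl, hΩ S c hcl hc]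
  by_cases he : kwEven ν S (ν (bar c)) (ν b)
  swap
  · simp [he]
  have hkk : key (bar c) ≠ key c := fun h => hf (hk h)
  by_cases hb1 : b = c
  · subst hb1
    have : kwSg key b (bar b) * kwSg key (bar b) b = -1 := by
      unfold kwSg
      rcases lt_or_gt_of_ne hkk with h | h <;> simp [h, h.not_gt]
    simp only [he, hc, not_false_eq_true, and_self, if_true]
    linear_combination (w b * Ω S * kwN key (bar b) S * kwN key b S) * this
  by_cases hb2 : b = bar c
  · subst hb2
    simp [kwSg, hf]
  by_cases hb3 : b ∈ S
  · simp [hb3, hb1]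
  have hm : b ∉ insert c (insert (bar c) S) := by simp [hb1, hb2, hb3]
  rw [if_pos ⟨hb3, he⟩, if_pos he, if_neg hb1, if_neg hm, kwN_insert key c c _ S hc hc' hf,
    kwN_insert key b c _ S hc hc' hf]
  have hcb : key c ≠ key b := fun h => hb1 (hk h).symm
  have hcb' : key (bar c) ≠ key b := fun h => hb2 (hk h).symm
  have key1 : kwSg key c (bar c) * kwSg key (bar c) b
      = kwSg key c b * (if key c < key b then -1 else 1) * (if key (bar c) < key c then -1 else 1)
        * (if key (bar c) < key b then -1 else 1) := by
    unfold kwSg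
    rcases lt_or_gt_of_ne hkk with h | h <;> rcases lt_or_gt_of_ne hcb with h' | h' <;>
    rcases lt_or_gt_of_ne hcb' with h'' | h'' <;> simp [h, h.not_gt, h', h'.not_gt, h'', h''.not_gt]
  have hsq := kwN_sq key c S
  simp only [lt_irrefl, if_false]
  linear_combination (w c * Ω S * kwN key (bar c) S * kwN key b S) * key1
    - (Ω S * w c * kwN key (bar c) S * kwN key b S * kwSg key c b *
      (if key c < key b then -1 else 1) * (if key (bar c) < key c then -1 else 1)
        * (if key (bar c) < key b then -1 else 1)) * hsq

theorem kwEven_self {D U : Type*} [DecidableEq U] (ν : D → U) (S : Finset D) (p q : U) :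
    kwEven ν S p p ↔ kwEven ν S q q := by
  unfold kwEven
  apply forall_congr'
  intro u
  split_ifs <;> simp [parity_simps]

open Classical in
theorem kw_core {D K U : Type*} [Fintype D] [DecidableEq D] [LinearOrder K] [DecidableEq U]
    (key : D → K) (hk : Function.Injective key) (bar : D → D)
    (hbar : ∀ d, bar (bar d) = d) (hfix : ∀ d, bar d ≠ d) (ν : D → U)
    (hblock : ∀ a b c, ν a = ν c → ν b ≠ ν a → (key a < key b ↔ key c < key b))
    (w : D → ℝ) (Ω : Finset D → ℝ)
    (hΩ : ∀ S c, kwClosed bar S → c ∉ S → Ω (insert c (insert (bar c) S))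
      = Ω S * w c * kwN key c S * kwN key (bar c) S) (a b : D) :
    kwG key bar ν Ω a b = kwP bar ν Ω (ν b) (ν b) * kwM key ν a b
      + ∑ c, kwM key ν a c * (kwSg key c (bar c) * w c * kwG key bar ν Ω (bar c) b) := by
  have hfil : ∀ (c : D) (f : Finset D → ℝ),
      ∑ S ∈ Finset.univ.filter (fun S => kwClosed bar S ∧ c ∈ S), f S
      = ∑ S ∈ Finset.univ.filter (fun S => kwClosed bar S), if c ∈ S then f S else 0 := by
    intro c f
    rw [← Finset.filter_filter, Finset.sum_filter]
  have hfil' : ∀ (c : D) (f : Finset D → ℝ),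
      ∑ S ∈ Finset.univ.filter (fun S => kwClosed bar S ∧ c ∉ S), f S
      = ∑ S ∈ Finset.univ.filter (fun S => kwClosed bar S), if c ∉ S then f S else 0 := by
    intro c f
    rw [← Finset.filter_filter, Finset.sum_filter]
  simp_rw [kw_perc key hk bar hbar hfix ν w Ω hΩ, hfil, Finset.mul_sum]
  rw [Finset.sum_comm, kwG, kwP, hfil', Finset.mul_sum, Finset.sum_mul, ← Finset.sum_add_distrib]
  apply Finset.sum_congr rfl
  intro S _
  have hsum : ∑ c, kwM key ν a c * (if c ∈ S then if kwEven ν S (ν c) (ν b) then Ω S *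
        (if b = c then -1 else if b ∈ S then 0 else
          kwSg key c b * kwN key c S * kwN key b S) else 0 else 0)
      = ∑ c ∈ S, kwM key ν a c * (if kwEven ν S (ν a) (ν b) then Ω S *
        (if b = c then -1 else if b ∈ S then 0 else
          kwSg key c b * kwN key c S * kwN key b S) else 0) := by
    rw [← Finset.sum_filter_add_sum_filter_not Finset.univ (fun c => c ∈ S)]
    have : ∑ x ∈ Finset.univ.filter (fun c => c ∉ S), kwM key ν a x *
        (if x ∈ S then if kwEven ν S (ν x) (ν b) then Ω S *
        (if b = x then -1 else if b ∈ S then 0 else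
          kwSg key x b * kwN key x S * kwN key b S) else 0 else 0) = 0 := by
      apply Finset.sum_eq_zero
      intro x hx
      simp only [Finset.mem_filter, Finset.mem_univ, true_and] at hx
      simp [hx]
    rw [this, add_zero]
    have h2 : Finset.univ.filter (fun c => c ∈ S) = S := by ext; simp
    rw [h2]
    apply Finset.sum_congr rfl
    intro c hc
    rw [if_pos hc]
    by_cases h : ν a = ν c
    · rw [h]
    · simp [kwM, h]
  rw [hsum]
  by_cases hbS : b ∈ S
  · have h3 : ∑ c ∈ S, kwM key ν a c * (if kwEven ν S (ν a) (ν b) then Ω S *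
        (if b = c then -1 else if b ∈ S then 0 else
          kwSg key c b * kwN key c S * kwN key b S) else 0)
        = ∑ c ∈ S, if b = c then - kwM key ν a b * (if kwEven ν S (ν a) (ν b) then Ω S else 0)
          else 0 := by
      apply Finset.sum_congr rfl
      intro c hc
      split_ifs with h1 h2 h2
      · rw [h2]; ring
      · ring
      · ring
      · ring
    rw [h3, Finset.sum_ite_eq, if_pos hbS]
    by_cases h : ν a = ν b
    · rw [h]
      simp only [hbS, not_true_eq_false, false_and, if_false, ite_self, mul_zero]
      split_ifs <;> ring
    · simp [kwM, h, hbS]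
  by_cases he : kwEven ν S (ν a) (ν b)
  · have hl := kw_local key hk ν hblock S a b hbS he
    have hsq := kwN_sq key b S
    have h3 : ∑ c ∈ S, kwM key ν a c * (if kwEven ν S (ν a) (ν b) then Ω S *
        (if b = c then -1 else if b ∈ S then 0 else
          kwSg key c b * kwN key c S * kwN key b S) else 0)
        = Ω S * kwN key b S * ∑ c ∈ S, kwM key ν a c * kwSg key c b * kwN key c S := by
      rw [Finset.mul_sum]
      apply Finset.sum_congr rfl
      intro c hc
      have : b ≠ c := fun h => hbS (h ▸ hc)
      rw [if_pos he, if_neg this, if_neg hbS]; ring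
    have h4 : (if kwEven ν S (ν b) (ν b) then Ω S else 0) * kwM key ν a b
        = Ω S * kwM key ν a b := by
      by_cases h : ν a = ν b
      · rw [if_pos (h ▸ he)]
      · simp [kwM, h]
    rw [h3, h4, if_pos (show b ∉ S ∧ kwEven ν S (ν a) (ν b) from ⟨hbS, he⟩)]
    by_cases ha : a ∈ S
    · rw [if_pos ha] at hl
      simp only [ha, not_true_eq_false, if_false]
      linear_combination (Ω S * kwN key b S) * hl + (Ω S * kwM key ν a b) * hsq
    · rw [if_neg ha] at hl
      simp only [ha, not_false_eq_true, if_true]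
      linear_combination (Ω S * kwN key b S) * hl + (Ω S * kwM key ν a b) * hsq
  · have h4 : (if kwEven ν S (ν b) (ν b) then Ω S else 0) * kwM key ν a b = 0 := by
      by_cases h : ν a = ν b
      · rw [if_neg (by rw [h] at he; exact he)]; ring
      · simp [kwM, h]
    rw [h4]; simp [he]

/-- Low darts of a set. -/
def kwLow {D K : Type*} [LinearOrder K] (key : D → K) (bar : D → D) (S : Finset D) : Finset D :=
  S.filter (fun d => key d < key (bar d))

theorem kw_prod_pair {D K : Type*} [DecidableEq D] [LinearOrder K] (key : D → K)
    (hk : Function.Injective key) (bar : D → D)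
    (hbar : ∀ d, bar (bar d) = d) (hfix : ∀ d, bar d ≠ d) (S : Finset D) (hS : kwClosed bar S)
    (f : D → ℝ) : ∏ d ∈ S, f d = ∏ d ∈ kwLow key bar S, (f d * f (bar d)) := by
  rw [Finset.prod_mul_distrib, ← Finset.prod_filter_mul_prod_filter_not S
    (fun d => key d < key (bar d)), kwLow]
  congr 1
  refine Finset.prod_bij' (fun d _ => bar d) (fun d _ => bar d) ?_ ?_ ?_ ?_ ?_
  · intro d hd
    simp only [Finset.mem_filter, not_lt] at hd ⊢
    refine ⟨hS d hd.1, ?_⟩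
    rw [hbar]
    exact lt_of_le_of_ne hd.2 (fun h => hfix d (hk h))
  · intro d hd
    simp only [Finset.mem_filter, not_lt] at hd ⊢
    refine ⟨hS d hd.1, ?_⟩
    rw [hbar]
    exact hd.2.le
  · intro d _; exact hbar d
  · intro d _; exact hbar d
  · intro d _; simp only [hbar]

theorem kwLow_insert {D K : Type*} [DecidableEq D] [LinearOrder K] (key : D → K) (bar : D → D)
    (hbar : ∀ d, bar (bar d) = d) (S : Finset D) (c : D) (hc : key c < key (bar c)) :
    kwLow key bar (insert c (insert (bar c) S)) = insert c (kwLow key bar S) := by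
  unfold kwLow
  rw [Finset.filter_insert, if_pos hc, Finset.filter_insert, if_neg (by rw [hbar]; exact hc.not_gt)]

/-- The weight of a set of darts. -/
def kwWt {D K : Type*} [LinearOrder K] (key : D → K) (bar : D → D) (w : D → ℝ) (S : Finset D) : ℝ :=
  ∏ d ∈ kwLow key bar S, w d

/-- The sign of a set of darts. -/
def kwX {D K U : Type*} [LinearOrder K] (key : D → K) (bar : D → D) (ν : D → U)
    (AB : U → D → ℝ) (S : Finset D) : ℝ :=
  ∏ d ∈ kwLow key bar S, ∏ t ∈ S, AB (ν t) d

theorem kw_low_wlog {D K : Type*} [DecidableEq D] [LinearOrder K] (key : D → K)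
    (hk : Function.Injective key) (bar : D → D)
    (hbar : ∀ d, bar (bar d) = d) (hfix : ∀ d, bar d ≠ d) (p : D → Prop)
    (h1 : ∀ c, key c < key (bar c) → p c) (h2 : ∀ c, p (bar c) → p c) (c : D) : p c := by
  rcases lt_or_gt_of_ne (fun h => hfix c (hk h) : key (bar c) ≠ key c) with h | h
  · exact h2 c (h1 _ (by rw [hbar]; exact h))
  · exact h1 c h

theorem kwWt_insert {D K : Type*} [DecidableEq D] [LinearOrder K] (key : D → K)
    (hk : Function.Injective key) (bar : D → D)
    (hbar : ∀ d, bar (bar d) = d) (hfix : ∀ d, bar d ≠ d) (w : D → ℝ)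
    (hw : ∀ d, w (bar d) = w d) (S : Finset D) (hS : kwClosed bar S) (c : D) :
    c ∉ S → kwWt key bar w (insert c (insert (bar c) S)) = w c * kwWt key bar w S := by
  refine kw_low_wlog key hk bar hbar hfix (fun c => c ∉ S →
    kwWt key bar w (insert c (insert (bar c) S)) = w c * kwWt key bar w S) ?_ ?_ c
  · intro c hlow hc
    unfold kwWt
    rw [kwLow_insert key bar hbar S c hlow, Finset.prod_insert]
    exact fun h => hc (Finset.mem_filter.mp h).1
  · intro c h hc
    have := h (fun h' => hc (by have := hS _ h'; rwa [hbar] at this))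
    rwa [hbar, hw, Finset.insert_comm] at this

theorem kwX_insert {D K U : Type*} [DecidableEq D] [LinearOrder K] (key : D → K)
    (hk : Function.Injective key) (bar : D → D)
    (hbar : ∀ d, bar (bar d) = d) (hfix : ∀ d, bar d ≠ d) (ν : D → U) (AB : U → D → ℝ)
    (hAB0 : ∀ c, AB (ν c) c = 1) (hAB1 : ∀ c, AB (ν (bar c)) c = 1)
    (hAB : ∀ e f, key e < key (bar e) → key f < key (bar f) → e ≠ f →
      AB (ν e) f * AB (ν (bar e)) f * AB (ν f) e * AB (ν (bar f)) e
        = (if key e < key f then -1 else 1) * (if key (bar e) < key f then -1 else 1)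
          * (if key e < key (bar f) then -1 else 1) * (if key (bar e) < key (bar f) then -1 else 1))
    (S : Finset D) (hS : kwClosed bar S) (c : D) :
    c ∉ S → kwX key bar ν AB (insert c (insert (bar c) S))
      = kwX key bar ν AB S * (kwN key c S * kwN key (bar c) S) := by
  refine kw_low_wlog key hk bar hbar hfix (fun c => c ∉ S →
    kwX key bar ν AB (insert c (insert (bar c) S))
      = kwX key bar ν AB S * (kwN key c S * kwN key (bar c) S)) ?_ ?_ c
  · intro c hlow hc
    have hc' : bar c ∉ S := fun h' => hc (by have := hS _ h'; rwa [hbar] at this)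
    have hc2 : c ∉ insert (bar c) S := by simp [hc, (hfix c).symm]
    unfold kwX
    have hc3 : c ∉ kwLow key bar S := fun h => hc (Finset.mem_filter.mp h).1
    rw [kwLow_insert key bar hbar S c hlow, Finset.prod_insert hc3]
    simp_rw [Finset.prod_insert hc2, Finset.prod_insert hc', hAB0, hAB1]
    rw [one_mul, one_mul, Finset.prod_mul_distrib, Finset.prod_mul_distrib]
    unfold kwN
    rw [kw_prod_pair key hk bar hbar hfix S hS, kw_prod_pair key hk bar hbar hfix S hS
      (fun s => if key s < key c then -1 else 1), kw_prod_pair key hk bar hbar hfix S hS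
      (fun s => if key s < key (bar c) then -1 else 1)]
    rw [mul_comm (∏ d ∈ kwLow key bar S, ∏ t ∈ S, AB (ν t) d), ← mul_assoc, ← mul_assoc]
    congr 1
    rw [← Finset.prod_mul_distrib, ← Finset.prod_mul_distrib, ← Finset.prod_mul_distrib]
    apply Finset.prod_congr rfl
    intro d hd
    have hd' := Finset.mem_filter.mp hd
    have := hAB d c hd'.2 hlow (fun h => hc (h ▸ hd'.1))
    linear_combination this
  · intro c h hc
    have := h (fun h' => hc (by have := hS _ h'; rwa [hbar] at this))
    rw [hbar, Finset.insert_comm] at this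
    rw [this]; ring

theorem kwX_even {D K U : Type*} [Fintype U] [DecidableEq U] [LinearOrder K] (key : D → K)
    (bar : D → D) (ν : D → U) (AB : U → D → ℝ) (hsq : ∀ u d, AB u d ^ 2 = 1)
    (S : Finset D) (p : U) (hS : kwEven ν S p p) : kwX key bar ν AB S = 1 := by
  apply Finset.prod_eq_one
  intro d _
  rw [← Finset.prod_fiberwise S ν]
  apply Finset.prod_eq_one
  intro u _
  have h1 : ∏ t ∈ S.filter (fun t => ν t = u), AB (ν t) d
      = ∏ t ∈ S.filter (fun t => ν t = u), AB u d :=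
    Finset.prod_congr rfl (fun t ht => by rw [(Finset.mem_filter.mp ht).2])
  rw [h1, Finset.prod_const]
  have h2 := (kwEven_self ν S p u).1 hS u
  simp only [if_true] at h2
  obtain ⟨k, hk⟩ : Even (S.filter (fun t => ν t = u)).card := by
    rw [add_assoc] at h2
    exact (Nat.even_add.mp h2).2 (by norm_num)
  rw [hk, ← two_mul, pow_mul, hsq, one_pow]

theorem kwEven_symm {D U : Type*} [DecidableEq U] (ν : D → U) (S : Finset D) (p q : U) :
    kwEven ν S p q ↔ kwEven ν S q p := by
  unfold kwEven
  apply forall_congr'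
  intro u
  rw [add_right_comm]

open Classical in
/-- Even subgraphs avoiding a dart. -/
def kwP0 {D K U : Type*} [Fintype D] [DecidableEq D] [DecidableEq U] [LinearOrder K] (key : D → K)
    (bar : D → D) (ν : D → U) (w : D → ℝ) (c : D) (p q : U) : ℝ :=
  ∑ S ∈ Finset.univ.filter (fun S => kwClosed bar S ∧ c ∉ S),
    if kwEven ν S p q then kwWt key bar w S else 0

open Classical in
theorem kwP_split {D K U : Type*} [Fintype D] [DecidableEq D] [DecidableEq U] [LinearOrder K]
    (key : D → K) (hk : Function.Injective key) (bar : D → D)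
    (hbar : ∀ d, bar (bar d) = d) (hfix : ∀ d, bar d ≠ d) (ν : D → U) (w : D → ℝ)
    (hw : ∀ d, w (bar d) = w d) (c : D) (q : U) :
    kwP bar ν (kwWt key bar w) (ν c) q = kwP0 key bar ν w c (ν c) q
      + w c * kwP0 key bar ν w c (ν (bar c)) q := by
  unfold kwP
  rw [← Finset.sum_filter_add_sum_filter_not _ (fun S => c ∈ S), Finset.filter_filter,
    Finset.filter_filter, kw_toggle bar hbar hfix c, add_comm]
  unfold kwP0
  congr 1
  rw [Finset.mul_sum]
  apply Finset.sum_congr rfl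
  intro S hS
  simp only [Finset.mem_filter, Finset.mem_univ, true_and] at hS
  have hc' : bar c ∉ S := fun h' => hS.2 (by have := hS.1 _ h'; rwa [hbar] at this)
  rw [if_congr (kwEven_insert bar ν S c hS.2 hc' (hfix c) q) rfl rfl,
    kwWt_insert key hk bar hbar hfix w hw S hS.1 c hS.2, mul_ite, mul_zero]

open Classical in
/-- Everything about the abstract Green function that is needed below. -/
theorem kw_abstract {D K U : Type*} [Fintype D] [DecidableEq D] [Fintype U] [DecidableEq U]
    [LinearOrder K]
    (key : D → K) (hk : Function.Injective key) (bar : D → D)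
    (hbar : ∀ d, bar (bar d) = d) (hfix : ∀ d, bar d ≠ d) (ν : D → U)
    (hblock : ∀ a b c, ν a = ν c → ν b ≠ ν a → (key a < key b ↔ key c < key b))
    (AB : U → D → ℝ) (hsq : ∀ u d, AB u d ^ 2 = 1)
    (hAB0 : ∀ c, AB (ν c) c = 1) (hAB1 : ∀ c, AB (ν (bar c)) c = 1)
    (hAB : ∀ e f, key e < key (bar e) → key f < key (bar f) → e ≠ f →
      AB (ν e) f * AB (ν (bar e)) f * AB (ν f) e * AB (ν (bar f)) e
        = (if key e < key f then -1 else 1) * (if key (bar e) < key f then -1 else 1)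
          * (if key e < key (bar f) then -1 else 1) * (if key (bar e) < key (bar f) then -1 else 1))
    (w : D → ℝ) (hw : ∀ d, w (bar d) = w d) :
    ∃ g : D → D → ℝ,
      (∀ (p : U) a b, g a b = kwP bar ν (kwWt key bar w) p p * kwM key ν a b
        + ∑ c, kwM key ν a c * (kwSg key c (bar c) * w c * g (bar c) b)) ∧
      (∀ c, g (bar c) c = kwSg key (bar c) c * kwP0 key bar ν w c (ν (bar c)) (ν c)) := by
  have hX := kwX_insert key hk bar hbar hfix ν AB hAB0 hAB1 hAB
  have hWt := kwWt_insert key hk bar hbar hfix w hw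
  refine ⟨kwG key bar ν (fun S => kwWt key bar w S * kwX key bar ν AB S), ?_, ?_⟩
  · intro p a b
    rw [kw_core key hk bar hbar hfix ν hblock w (fun S => kwWt key bar w S * kwX key bar ν AB S) ?_]
    · congr 2
      unfold kwP
      apply Finset.sum_congr rfl
      intro S _
      rw [if_congr (kwEven_self ν S (ν b) p) rfl rfl]
      split_ifs with h
      · change kwWt key bar w S * kwX key bar ν AB S = _
        rw [kwX_even key bar ν AB hsq S p h, mul_one]
      · rfl
    · intro S c hS hc
      rw [hX S hS c hc, hWt S hS c hc]; ring
  · intro c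
    unfold kwG kwP0
    congr 1
    have hfil : Finset.univ.filter (fun S => kwClosed bar S ∧ bar c ∉ S)
        = Finset.univ.filter (fun S => kwClosed bar S ∧ c ∉ S) := by
      ext S
      simp only [Finset.mem_filter, Finset.mem_univ, true_and]
      constructor
      · rintro ⟨h, h'⟩; exact ⟨h, fun h2 => h' (h c h2)⟩
      · rintro ⟨h, h'⟩; exact ⟨h, fun h2 => h' (by have := h _ h2; rwa [hbar] at this)⟩
    rw [hfil]
    apply Finset.sum_congr rfl
    intro S hS
    simp only [Finset.mem_filter, Finset.mem_univ, true_and] at hS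
    have hc' : bar c ∉ S := fun h' => hS.2 (by have := hS.1 _ h'; rwa [hbar] at this)
    simp only [hS.2, not_false_eq_true, true_and]
    split_ifs with h
    · have h1 := hX S hS.1 c hS.2
      have h2 := (kwEven_insert bar ν S c hS.2 hc' (hfix c) (ν c)).2 h
      rw [kwX_even key bar ν AB hsq _ _ h2] at h1
      linear_combination (-kwWt key bar w S) * h1
    · rfl

/-! ### High-temperature expansion -/

open Classical in
theorem kw_expand {D K U : Type*} [Fintype D] [DecidableEq D] [LinearOrder K] (key : D → K)
    (hk : Function.Injective key) (bar : D → D)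
    (hbar : ∀ d, bar (bar d) = d) (hfix : ∀ d, bar d ≠ d) (ν : D → U) (w : D → ℝ) (s : U → ℝ) :
    ∏ d ∈ kwLow key bar Finset.univ, (1 + w d * (s (ν d) * s (ν (bar d))))
      = ∑ S ∈ Finset.univ.filter (fun S => kwClosed bar S),
          kwWt key bar w S * ∏ d ∈ S, s (ν d) := by
  rw [Finset.prod_one_add]
  symm
  refine Finset.sum_bij' (fun S _ => kwLow key bar S) (fun L _ => L ∪ L.image bar) ?_ ?_ ?_ ?_ ?_
  · intro S _
    rw [Finset.mem_powerset]
    exact Finset.filter_subset_filter _ (Finset.subset_univ S)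
  · intro L _
    simp only [Finset.mem_filter, Finset.mem_univ, true_and]
    intro d hd
    simp only [Finset.mem_union, Finset.mem_image] at hd ⊢
    rcases hd with hd | ⟨e, he, rfl⟩
    · exact Or.inr ⟨d, hd, rfl⟩
    · left; rwa [hbar]
  · intro S hS
    have hS : kwClosed bar S := (Finset.mem_filter.mp hS).2
    ext d
    simp only [kwLow, Finset.mem_union, Finset.mem_image, Finset.mem_filter]
    constructor
    · rintro (h | ⟨e, he, rfl⟩)
      · exact h.1
      · exact hS e he.1
    · intro h
      rcases lt_or_gt_of_ne (fun h => hfix d (hk h) : key (bar d) ≠ key d) with h' | h'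
      · right
        exact ⟨bar d, ⟨hS d h, by rwa [hbar]⟩, hbar d⟩
      · exact Or.inl ⟨h, h'⟩
  · intro L hL
    rw [Finset.mem_powerset] at hL
    ext d
    simp only [kwLow, Finset.mem_union, Finset.mem_image, Finset.mem_filter]
    constructor
    · rintro ⟨h | ⟨e, he, rfl⟩, h2⟩
      · exact h
      · have := (Finset.mem_filter.mp (hL he)).2
        rw [hbar] at h2
        exact absurd h2 this.not_gt
    · intro h
      exact ⟨Or.inl h, (Finset.mem_filter.mp (hL h)).2⟩
  · intro S hS
    have hS : kwClosed bar S := (Finset.mem_filter.mp hS).2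
    rw [kw_prod_pair key hk bar hbar hfix S hS, kwWt, ← Finset.prod_mul_distrib]

theorem kw_spin_pow (n : ℕ) : ∑ b : Bool, spin b ^ n = if Even n then 2 else 0 := by
  rw [Fintype.sum_bool]
  simp only [spin, if_true, Bool.false_eq_true, if_false, one_pow]
  split_ifs with h
  · rw [h.neg_one_pow]; norm_num
  · rw [(Nat.not_even_iff_odd.mp h).neg_one_pow]; norm_num

open Classical in
theorem kw_spin_sum {D U : Type*} [Fintype U] [DecidableEq U] (ν : D → U) (S : Finset D) (p q : U) :
    ∑ x : U → Bool, spin (x p) * spin (x q) * ∏ d ∈ S, spin (x (ν d))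
      = if kwEven ν S p q then (2 : ℝ) ^ Fintype.card U else 0 := by
  have h1 : ∀ x : U → Bool, spin (x p) * spin (x q) * ∏ d ∈ S, spin (x (ν d))
      = ∏ u, spin (x u) ^ ((S.filter (fun s => ν s = u)).card + (if p = u then 1 else 0)
          + (if q = u then 1 else 0)) := by
    intro x
    simp_rw [pow_add, Finset.prod_mul_distrib]
    have e1 : ∀ p : U, ∏ u, spin (x u) ^ (if p = u then 1 else 0) = spin (x p) := by
      intro p
      rw [Finset.prod_eq_single p]
      · simp
      · intro u _ hu; simp [hu.symm]
      · simp
    rw [e1, e1, ← Finset.prod_fiberwise S ν]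
    have e2 : ∀ u, ∏ d ∈ S.filter (fun d => ν d = u), spin (x (ν d))
        = spin (x u) ^ (S.filter (fun d => ν d = u)).card := by
      intro u
      rw [Finset.prod_congr rfl (fun t ht => by rw [(Finset.mem_filter.mp ht).2]),
        Finset.prod_const]
    simp_rw [e2]; ring
  simp_rw [h1]
  have h2 := Finset.prod_univ_sum (fun _ : U => (Finset.univ : Finset Bool))
    (fun u b => spin b ^ ((S.filter (fun s => ν s = u)).card + (if p = u then 1 else 0)
          + (if q = u then 1 else 0)))
  rw [Fintype.piFinset_univ] at h2
  rw [← h2]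
  simp_rw [kw_spin_pow]
  unfold kwEven
  by_cases h : ∀ u, Even ((S.filter (fun s => ν s = u)).card + (if p = u then 1 else 0)
          + (if q = u then 1 else 0))
  · rw [if_pos h, Finset.prod_congr rfl (fun u _ => if_pos (h u)), Finset.prod_const,
      Finset.card_univ]
  · rw [if_neg h]
    push Not at h
    obtain ⟨u, hu⟩ := h
    apply Finset.prod_eq_zero (Finset.mem_univ u)
    rw [if_neg hu]

open Classical in
theorem kw_expand_sum {D K U : Type*} [Fintype D] [DecidableEq D] [LinearOrder K]
    [Fintype U] [DecidableEq U] (key : D → K)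
    (hk : Function.Injective key) (bar : D → D)
    (hbar : ∀ d, bar (bar d) = d) (hfix : ∀ d, bar d ≠ d) (ν : D → U) (w : D → ℝ) (p q : U) :
    ∑ x : U → Bool, spin (x p) * spin (x q) *
        ∏ d ∈ kwLow key bar Finset.univ, (1 + w d * (spin (x (ν d)) * spin (x (ν (bar d)))))
      = 2 ^ Fintype.card U * kwP bar ν (kwWt key bar w) p q := by
  simp_rw [fun x : U → Bool => kw_expand key hk bar hbar hfix ν w (fun u => spin (x u)),
    Finset.mul_sum]
  rw [Finset.sum_comm, kwP, Finset.mul_sum]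
  apply Finset.sum_congr rfl
  intro S _
  have := kw_spin_sum ν S p q
  calc _ = kwWt key bar w S * ∑ x : U → Bool, spin (x p) * spin (x q) * ∏ d ∈ S, spin (x (ν d)) := by
        rw [Finset.mul_sum]
        exact Finset.sum_congr rfl (fun x _ => by ring)
    _ = _ := by
        rw [this]; split_ifs <;> ring

theorem kw_spin_sq (b : Bool) : spin b * spin b = 1 := by
  cases b <;> simp [spin]

theorem kw_exp (t : ℝ) (a b : Bool) : Real.exp (t * (spin a * spin b))
    = Real.cosh t * (1 + Real.tanh t * (spin a * spin b)) := by
  have hc := (Real.cosh_pos t).ne'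
  rw [Real.tanh_eq_sinh_div_cosh]
  have h1 : Real.exp t = Real.cosh t + Real.sinh t := (Real.cosh_add_sinh t).symm
  have h2 : Real.exp (-t) = Real.cosh t - Real.sinh t := (Real.cosh_sub_sinh t).symm
  cases a <;> cases b <;> simp [spin] <;> field_simp <;> first | exact h1 | (rw [h2]; ring)

/-- Reversal of darts. -/
def kwBar (G : SimpleGraph V) (d : {p : V × V // G.Adj p.1 p.2}) : {p : V × V // G.Adj p.1 p.2} :=
  ⟨(d.1.2, d.1.1), d.2.symm⟩

theorem kw_moment (G : SimpleGraph V) [DecidableRel G.Adj] {K : Type*} [LinearOrder K]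
    (key : {p : V × V // G.Adj p.1 p.2} → K) (hk : Function.Injective key) (θ : Sym2 V → ℝ)
    (i j : V) :
    kwP (kwBar G) (fun d => d.1.1)
        (kwWt key (kwBar G) (fun d => Real.tanh (θ s(d.1.1, d.1.2)))) i i ≠ 0 ∧
    momentPair G (fun _ => 0) θ i j =
      kwP (kwBar G) (fun d => d.1.1)
        (kwWt key (kwBar G) (fun d => Real.tanh (θ s(d.1.1, d.1.2)))) i j /
      kwP (kwBar G) (fun d => d.1.1)
        (kwWt key (kwBar G) (fun d => Real.tanh (θ s(d.1.1, d.1.2)))) i i := by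
  have hbar : ∀ d, kwBar G (kwBar G d) = d := fun d => rfl
  have hfix : ∀ d, kwBar G d ≠ d := by
    rintro ⟨⟨a, b⟩, h⟩ h'
    have : b = a := congrArg (fun d => d.1.1) h'
    exact h.ne this.symm
  have hedge : ∀ F : Sym2 V → ℝ, ∏ e ∈ G.edgeFinset, F e
      = ∏ d ∈ kwLow key (kwBar G) Finset.univ, F s(d.1.1, d.1.2) := by
    intro F
    symm
    refine Finset.prod_bij (fun d _ => s(d.1.1, d.1.2)) ?_ ?_ ?_ ?_
    · intro d _
      rw [SimpleGraph.mem_edgeFinset]; exact d.2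
    · intro d hd e he h
      have hd := (Finset.mem_filter.mp hd).2
      have he := (Finset.mem_filter.mp he).2
      rw [Sym2.eq_iff] at h
      rcases h with h | h
      · exact Subtype.ext (Prod.ext h.1 h.2)
      · have : d = kwBar G e := Subtype.ext (Prod.ext h.1 h.2)
        subst this
        exact absurd hd he.not_gt
    · intro e he
      induction e with
      | h a b =>
        rw [SimpleGraph.mem_edgeFinset] at he
        have he : G.Adj a b := he
        have hne : key (kwBar G ⟨(a, b), he⟩) ≠ key ⟨(a, b), he⟩ := fun h => hfix _ (hk h)
        rcases lt_or_gt_of_ne hne with h | h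
        · exact ⟨⟨(b, a), he.symm⟩, Finset.mem_filter.mpr ⟨Finset.mem_univ _, h⟩, Sym2.eq_swap⟩
        · exact ⟨⟨(a, b), he⟩, Finset.mem_filter.mpr ⟨Finset.mem_univ _, h⟩, rfl⟩
    · intro d _; rfl
  set C : ℝ := ∏ e ∈ G.edgeFinset, Real.cosh (θ e) with hC
  have hCpos : 0 < C := Finset.prod_pos (fun e _ => Real.cosh_pos _)
  have hexp : ∀ x : V → Bool, Real.exp (energy G (fun _ => 0) θ x) = C *
      ∏ d ∈ kwLow key (kwBar G) Finset.univ, (1 + Real.tanh (θ s(d.1.1, d.1.2)) *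
        (spin (x d.1.1) * spin (x (kwBar G d).1.1))) := by
    intro x
    unfold energy
    simp only [zero_mul, Finset.sum_const_zero, zero_add]
    rw [Real.exp_sum, hC, hedge, hedge, ← Finset.prod_mul_distrib]
    apply Finset.prod_congr rfl
    intro d _
    exact kw_exp _ _ _
  have hsum : ∀ p q : V, ∑ x : V → Bool, Real.exp (energy G (fun _ => 0) θ x) * spin (x p)
      * spin (x q) = C * 2 ^ Fintype.card V * kwP (kwBar G) (fun d => d.1.1)
        (kwWt key (kwBar G) (fun d => Real.tanh (θ s(d.1.1, d.1.2)))) p q := by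
    intro p q
    rw [mul_assoc, ← kw_expand_sum key hk (kwBar G) hbar hfix, Finset.mul_sum]
    apply Finset.sum_congr rfl
    intro x _
    rw [hexp x]; ring
  have hZ : partitionFn G (fun _ => 0) θ = C * 2 ^ Fintype.card V *
      kwP (kwBar G) (fun d => d.1.1)
        (kwWt key (kwBar G) (fun d => Real.tanh (θ s(d.1.1, d.1.2)))) i i := by
    rw [← hsum]
    unfold partitionFn
    apply Finset.sum_congr rfl
    intro x _
    rw [mul_assoc, kw_spin_sq, mul_one]
  have hZpos : 0 < partitionFn G (fun _ => 0) θ :=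
    Finset.sum_pos (fun x _ => Real.exp_pos _) Finset.univ_nonempty
  have hne : kwP (kwBar G) (fun d => d.1.1)
        (kwWt key (kwBar G) (fun d => Real.tanh (θ s(d.1.1, d.1.2)))) i i ≠ 0 := by
    intro h
    rw [hZ, h, mul_zero] at hZpos
    exact lt_irrefl _ hZpos
  refine ⟨hne, ?_⟩
  have hm : momentPair G (fun _ => 0) θ i j = (∑ x : V → Bool,
      Real.exp (energy G (fun _ => 0) θ x) * spin (x i) * spin (x j))
        / partitionFn G (fun _ => 0) θ := by
    unfold momentPair isingProb
    rw [Finset.sum_div]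
    apply Finset.sum_congr rfl
    intro x _
    ring
  rw [hm, hsum, hZ, mul_div_mul_left]
  positivity

/-! ### Geometry -/

theorem kw_lin_sign (p q l r : ℝ) (hlr : l ≤ r) (h : ∀ x, l ≤ x → x ≤ r → p + q * x ≠ 0) :
    (0 < p + q * l ↔ 0 < p + q * r) := by
  have hc : ContinuousOn (fun x : ℝ => p + q * x) (Set.Icc l r) := by fun_prop
  constructor
  · intro h1
    by_contra h2
    obtain ⟨x, hx, hx'⟩ := intermediate_value_Icc' hlr hc ⟨not_lt.mp h2, h1.le⟩
    exact h x hx.1 hx.2 hx'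
  · intro h1
    by_contra h2
    obtain ⟨x, hx, hx'⟩ := intermediate_value_Icc hlr hc ⟨not_lt.mp h2, h1.le⟩
    exact h x hx.1 hx.2 hx'

theorem kw_pair_real (a b c d ya yb yc yd se sf : ℝ) (hab : a < b) (hcd : c < d)
    (hb : yb = ya + se * (b - a)) (hd : yd = yc + sf * (d - c))
    (hno : ∀ x, a ≤ x → x ≤ b → c ≤ x → x ≤ d → ya + se * (x - a) = yc + sf * (x - c) →
      (x = a ∨ x = b) ∧ (x = c ∨ x = d))
    (hac : a = c → ya = yc) (hbd : b = d → yb = yd) (hne : ¬ (a = c ∧ b = d)) :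
    (if c < a ∧ a < d ∧ yc + sf * (a - c) < ya then (-1 : ℝ) else 1) *
    (if c < b ∧ b < d ∧ yc + sf * (b - c) < yb then (-1 : ℝ) else 1) *
    (if a < c ∧ c < b ∧ ya + se * (c - a) < yc then (-1 : ℝ) else 1) *
    (if a < d ∧ d < b ∧ ya + se * (d - a) < yd then (-1 : ℝ) else 1) =
    (if a < c ∨ (a = c ∧ sf < se) then (-1 : ℝ) else 1) * (if b ≤ c then (-1 : ℝ) else 1) *
    (if a < d then (-1 : ℝ) else 1) * (if b < d ∨ (b = d ∧ sf < se) then (-1 : ℝ) else 1) := by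
  have hsign : ∀ l r, l ≤ r → a ≤ l → c ≤ l → r ≤ b → r ≤ d →
      (∀ x, l ≤ x → x ≤ r → ¬ ((x = a ∨ x = b) ∧ (x = c ∨ x = d))) →
      (ya + se * (l - a) < yc + sf * (l - c) ↔ ya + se * (r - a) < yc + sf * (r - c)) ∧
      ya + se * (l - a) ≠ yc + sf * (l - c) ∧ ya + se * (r - a) ≠ yc + sf * (r - c) := by
    intro l r hlr h1 h2 h3 h4 h5
    have h6 : ∀ x, l ≤ x → x ≤ r → ya + se * (x - a) ≠ yc + sf * (x - c) := by
      intro x hx hx' h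
      exact h5 x hx hx' (hno x (by linarith) (by linarith) (by linarith) (by linarith) h)
    refine ⟨?_, h6 l le_rfl hlr, h6 r hlr le_rfl⟩
    have := kw_lin_sign (yc - sf * c - ya + se * a) (sf - se) l r hlr (by
      intro x hx hx' h
      apply h6 x hx hx'
      linarith)
    constructor
    · intro h
      have := this.1 (by linarith)
      linarith
    · intro h
      have := this.2 (by linarith)
      linarith
  rcases lt_trichotomy a c with h1 | h1 | h1
  · rcases le_or_gt b c with h2 | h2
    · have e1 : a < d := by linarith
      have e2 : b < d := by linarith
      simp [h1, h1.not_gt, h2, h2.not_gt, e1, e2, e2.not_gt]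
    · have e1 : a < d := by linarith
      rcases lt_trichotomy b d with h3 | h3 | h3
      · obtain ⟨k1, k2, k3⟩ := hsign c b h2.le h1.le le_rfl le_rfl h3.le (by
          rintro x hx hx' ⟨h | h, h' | h'⟩ <;> linarith)
        have k4 : (ya + se * (c - a) < yc) ↔ ¬ (yc + sf * (b - c) < yb) := by
          rw [hb, not_lt, le_iff_lt_or_eq, ← k1]
          constructor
          · intro h; left; linarith
          · rintro (h | h)
            · linarith
            · exact absurd h k3
        by_cases k5 : yc + sf * (b - c) < yb
        · simp [h1, h1.not_gt, h2, h2.not_ge, h3, h3.not_gt, e1, k4, k5]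
        · simp [h1, h1.not_gt, h2, h2.not_ge, h3, h3.not_gt, e1, k4, k5]
      · have hyy := hbd h3
        have k4 : (ya + se * (c - a) < yc) ↔ sf < se := by
          have : yc - (ya + se * (c - a)) = (se - sf) * (b - c) := by
            rw [hb, hd] at hyy; subst h3; linarith
          constructor
          · intro h; nlinarith
          · intro h; nlinarith
        have h5 : d = b := h3.symm
        subst h5
        by_cases k5 : sf < se <;>
        simp [h1, h1.not_gt, h2, h2.not_ge, e1, k4, k5]
      · obtain ⟨k1, k2, k3⟩ := hsign c d hcd.le h1.le le_rfl h3.le le_rfl (by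
          rintro x hx hx' ⟨h | h, h' | h'⟩ <;> linarith)
        rw [sub_self, mul_zero, add_zero, ← hd] at k1
        have e3 : ¬ b = d := h3.ne'
        by_cases k5 : ya + se * (d - a) < yd
        · simp [h1, h1.not_gt, h2, h2.not_ge, h3, h3.not_gt, e1, k1, k5, e3]
        · simp [h1, h1.not_gt, h2, h2.not_ge, h3, h3.not_gt, e1, k1, k5, e3]
  · have hyy := hac h1
    subst h1
    subst hyy
    rcases lt_trichotomy b d with h3 | h3 | h3
    · have k4 : (ya + sf * (b - a) < yb) ↔ sf < se := by
        rw [hb]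
        constructor
        · intro h; nlinarith
        · intro h; nlinarith
      by_cases k5 : sf < se <;>
        simp [hab, hab.not_ge, hcd, h3, h3.not_gt, k4, k5]
    · exact absurd ⟨rfl, h3⟩ hne
    · have k3 : se ≠ sf := by
        intro h
        have := hno d hcd.le h3.le hcd.le le_rfl (by rw [h])
        rcases this.1 with h' | h' <;> linarith
      have k4 : (ya + se * (d - a) < yd) ↔ ¬ sf < se := by
        rw [hd, not_lt]
        constructor
        · intro h; nlinarith
        · intro h
          have := lt_of_le_of_ne h k3
          nlinarith
      have e3 : ¬ b = d := h3.ne'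
      by_cases k5 : sf < se <;>
        simp [hab, hab.not_ge, hcd, h3, h3.not_gt, k4, k5, e3]
  · have e0 : ¬ a = c := h1.ne'
    have e1 : ¬ b ≤ c := by intro h; linarith
    rcases le_or_gt d a with h2 | h2
    · have e2 : d < b := by linarith
      have e3 : ¬ b = d := e2.ne'
      simp [h1.not_gt, e0, e1, h2.not_gt, e2.not_gt, e3]
    · have e2 : c < b := by linarith
      rcases lt_trichotomy b d with h3 | h3 | h3
      · obtain ⟨k1, k2, k3⟩ := hsign a b hab.le le_rfl h1.le le_rfl h3.le (by
          rintro x hx hx' ⟨h | h, h' | h'⟩ <;> linarith)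
        have k4 : (yc + sf * (a - c) < ya) ↔ (yc + sf * (b - c) < yb) := by
          rw [sub_self, mul_zero, add_zero] at k1 k2
          rw [← hb] at k1 k3
          have : ¬ (ya < yc + sf * (a - c)) ↔ ¬ (yb < yc + sf * (b - c)) := not_congr k1
          rw [not_lt, not_lt, le_iff_lt_or_eq, le_iff_lt_or_eq] at this
          constructor
          · intro h
            exact (this.1 (Or.inl h)).resolve_right k3.symm
          · intro h
            exact (this.2 (Or.inl h)).resolve_right k2.symm
        by_cases k5 : yc + sf * (b - c) < yb
        · simp [h1, h1.not_gt, e0, e1, e2, h2, h3, h3.not_gt, k4, k5]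
        · simp [h1, h1.not_gt, e0, e1, e2, h2, h3, h3.not_gt, k4, k5]
      · have hyy := hbd h3
        have h5 : d = b := h3.symm
        subst h5
        have k3 : se ≠ sf := by
          intro h
          have := hno a le_rfl hab.le h1.le h2.le (by
            rw [hb, hd] at hyy; rw [h] at hyy ⊢; linarith)
          rcases this.2 with h' | h' <;> linarith
        have k4 : (yc + sf * (a - c) < ya) ↔ ¬ sf < se := by
          have : ya - (yc + sf * (a - c)) = (sf - se) * (d - a) := by
            rw [hb, hd] at hyy; linarith
          rw [not_lt]
          constructor
          · intro h; nlinarith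
          · intro h
            have := lt_of_le_of_ne h k3
            nlinarith
        by_cases k5 : sf < se <;>
          simp [h1, h1.not_gt, e0, e1, h2, k4, k5]
      · obtain ⟨k1, k2, k3⟩ := hsign a d h2.le le_rfl h1.le h3.le le_rfl (by
          rintro x hx hx' ⟨h | h, h' | h'⟩ <;> linarith)
        have e3 : ¬ b = d := h3.ne'
        rw [sub_self, mul_zero, add_zero] at k1 k2
        rw [← hd] at k1 k3
        have k4 : (yc + sf * (a - c) < ya) ↔ ¬ (ya + se * (d - a) < yd) := by
          rw [← k1, not_lt, le_iff_lt_or_eq]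
          constructor
          · intro h; exact Or.inl h
          · intro h; exact h.resolve_right k2.symm
        by_cases k5 : ya + se * (d - a) < yd
        · simp [h1, h1.not_gt, e0, e1, e2, h2, h3, h3.not_gt, k4, k5, e3]
        · simp [h1, h1.not_gt, e0, e1, e2, h2, h3, h3.not_gt, k4, k5, e3]

/-- Angle of a nonvertical vector, in `(-π/2, 3π/2)`. -/
def kwAng (z : ℂ) : ℝ := Real.arctan (z.im / z.re) + if z.re < 0 then Real.pi else 0

theorem kwAng_spec (z : ℂ) (hz : z.re ≠ 0) :
    ∃ r : ℝ, 0 < r ∧ z = r * Complex.exp (Complex.I * kwAng z) := by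
  set s := z.im / z.re with hs
  have him : z.im = z.re * s := by rw [hs]; field_simp
  have hpos : 0 < Real.sqrt (1 + s ^ 2) := Real.sqrt_pos.mpr (by positivity)
  have hcos := Real.cos_arctan s
  have hsin := Real.sin_arctan s
  have key : ∀ φ : ℝ, Complex.exp (Complex.I * φ) = ⟨Real.cos φ, Real.sin φ⟩ := by
    intro φ
    rw [mul_comm, Complex.exp_mul_I]
    apply Complex.ext <;> simp [Complex.cos_ofReal_re, Complex.sin_ofReal_re]
  rcases lt_or_gt_of_ne hz with h | h
  · refine ⟨-z.re * Real.sqrt (1 + s ^ 2), by nlinarith, ?_⟩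
    rw [key, kwAng, if_pos h, Real.cos_add_pi, Real.sin_add_pi, ← hs, hcos, hsin]
    apply Complex.ext
    · simp; field_simp
    · simp; rw [him]; field_simp
  · refine ⟨z.re * Real.sqrt (1 + s ^ 2), by positivity, ?_⟩
    rw [key, kwAng, if_neg h.not_gt, add_zero, ← hs, hcos, hsin]
    apply Complex.ext
    · simp; field_simp
    · simp; rw [him]; field_simp

theorem kwAng_bounds (z : ℂ) : -(Real.pi / 2) < kwAng z ∧ kwAng z < 3 * Real.pi / 2 := by
  have h1 := Real.neg_pi_div_two_lt_arctan (z.im / z.re)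
  have h2 := Real.arctan_lt_pi_div_two (z.im / z.re)
  have h3 := Real.pi_pos
  unfold kwAng
  split_ifs <;> constructor <;> linarith

theorem kw_arg (r r' g g' : ℝ) (hr : 0 < r) (hr' : 0 < r') (hg : g ≠ g')
    (h1 : g' - g < 2 * Real.pi) (h2 : g - g' < 2 * Real.pi) :
    Complex.arg ((r' * Complex.exp (Complex.I * g')) / (-(r * Complex.exp (Complex.I * g))))
      = if g < g' then g' - g - Real.pi else g' - g + Real.pi := by
  have hpi := Real.pi_pos
  set φ : ℝ := if g < g' then g' - g - Real.pi else g' - g + Real.pi with hφ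
  have hmem : φ ∈ Set.Ioc (-Real.pi) Real.pi := by
    rw [hφ]
    split_ifs with h
    · constructor <;> linarith
    · have : g' < g := lt_of_le_of_ne (not_lt.mp h) hg.symm
      constructor <;> linarith
  have he : Complex.exp (Complex.I * φ)
      = - (Complex.exp (Complex.I * g') / Complex.exp (Complex.I * g)) := by
    rw [← Complex.exp_sub, hφ]
    split_ifs with h
    · push_cast
      rw [show Complex.I * ((g' : ℂ) - g - Real.pi)
        = (Complex.I * g' - Complex.I * g) - Real.pi * Complex.I by ring, Complex.exp_sub,
        Complex.exp_pi_mul_I]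
      ring
    · push_cast
      rw [show Complex.I * ((g' : ℂ) - g + Real.pi)
        = (Complex.I * g' - Complex.I * g) + Real.pi * Complex.I by ring, Complex.exp_add,
        Complex.exp_pi_mul_I]
      ring
  have hz : (r' * Complex.exp (Complex.I * g')) / (-(r * Complex.exp (Complex.I * g)))
      = ((r' / r : ℝ) : ℂ) * (Complex.cos φ + Complex.sin φ * Complex.I) := by
    rw [← Complex.exp_mul_I, mul_comm (φ : ℂ), he]
    have : (r : ℂ) ≠ 0 := by exact_mod_cast hr.ne'
    have := Complex.exp_ne_zero (Complex.I * g)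
    push_cast
    field_simp
  rw [hz]
  exact Complex.arg_mul_cos_add_sin_mul_I (by positivity) hmem

theorem kw_phase (r r' g g' : ℝ) (hr : 0 < r) (hr' : 0 < r') (hg : g ≠ g')
    (h1 : g' - g < 2 * Real.pi) (h2 : g - g' < 2 * Real.pi) :
    Complex.exp (Complex.I / 2 * (Complex.arg ((r' * Complex.exp (Complex.I * g')) /
      (-(r * Complex.exp (Complex.I * g)))) : ℂ))
      = Complex.I * Complex.exp (Complex.I * g' / 2) / Complex.exp (Complex.I * g / 2) *
        (if g < g' then -1 else 1) := by
  rw [kw_arg r r' g g' hr hr' hg h1 h2]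
  have hI : Complex.exp (Real.pi / 2 * Complex.I) = Complex.I := Complex.exp_pi_div_two_mul_I
  split_ifs with h
  · push_cast
    rw [show Complex.I / 2 * ((g' : ℂ) - g - Real.pi)
      = Complex.I * g' / 2 - Complex.I * g / 2 - Real.pi / 2 * Complex.I by ring,
      Complex.exp_sub, Complex.exp_sub, hI]
    have := Complex.exp_ne_zero (Complex.I * g / 2)
    have := Complex.I_ne_zero
    field_simp
    simp
  · push_cast
    rw [show Complex.I / 2 * ((g' : ℂ) - g + Real.pi)
      = Complex.I * g' / 2 - Complex.I * g / 2 + Real.pi / 2 * Complex.I by ring,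
      Complex.exp_add, Complex.exp_sub, hI]
    ring

/-- Linear algebra: solving the Kac–Ward system from the Green function. -/
theorem kw_solve {D : Type*} [Fintype D] [DecidableEq D] (bar : D → D)
    (ρ : D → ℂ) (hρ : ∀ d, ρ d ≠ 0) (M : D → D → ℝ) (σ w : D → ℝ) (g : D → D → ℝ) (P : ℝ)
    (hP : P ≠ 0) (hσ : ∀ c, Complex.I * ρ c / ρ (bar c) = σ c)
    (hg : ∀ a b, g a b = P * M a b + ∑ c, M a c * (σ c * w c * g (bar c) b))
    (A W S : Matrix D D ℂ)
    (hA : ∀ d d', A d d' = Complex.I * ρ d' / ρ (bar d) * (M (bar d) d' : ℂ))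
    (hW : W = A * Matrix.diagonal (fun d => (w d : ℂ)))
    (hdet : IsUnit (1 - W).det) (hS : S = (1 - W)⁻¹ * A) (d : D) :
    S d d = ((σ d * g (bar d) d / P : ℝ) : ℂ) := by
  have hPC : (P : ℂ) ≠ 0 := by exact_mod_cast hP
  let T : Matrix D D ℂ := fun d d' => Complex.I * ρ d' / ρ (bar d) * (g (bar d) d' : ℂ) / P
  have hT : (1 - W) * T = A := by
    ext d d'
    rw [sub_mul, one_mul, Matrix.sub_apply, Matrix.mul_apply]
    have h1 : ∀ c, W d c = A d c * w c := by
      intro c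
      rw [hW, Matrix.mul_diagonal]
    have h2 : ∀ c, W d c * T c d' = Complex.I * ρ d' / ρ (bar d) / P *
        ((M (bar d) c * (σ c * w c * g (bar c) d') : ℝ) : ℂ) := by
      intro c
      rw [h1, hA]
      push_cast
      rw [← hσ c]
      simp only [T]
      have := hρ (bar c)
      have := hρ (bar d)
      field_simp
    rw [Finset.sum_congr rfl (fun c _ => h2 c), ← Finset.mul_sum, hA]
    have h3 := congrArg (fun x : ℝ => (x : ℂ)) (hg (bar d) d')
    simp only [Complex.ofReal_add, Complex.ofReal_sum, Complex.ofReal_mul] at h3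
    simp only [T, Complex.ofReal_mul]
    rw [h3]
    have := hρ (bar d)
    field_simp
    ring
  have hST : S = T := by
    rw [hS, ← hT, ← mul_assoc, Matrix.nonsing_inv_mul _ hdet, one_mul]
  rw [hST]
  simp only [T]
  rw [hσ]
  push_cast
  ring

theorem kwP0_bar {D K U : Type*} [Fintype D] [DecidableEq D] [DecidableEq U] [LinearOrder K]
    (key : D → K) (bar : D → D) (hbar : ∀ d, bar (bar d) = d)
    (ν : D → U) (w : D → ℝ) (c : D) (p q : U) :
    kwP0 key bar ν w (bar c) p q = kwP0 key bar ν w c q p := by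
  classical
  unfold kwP0
  apply Finset.sum_congr
  · ext S
    simp only [Finset.mem_filter, Finset.mem_univ, true_and]
    constructor
    · rintro ⟨h, h'⟩; exact ⟨h, fun h2 => h' (h c h2)⟩
    · rintro ⟨h, h'⟩; exact ⟨h, fun h2 => h' (by have := h _ h2; rwa [hbar] at this)⟩
  · intro S _
    exact if_congr (kwEven_symm ν S p q) rfl rfl

theorem kwP0_self {D K U : Type*} [Fintype D] [DecidableEq D] [DecidableEq U] [LinearOrder K]
    (key : D → K) (bar : D → D) (ν : D → U) (w : D → ℝ) (c : D) (p q : U) :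
    kwP0 key bar ν w c p p = kwP0 key bar ν w c q q := by
  classical
  exact Finset.sum_congr rfl (fun S _ => if_congr (kwEven_self ν S p q) rfl rfl)

theorem kwP0_symm {D K U : Type*} [Fintype D] [DecidableEq D] [DecidableEq U] [LinearOrder K]
    (key : D → K) (bar : D → D) (ν : D → U) (w : D → ℝ) (c : D) (p q : U) :
    kwP0 key bar ν w c p q = kwP0 key bar ν w c q p := by
  classical
  exact Finset.sum_congr rfl (fun S _ => if_congr (kwEven_symm ν S p q) rfl rfl)

theorem kw_final_alg (P0 P1 w P N : ℝ) (hP : P ≠ 0) (h1 : P = P0 + w * P1)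
    (h2 : N = P1 + w * P0) :
    N / P = w - (1 / 2) * (1 - w ^ 2) * (-(P1 / P) + -(P1 / P)) := by
  have h3 : P0 = P - w * P1 := by linarith
  rw [h2, h3]
  field_simp
  ring

/-- The main theorem when no edge is vertical. -/
theorem kw_main (G : SimpleGraph V) [DecidableRel G.Adj]
    (v : V → ℂ) (hre : ∀ i j, i ≠ j → (v i).re ≠ (v j).re)
    (hX : ∀ i j k l : V, G.Adj i j → G.Adj k l → s(i, j) ≠ s(k, l) → ∀ s t : ℝ,
      0 ≤ s → s ≤ 1 → 0 ≤ t → t ≤ 1 → v i + s * (v j - v i) = v k + t * (v l - v k) →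
      (v i + s * (v j - v i) = v i ∨ v i + s * (v j - v i) = v j) ∧
      (v i + s * (v j - v i) = v k ∨ v i + s * (v j - v i) = v l))
    (θ : Sym2 V → ℝ)
    (A W S : Matrix {p : V × V // G.Adj p.1 p.2} {p : V × V // G.Adj p.1 p.2} ℂ)
    (hA : ∀ d d' : {p : V × V // G.Adj p.1 p.2}, A d d' =
      if d.1.2 = d'.1.1 ∧ d.1.1 ≠ d'.1.2 then
        Complex.exp (Complex.I / 2 *
          (Complex.arg ((v d'.1.2 - v d.1.2) / (v d.1.2 - v d.1.1)) : ℂ))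
      else 0)
    (hW : W = A * Matrix.diagonal (fun d => (Real.tanh (θ s(d.1.1, d.1.2)) : ℂ)))
    (hdet : IsUnit (1 - W).det)
    (hS : S = (1 - W)⁻¹ * A) (i j : V) (h : G.Adj i j) :
      (momentPair G (fun _ => 0) θ i j : ℂ)
        = (Real.tanh (θ s(i, j)) : ℂ)
          - (1 / 2) * (1 - (Real.tanh (θ s(i, j)) : ℂ) ^ 2) *
              (S ⟨(i, j), h⟩ ⟨(i, j), h⟩ + S ⟨(j, i), h.symm⟩ ⟨(j, i), h.symm⟩) := by
  classical
  have hpi := Real.pi_pos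
  have hvv : ∀ i j, v i = v j → i = j := fun i j h => by
    by_contra h'; exact hre i j h' (by rw [h])
  have hreq : ∀ i j, (v i).re = (v j).re → i = j := fun i j h => by
    by_contra h'; exact hre i j h' h
  let bar := kwBar G
  let ν : {p : V × V // G.Adj p.1 p.2} → V := fun d => d.1.1
  let z : {p : V × V // G.Adj p.1 p.2} → ℂ := fun d => v d.1.2 - v d.1.1
  let γ : {p : V × V // G.Adj p.1 p.2} → ℝ := fun d => kwAng (z d)
  let sl : {p : V × V // G.Adj p.1 p.2} → ℝ := fun d => (z d).im / (z d).re
  let key : {p : V × V // G.Adj p.1 p.2} → ℝ ×ₗ ℝ := fun d => toLex ((v d.1.1).re, - γ d)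
  have hbar : ∀ d, bar (bar d) = d := fun d => rfl
  have hfix : ∀ d, bar d ≠ d := by
    rintro ⟨⟨a, b⟩, h⟩ h'
    have : b = a := congrArg (fun d => d.1.1) h'
    exact h.ne this.symm
  have hzre : ∀ d, (z d).re = (v d.1.2).re - (v d.1.1).re := fun d => by simp [z]
  have hzim : ∀ d, (z d).im = (v d.1.2).im - (v d.1.1).im := fun d => by simp [z]
  have hz0 : ∀ d, (z d).re ≠ 0 := fun d => by
    rw [hzre, sub_ne_zero]; exact hre _ _ d.2.ne'
  have hzbar : ∀ d, z (bar d) = - z d := fun d => by simp [z, bar, kwBar]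
  have hslbar : ∀ d, sl (bar d) = sl d := fun d => by
    simp only [sl, hzbar, Complex.neg_re, Complex.neg_im, neg_div_neg_eq]
  have hlt : ∀ a b, key a < key b ↔ (v a.1.1).re < (v b.1.1).re ∨
      ((v a.1.1).re = (v b.1.1).re ∧ γ b < γ a) := by
    intro a b
    simp only [key, Prod.Lex.toLex_lt_toLex, neg_lt_neg_iff]
  have hlow : ∀ d, key d < key (bar d) ↔ (v d.1.1).re < (v d.1.2).re := by
    intro d
    rw [hlt]
    constructor
    · rintro (h | h)
      · exact h
      · exact absurd h.1 (hre _ _ d.2.ne)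
    · exact Or.inl
  have hγR : ∀ d, (v d.1.1).re < (v d.1.2).re → γ d = Real.arctan (sl d) := by
    intro d hd
    have : ¬ (z d).re < 0 := by rw [hzre]; linarith
    simp only [γ, kwAng, if_neg this, add_zero, sl]
  have hγL : ∀ d, (v d.1.2).re < (v d.1.1).re → γ d = Real.arctan (sl d) + Real.pi := by
    intro d hd
    have : (z d).re < 0 := by rw [hzre]; linarith
    simp only [γ, kwAng, if_pos this, sl]
  have hγbar : ∀ d, (v d.1.1).re < (v d.1.2).re → γ (bar d) = Real.arctan (sl d) + Real.pi := by
    intro d hd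
    rw [hγL (bar d) hd, hslbar]
  have hb1 := Real.neg_pi_div_two_lt_arctan
  have hb2 := Real.arctan_lt_pi_div_two
  -- injectivity of the key
  have haux : ∀ a b : {p : V × V // G.Adj p.1 p.2}, a.1.1 = b.1.1 → ∀ t : ℝ, 0 < t → t ≤ 1 →
      z b = t * z a → a.1.2 = b.1.2 := by
    intro a b hab t ht ht1 hz
    by_contra hne
    have hs : s(a.1.1, a.1.2) ≠ s(b.1.1, b.1.2) := by
      rw [hab]
      intro h
      exact hne (Sym2.congr_right.mp h)
    have hpt : v a.1.1 + t * (v a.1.2 - v a.1.1) = v b.1.2 := by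
      change v b.1.2 - v b.1.1 = t * (v a.1.2 - v a.1.1) at hz
      rw [← hz, hab]; ring
    have := hX _ _ _ _ a.2 b.2 hs t 1 ht.le ht1 zero_le_one le_rfl (by
      rw [hpt]; push_cast; ring)
    rw [hpt] at this
    rcases this.1 with h' | h'
    · exact b.2.ne' (by rw [hvv _ _ h', hab])
    · exact hne (hvv _ _ h').symm
  have hk : Function.Injective key := by
    intro a b hab
    have h1 : (v a.1.1).re = (v b.1.1).re := congrArg (fun x => (ofLex x).1) hab
    have h2 : γ a = γ b := by
      have : - γ a = - γ b := congrArg (fun x => (ofLex x).2) hab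
      linarith
    have h3 : a.1.1 = b.1.1 := hreq _ _ h1
    have h4 : 0 < (z b).re / (z a).re ∧ sl a = sl b := by
      have ha := hre _ _ a.2.ne
      have hb := hre _ _ b.2.ne
      have := hb1 (sl a); have := hb2 (sl a); have := hb1 (sl b); have := hb2 (sl b)
      rcases lt_or_gt_of_ne ha with ha | ha <;> rcases lt_or_gt_of_ne hb with hb | hb
      · rw [hγR a ha, hγR b hb] at h2
        refine ⟨div_pos (by rw [hzre]; linarith) (by rw [hzre]; linarith), Real.arctan_injective h2⟩
      · rw [hγR a ha, hγL b hb] at h2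
        exfalso; linarith
      · rw [hγL a ha, hγR b hb] at h2
        exfalso; linarith
      · rw [hγL a ha, hγL b hb] at h2
        refine ⟨div_pos_of_neg_of_neg (by rw [hzre]; linarith) (by rw [hzre]; linarith),
          Real.arctan_injective (by linarith)⟩
    have h5 : z b = ((z b).re / (z a).re : ℝ) * z a := by
      have e1 : (z a).im = sl a * (z a).re := (div_mul_cancel₀ _ (hz0 a)).symm
      have e2 : (z b).im = sl b * (z b).re := (div_mul_cancel₀ _ (hz0 b)).symm
      have e0 := hz0 a
      apply Complex.ext
      · rw [Complex.re_ofReal_mul]; field_simp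
      · rw [Complex.im_ofReal_mul, e1, e2, h4.2]; field_simp
    have h6 : a.1.2 = b.1.2 := by
      rcases le_total ((z b).re / (z a).re) 1 with h7 | h7
      · exact haux a b h3 _ h4.1 h7 h5
      · have h8 : z a = (((z b).re / (z a).re)⁻¹ : ℝ) * z b := by
          rw [h5]
          have : (((z b).re / (z a).re : ℝ) : ℂ) ≠ 0 := by exact_mod_cast h4.1.ne'
          rw [← h5, Complex.ofReal_inv]
          nth_rewrite 2 [h5]
          rw [inv_mul_cancel_left₀ this]
        exact (haux b a h3.symm _ (inv_pos.mpr h4.1) (inv_le_one_of_one_le₀ h7) h8).symm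
    exact Subtype.ext (Prod.ext h3 h6)
  have hblock : ∀ a b c, ν a = ν c → ν b ≠ ν a → (key a < key b ↔ key c < key b) := by
    intro a b c h1 h2
    have h1 : a.1.1 = c.1.1 := h1
    have h3 : (v a.1.1).re ≠ (v b.1.1).re := hre _ _ (Ne.symm h2)
    rw [hlt, hlt, ← h1]
    simp [h3]
  let AB : V → {p : V × V // G.Adj p.1 p.2} → ℝ := fun u d =>
    if (v d.1.1).re < (v u).re ∧ (v u).re < (v d.1.2).re ∧
      (v d.1.1).im + sl d * ((v u).re - (v d.1.1).re) < (v u).im then -1 else 1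
  have hsq : ∀ u d, AB u d ^ 2 = 1 := by
    intro u d
    simp only [AB]
    split_ifs <;> norm_num
  have hAB0 : ∀ c, AB (ν c) c = 1 := fun c => by simp [AB, ν]
  have hAB1 : ∀ c, AB (ν (bar c)) c = 1 := fun c => by simp [AB, ν, bar, kwBar]
  have hAB : ∀ e f, key e < key (bar e) → key f < key (bar f) → e ≠ f →
      AB (ν e) f * AB (ν (bar e)) f * AB (ν f) e * AB (ν (bar f)) e
        = (if key e < key f then -1 else 1) * (if key (bar e) < key f then -1 else 1)
          * (if key e < key (bar f) then -1 else 1)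
          * (if key (bar e) < key (bar f) then -1 else 1) := by
    intro e f he hf hef
    rw [hlow] at he hf
    have hsle : (v e.1.2).im = (v e.1.1).im + sl e * ((v e.1.2).re - (v e.1.1).re) := by
      have : sl e * (z e).re = (z e).im := div_mul_cancel₀ _ (hz0 e)
      rw [hzre, hzim] at this
      linarith
    have hslf : (v f.1.2).im = (v f.1.1).im + sl f * ((v f.1.2).re - (v f.1.1).re) := by
      have : sl f * (z f).re = (z f).im := div_mul_cancel₀ _ (hz0 f)
      rw [hzre, hzim] at this
      linarith
    have hs : s(e.1.1, e.1.2) ≠ s(f.1.1, f.1.2) := by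
      intro h
      rw [Sym2.eq_iff] at h
      rcases h with h | h
      · exact hef (Subtype.ext (Prod.ext h.1 h.2))
      · rw [h.1, h.2] at he
        linarith
    have hreal := kw_pair_real (v e.1.1).re (v e.1.2).re (v f.1.1).re (v f.1.2).re
      (v e.1.1).im (v e.1.2).im (v f.1.1).im (v f.1.2).im (sl e) (sl f) he hf hsle hslf
      (by
        intro x h1 h2 h3 h4 h5
        have hpe : ((v e.1.1 + ((x - (v e.1.1).re) / ((v e.1.2).re - (v e.1.1).re) : ℝ) *
            (v e.1.2 - v e.1.1) : ℂ)) = ⟨x, (v e.1.1).im + sl e * (x - (v e.1.1).re)⟩ := by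
          have : (v e.1.2).re - (v e.1.1).re ≠ 0 := by linarith
          apply Complex.ext
          · rw [Complex.add_re, Complex.re_ofReal_mul, Complex.sub_re]; field_simp; ring
          · rw [Complex.add_im, Complex.im_ofReal_mul, Complex.sub_im, hsle]; field_simp; ring
        have hpf : ((v f.1.1 + ((x - (v f.1.1).re) / ((v f.1.2).re - (v f.1.1).re) : ℝ) *
            (v f.1.2 - v f.1.1) : ℂ)) = ⟨x, (v f.1.1).im + sl f * (x - (v f.1.1).re)⟩ := by
          have : (v f.1.2).re - (v f.1.1).re ≠ 0 := by linarith
          apply Complex.ext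
          · rw [Complex.add_re, Complex.re_ofReal_mul, Complex.sub_re]; field_simp; ring
          · rw [Complex.add_im, Complex.im_ofReal_mul, Complex.sub_im, hslf]; field_simp; ring
        have := hX _ _ _ _ e.2 f.2 hs
          ((x - (v e.1.1).re) / ((v e.1.2).re - (v e.1.1).re))
          ((x - (v f.1.1).re) / ((v f.1.2).re - (v f.1.1).re))
          (div_nonneg (by linarith) (by linarith))
          (by rw [div_le_one (by linarith)]; linarith)
          (div_nonneg (by linarith) (by linarith))
          (by rw [div_le_one (by linarith)]; linarith)
          (by rw [hpe, hpf, h5])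
        rw [hpe] at this
        exact ⟨this.1.imp (congrArg Complex.re) (congrArg Complex.re),
          this.2.imp (congrArg Complex.re) (congrArg Complex.re)⟩)
      (fun h => by rw [hreq _ _ h]) (fun h => by rw [hreq _ _ h])
      (fun h => hef (Subtype.ext (Prod.ext (hreq _ _ h.1) (hreq _ _ h.2))))
    have k1 : key e < key f ↔ ((v e.1.1).re < (v f.1.1).re ∨
        ((v e.1.1).re = (v f.1.1).re ∧ sl f < sl e)) := by
      rw [hlt, hγR e he, hγR f hf, Real.arctan_strictMono.lt_iff_lt]
    have k2 : key (bar e) < key f ↔ (v e.1.2).re ≤ (v f.1.1).re := by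
      rw [hlt, hγbar e he, hγR f hf, le_iff_lt_or_eq]
      have : Real.arctan (sl f) < Real.arctan (sl e) + Real.pi := by
        linarith [hb1 (sl e), hb2 (sl f)]
      simp only [this, and_true]
      rfl
    have k3 : key e < key (bar f) ↔ (v e.1.1).re < (v f.1.2).re := by
      rw [hlt, hγbar f hf, hγR e he]
      have : ¬ (Real.arctan (sl f) + Real.pi < Real.arctan (sl e)) := by
        linarith [hb1 (sl f), hb2 (sl e)]
      simp only [this, and_false, or_false]
      rfl
    have k4 : key (bar e) < key (bar f) ↔ ((v e.1.2).re < (v f.1.2).re ∨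
        ((v e.1.2).re = (v f.1.2).re ∧ sl f < sl e)) := by
      rw [hlt, hγbar f hf, hγbar e he, add_lt_add_iff_right, Real.arctan_strictMono.lt_iff_lt]
      rfl
    rw [if_congr k1 rfl rfl, if_congr k2 rfl rfl, if_congr k3 rfl rfl, if_congr k4 rfl rfl,
      ← hreal]
    rfl
  let w : {p : V × V // G.Adj p.1 p.2} → ℝ := fun d => Real.tanh (θ s(d.1.1, d.1.2))
  have hw : ∀ d, w (bar d) = w d := fun d => by
    simp only [w, bar, kwBar]
    rw [Sym2.eq_swap]
  obtain ⟨g, hg1, hg2⟩ := kw_abstract key hk bar hbar hfix ν hblock AB hsq hAB0 hAB1 hAB w hw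
  obtain ⟨hP, hmom⟩ := kw_moment G key hk θ i j
  change kwP bar ν (kwWt key bar w) i i ≠ 0 at hP
  change _ = kwP bar ν (kwWt key bar w) i j / kwP bar ν (kwWt key bar w) i i at hmom
  let ρ : {p : V × V // G.Adj p.1 p.2} → ℂ := fun d => Complex.exp (Complex.I * γ d / 2)
  have hρ : ∀ d, ρ d ≠ 0 := fun d => Complex.exp_ne_zero _
  have hσ : ∀ c, Complex.I * ρ c / ρ (bar c) = (kwSg key c (bar c) : ℂ) := by
    intro c
    have hI : Complex.exp (Real.pi / 2 * Complex.I) = Complex.I := Complex.exp_pi_div_two_mul_I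
    have hne := hre _ _ c.2.ne
    rcases lt_or_gt_of_ne hne with hc | hc
    · have hl : key c < key (bar c) := (hlow c).2 hc
      have e1 : ρ (bar c) = ρ c * Complex.I := by
        simp only [ρ]
        rw [hγbar c hc, hγR c hc]
        nth_rewrite 3 [← hI]
        rw [← Complex.exp_add]
        congr 1
        push_cast
        ring
      rw [e1, kwSg, if_pos hl]
      have := hρ c
      have := Complex.I_ne_zero
      push_cast
      field_simp
    · have hl : key (bar c) < key c := by
        have := (hlow (bar c)).2 hc
        rwa [hbar] at this
      have e1 : ρ c = ρ (bar c) * Complex.I := by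
        simp only [ρ]
        have h1 := hγbar (bar c) hc
        rw [hbar] at h1
        rw [h1, hγR (bar c) hc]
        nth_rewrite 3 [← hI]
        rw [← Complex.exp_add]
        congr 1
        push_cast
        ring
      rw [e1, kwSg, if_neg hl.not_gt, if_pos hl]
      have := hρ (bar c)
      push_cast
      field_simp
      simp
  have hA' : ∀ d d', A d d' = Complex.I * ρ d' / ρ (bar d) * (kwM key ν (bar d) d' : ℂ) := by
    intro d d'
    rw [hA]
    by_cases h1 : d.1.2 = d'.1.1
    · have hν : ν (bar d) = ν d' := h1
      by_cases h2 : d.1.1 = d'.1.2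
      · have : bar d = d' := Subtype.ext (Prod.ext h1 h2)
        rw [if_neg (by simp [h2]), kwM, if_pos hν, this, kwSg]
        simp
      · rw [if_pos ⟨h1, h2⟩, kwM, if_pos hν]
        obtain ⟨r, hr, hzr⟩ := kwAng_spec (z (bar d)) (hz0 _)
        obtain ⟨r', hr', hzr'⟩ := kwAng_spec (z d') (hz0 _)
        have hne : bar d ≠ d' := fun h => h2 (congrArg (fun x => x.1.2) h)
        have hrr : (v (bar d).1.1).re = (v d'.1.1).re := by
          change (v d.1.2).re = _
          rw [h1]
        have hγne : γ (bar d) ≠ γ d' := by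
          intro h
          apply hne
          apply hk
          simp only [key]
          rw [hrr, h]
        have hb := kwAng_bounds (z (bar d))
        have hb' := kwAng_bounds (z d')
        have hph := kw_phase r r' (γ (bar d)) (γ d') hr hr' hγne
          (by simp only [γ]; linarith [hb.1, hb'.2]) (by simp only [γ]; linarith [hb.2, hb'.1])
        have e1 : v d'.1.2 - v d.1.2 = r' * Complex.exp (Complex.I * γ d') := by
          rw [h1]; exact hzr'
        have e2 : v d.1.2 - v d.1.1 = -(r * Complex.exp (Complex.I * γ (bar d))) := by
          have : z (bar d) = r * Complex.exp (Complex.I * γ (bar d)) := hzr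
          rw [← this, hzbar, neg_neg]
        rw [e1, e2, hph]
        congr 1
        unfold kwSg
        rcases lt_or_gt_of_ne hγne with hl | hl
        · have hk1 : key d' < key (bar d) := by rw [hlt]; exact Or.inr ⟨hrr.symm, hl⟩
          rw [if_pos hl, if_neg hk1.not_gt, if_pos hk1]; push_cast; rfl
        · have hk1 : key (bar d) < key d' := by rw [hlt]; exact Or.inr ⟨hrr, hl⟩
          rw [if_neg hl.not_gt, if_pos hk1]; push_cast; rfl
    · have hν : ¬ ν (bar d) = ν d' := h1
      rw [if_neg (fun h => h1 h.1), kwM, if_neg hν]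
      simp
  have hsol := kw_solve bar ρ hρ (kwM key ν) (fun c => kwSg key c (bar c)) w g
    (kwP bar ν (kwWt key bar w) i i) hP hσ (hg1 i) A W S hA' hW hdet hS
  have hsol' : ∀ d, S d d = ((-(kwP0 key bar ν w d (ν (bar d)) (ν d)
      / kwP bar ν (kwWt key bar w) i i) : ℝ) : ℂ) := by
    intro d
    rw [hsol d, hg2 d]
    congr 1
    have hkk : key (bar d) ≠ key d := fun h => hfix d (hk h)
    have : kwSg key d (bar d) * kwSg key (bar d) d = -1 := by
      unfold kwSg
      rcases lt_or_gt_of_ne hkk with h | h <;> simp [h, h.not_gt]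
    rw [← mul_assoc, this]; ring
  let d0 : {p : V × V // G.Adj p.1 p.2} := ⟨(i, j), h⟩
  have hS1 : S ⟨(i, j), h⟩ ⟨(i, j), h⟩ = ((-(kwP0 key bar ν w d0 j i
      / kwP bar ν (kwWt key bar w) i i) : ℝ) : ℂ) := hsol' d0
  have hS2 : S ⟨(j, i), h.symm⟩ ⟨(j, i), h.symm⟩ = ((-(kwP0 key bar ν w d0 j i
      / kwP bar ν (kwWt key bar w) i i) : ℝ) : ℂ) := by
    rw [← kwP0_bar key bar hbar]
    exact hsol' (bar d0)
  have hPi : kwP bar ν (kwWt key bar w) i i = kwP0 key bar ν w d0 i i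
      + w d0 * kwP0 key bar ν w d0 j i := kwP_split key hk bar hbar hfix ν w hw d0 i
  have hPj : kwP bar ν (kwWt key bar w) i j = kwP0 key bar ν w d0 j i
      + w d0 * kwP0 key bar ν w d0 i i := by
    rw [kwP0_symm key bar ν w d0 j i, kwP0_self key bar ν w d0 i j]
    exact kwP_split key hk bar hbar hfix ν w hw d0 j
  have hw0 : Real.tanh (θ s(i, j)) = w d0 := rfl
  rw [hS1, hS2, hmom, hw0]
  have hfinal : kwP bar ν (kwWt key bar w) i j / kwP bar ν (kwWt key bar w) i i
      = w d0 - (1 / 2) * (1 - w d0 ^ 2) * (-(kwP0 key bar ν w d0 j i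
      / kwP bar ν (kwWt key bar w) i i) + -(kwP0 key bar ν w d0 j i
      / kwP bar ν (kwWt key bar w) i i)) := by
    exact kw_final_alg _ _ _ _ _ hP hPi hPj
  rw [hfinal]
  push_cast
  ring

/-- With the Kac–Ward matrices `A`, `D`, `W = A·D` of a straight-line planar
embedding of `G`, `w_{ij} = tanh θ_{ij}` and `S = (I−W)⁻¹A`, the edge moments of the
zero-field Ising model satisfy
`μ_{ij} = w_{ij} − (1/2)(1 − w_{ij}²)(S_{(i,j),(i,j)} + S_{(j,i),(j,i)})`. -/
theorem kac_ward_edge_moments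
    (G : SimpleGraph V) [DecidableRel G.Adj]
    (v : V → ℂ) (hinj : Function.Injective v)
    (hcross : ∀ i j k l : V, G.Adj i j → G.Adj k l → s(i, j) ≠ s(k, l) →
      segment ℝ (v i) (v j) ∩ segment ℝ (v k) (v l) ⊆ ({v i, v j} : Set ℂ) ∩ {v k, v l})
    (hvert : ∀ i j : V, G.Adj i j → ∀ k : V, k ≠ i → k ≠ j →
      v k ∉ openSegment ℝ (v i) (v j))
    (θ : Sym2 V → ℝ)
    (A W S : Matrix {p : V × V // G.Adj p.1 p.2} {p : V × V // G.Adj p.1 p.2} ℂ)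
    (hA : ∀ d d' : {p : V × V // G.Adj p.1 p.2}, A d d' =
      if d.1.2 = d'.1.1 ∧ d.1.1 ≠ d'.1.2 then
        Complex.exp (Complex.I / 2 *
          (Complex.arg ((v d'.1.2 - v d.1.2) / (v d.1.2 - v d.1.1)) : ℂ))
      else 0)
    (hW : W = A * Matrix.diagonal (fun d => (Real.tanh (θ s(d.1.1, d.1.2)) : ℂ)))
    (hdet : IsUnit (1 - W).det)
    (hS : S = (1 - W)⁻¹ * A) :
    ∀ i j : V, ∀ h : G.Adj i j,
      (momentPair G (fun _ => 0) θ i j : ℂ)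
        = (Real.tanh (θ s(i, j)) : ℂ)
          - (1 / 2) * (1 - (Real.tanh (θ s(i, j)) : ℂ) ^ 2) *
              (S ⟨(i, j), h⟩ ⟨(i, j), h⟩ + S ⟨(j, i), h.symm⟩ ⟨(j, i), h.symm⟩) := by
  classical
  -- a rotation making all the real parts distinct
  obtain ⟨t, ht⟩ := Infinite.exists_notMem_finset
    ((Finset.univ : Finset (V × V)).image (fun p => (v p.1 - v p.2).re / (v p.1 - v p.2).im))
  have hre : ∀ i j, i ≠ j → ((1 + t * Complex.I) * v i).re ≠ ((1 + t * Complex.I) * v j).re := by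
    intro i j hij hEq
    have h1 : (v i - v j).re - t * (v i - v j).im = 0 := by
      simp at hEq ⊢
      linarith
    by_cases him : (v i - v j).im = 0
    · apply hij
      apply hinj
      rw [← sub_eq_zero]
      apply Complex.ext
      · rw [him] at h1; simpa using h1
      · exact him
    · apply ht
      rw [Finset.mem_image]
      refine ⟨(i, j), Finset.mem_univ _, ?_⟩
      rw [div_eq_iff him]; linarith
  have hu : (1 + t * Complex.I : ℂ) ≠ 0 := by
    intro h0
    have := congrArg Complex.re h0
    simp at this
  intro i j h
  refine kw_main G (fun i => (1 + t * Complex.I) * v i) hre ?_ θ A W S ?_ hW hdet hS i j h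
  · intro i j k l hij hkl hne s r hs0 hs1 hr0 hr1 hEq
    have e1 : ∀ (x y : ℂ) (s : ℝ), (1 + t * Complex.I) * x + s * ((1 + t * Complex.I) * y
        - (1 + t * Complex.I) * x) = (1 + t * Complex.I) * (x + s * (y - x)) := by
      intro x y s; ring
    simp only [e1] at hEq ⊢
    have hEq' := mul_left_cancel₀ hu hEq
    have hm1 : v i + s * (v j - v i) ∈ segment ℝ (v i) (v j) := by
      rw [segment_eq_image']
      exact ⟨s, ⟨hs0, hs1⟩, by simp⟩
    have hm2 : v i + s * (v j - v i) ∈ segment ℝ (v k) (v l) := by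
      rw [segment_eq_image', hEq']
      exact ⟨r, ⟨hr0, hr1⟩, by simp⟩
    have := hcross i j k l hij hkl hne ⟨hm1, hm2⟩
    simp only [Set.mem_inter_iff, Set.mem_insert_iff, Set.mem_singleton_iff] at this
    exact ⟨this.1.imp (congrArg _) (congrArg _), this.2.imp (congrArg _) (congrArg _)⟩
  · intro d d'
    rw [hA]
    simp only [← mul_sub, mul_div_mul_left _ _ hu]
end
end
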